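/- arXiv:math/0301304 — 4 statements merged into one kernel-verified Lean document; each statement's English description precedes it below -/
import Mathlib

section
/- Let (A_n, u_n)_{n∈ℕ} be an inverse system of abelian groups satisfying the Mittag-Leffler condition: for each n, the decreasing chain of subgroups im(A_{n+i} → A_n) (i ≥ 0, images under composites of transition maps) is eventually constant. Then lim¹ A_n = 0; equivalently, the homomorphism ∏_n A_n → ∏_n A_n given by (a_n)_n ↦ (a_n − u_{n+1}(a_{n+1}))_n is surjective. -/
/-- The composite transition map `A (n + i) →+ A n` of an inverse system indexed by `ℕ`. -/
def transitionComp {A : ℕ → Type*} [∀ n, AddCommGroup (A n)]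
    (u : ∀ n, A (n + 1) →+ A n) (n : ℕ) : ∀ i, A (n + i) →+ A n
  | 0 => AddMonoidHom.id _
  | i + 1 => (transitionComp u n i).comp (u (n + i))

/-- Iterated images, defined recursively from the outside. -/
def mlImg {A : ℕ → Type*} [∀ n, AddCommGroup (A n)]
    (u : ∀ n, A (n + 1) →+ A n) : ∀ (_ : ℕ) (n : ℕ), AddSubgroup (A n)
  | 0, _ => ⊤
  | i + 1, n => (mlImg u i (n + 1)).map (u n)

/-- Partial sums `b n + u (b (n+1)) + ...` with `k` terms. -/
def mlSum {A : ℕ → Type*} [∀ n, AddCommGroup (A n)]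
    (u : ∀ n, A (n + 1) →+ A n) (b : ∀ n, A n) : ∀ (_ : ℕ) (n : ℕ), A n
  | 0, _ => 0
  | k + 1, n => b n + u n (mlSum u b k (n + 1))

theorem map_transitionComp_mlImg {A : ℕ → Type*} [∀ n, AddCommGroup (A n)]
    (u : ∀ n, A (n + 1) →+ A n) (n i : ℕ) : ∀ j,
    (mlImg u j (n + i)).map (transitionComp u n i) = mlImg u (i + j) n := by
  induction i with
  | zero =>
    intro j
    rw [Nat.zero_add]
    exact AddSubgroup.map_id _
  | succ i ih =>
    intro j
    have h := ih (j + 1)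
    rw [show i + 1 + j = i + (j + 1) by omega, ← h]
    exact (AddSubgroup.map_map _ _ _).symm

theorem range_transitionComp {A : ℕ → Type*} [∀ n, AddCommGroup (A n)]
    (u : ∀ n, A (n + 1) →+ A n) (n i : ℕ) :
    (transitionComp u n i).range = mlImg u i n := by
  rw [AddMonoidHom.range_eq_map]
  exact map_transitionComp_mlImg u n i 0

theorem mlSum_sub_mem {A : ℕ → Type*} [∀ n, AddCommGroup (A n)]
    (u : ∀ n, A (n + 1) →+ A n) (b : ∀ n, A n) (k : ℕ) : ∀ n,
    mlSum u b (k + 1) n - mlSum u b k n ∈ mlImg u k n := by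
  induction k with
  | zero => intro n; exact AddSubgroup.mem_top _
  | succ k ih =>
    intro n
    refine ⟨_, ih (n + 1), ?_⟩
    rw [map_sub]
    change _ = (b n + u n (mlSum u b (k + 1) (n + 1))) - (b n + u n (mlSum u b k (n + 1)))
    abel

/-- If an inverse system `(A n, u n)` of abelian groups satisfies the
Mittag-Leffler condition (for each `n` the decreasing chain of images
`im(A (n+i) → A n)` is eventually constant), then `lim¹ Aₙ = 0`, i.e. the map
`(aₙ)ₙ ↦ (aₙ - u (aₙ₊₁))ₙ` on `∏ₙ Aₙ` is surjective. -/
theorem stmt_1 (A : ℕ → Type*) [∀ n, AddCommGroup (A n)]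
    (u : ∀ n, A (n + 1) →+ A n)
    (hML : ∀ n, ∃ i₀, ∀ i, i₀ ≤ i →
      (transitionComp u n i).range = (transitionComp u n i₀).range) :
    Function.Surjective (fun a : ∀ n, A n => fun n => a n - u n (a (n + 1))) := by
  intro b
  simp only [range_transitionComp] at hML
  choose N hN using hML
  have hmap : ∀ n, (mlImg u (N (n + 1)) (n + 1)).map (u n) = mlImg u (N n) n := by
    intro n
    rw [← hN (n + 1) (N n + N (n + 1)) (by omega), ← hN n (N n + N (n + 1) + 1) (by omega)]
    rfl
  have hP : ∀ n j, mlSum u b (N n + j) n - mlSum u b (N n) n ∈ mlImg u (N n) n := by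
    intro n j
    induction j with
    | zero => simp
    | succ j ih =>
      have h := mlSum_sub_mem u b (N n + j) n
      rw [hN n (N n + j) (by omega)] at h
      have h2 := add_mem h ih
      rwa [sub_add_sub_cancel] at h2
  have hd : ∀ n, b n - (mlSum u b (N n) n - u n (mlSum u b (N (n + 1)) (n + 1)))
      ∈ mlImg u (N n) n := by
    intro n
    have h1 := hP n (N (n + 1) + 1)
    have h2 := hP (n + 1) (N n)
    rw [show N (n + 1) + N n = N n + N (n + 1) by omega] at h2
    have h3 : u n _ ∈ mlImg u (N n) n := hmap n ▸ AddSubgroup.mem_map_of_mem (u n) h2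
    have h4 := sub_mem h1 h3
    rw [map_sub] at h4
    change (b n + u n (mlSum u b (N n + N (n + 1)) (n + 1))) - _ - _ ∈ _ at h4
    convert h4 using 1
    abel
  have hs : ∀ n (x : mlImg u (N n) n), ∃ y : mlImg u (N (n + 1)) (n + 1),
      u n y = x - (b n - (mlSum u b (N n) n - u n (mlSum u b (N (n + 1)) (n + 1)))) := by
    intro n x
    have h := sub_mem x.2 (hd n)
    replace h := (hmap n).ge h
    obtain ⟨y, hy, e⟩ := h
    exact ⟨⟨y, hy⟩, e⟩
  choose f hf using hs
  let e : ∀ n, mlImg u (N n) n := fun n => Nat.rec 0 f n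
  refine ⟨fun n => mlSum u b (N n) n + (e n).1, ?_⟩
  funext n
  have h : u n (e (n + 1)).1 = _ := hf n (e n)
  simp only [map_add, h]
  abel
end

section
/- Let (A_n, u_n)_{n∈ℕ} be an inverse system of finite groups, with transition maps u_{n+1} : A_{n+1} → A_n group homomorphisms. If the inverse limit lim A_n (the set of all families (a_n)_{n∈ℕ} with a_n ∈ A_n and u_{n+1}(a_{n+1}) = a_n for all n) is infinite, then it is uncountable. -/
/-- If the inverse limit of an inverse system `(A n, u n)` of finite groups
is infinite, then it is uncountable. -/
theorem stmt_2 (A : ℕ → Type*) [∀ n, Group (A n)] [∀ n, Finite (A n)]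
    (u : ∀ n, A (n + 1) →* A n)
    (h : Infinite {a : ∀ n, A n // ∀ n, u n (a (n + 1)) = a n}) :
    ¬ Countable {a : ∀ n, A n // ∀ n, u n (a (n + 1)) = a n} := by
  intro hc
  let S : Subgroup (∀ n, A n) :=
    { carrier := {a | ∀ n, u n (a (n + 1)) = a n}
      mul_mem' := fun {a b} ha hb n => by
        rw [Pi.mul_apply, Pi.mul_apply, map_mul, ha n, hb n]
      one_mem' := fun n => by simp
      inv_mem' := fun {a} ha n => by
        rw [Pi.inv_apply, Pi.inv_apply, map_inv, ha n] }
  have hS : Infinite S := h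
  have hcS : Countable S := hc
  letI : ∀ n, TopologicalSpace (A n) := fun n => ⊥
  haveI : ∀ n, DiscreteTopology (A n) := fun n => ⟨rfl⟩
  have hclosed : IsClosed (S : Set (∀ n, A n)) := by
    change IsClosed {a : ∀ n, A n | ∀ n, u n (a (n + 1)) = a n}
    rw [Set.setOf_forall]
    refine isClosed_iInter fun n => isClosed_eq ?_ (continuous_apply n)
    exact continuous_of_discreteTopology.comp (continuous_apply (n + 1))
  haveI : CompactSpace S := isCompact_iff_compactSpace.mp hclosed.isCompact
  obtain ⟨x, hx⟩ := nonempty_interior_of_iUnion_of_closed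
    (f := fun x : S => ({x} : Set S)) (fun x => isClosed_singleton) (by ext y; simp)
  have hox : IsOpen ({x} : Set S) := by
    rcases Set.subset_singleton_iff_eq.mp (interior_subset (s := ({x} : Set S))) with h0 | h0
    · exact absurd h0 hx.ne_empty
    · exact interior_eq_iff_isOpen.mp h0
  have h1 : IsOpen ({1} : Set S) := by
    have h2 := hox.preimage (continuous_const_mul x)
    convert h2 using 1
    ext y
    simp
  haveI := discreteTopology_of_isOpen_singleton_one h1
  haveI : Finite S := finite_of_compact_of_discrete
  exact not_finite S
end

section
/- Let (A_n, u_n)_{n∈ℕ} be an inverse system of abelian groups in which every A_n is countable, and suppose the system fails the Mittag-Leffler condition, i.e., there exists an n for which the decreasing chain of subgroups im(A_{n+i} → A_n) (i ≥ 0) is not eventually constant. Then lim¹ A_n is uncountable. -/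
/-- The homomorphism `∏ₙ Aₙ → ∏ₙ Aₙ`, `(aₙ)ₙ ↦ (aₙ - uₙ₊₁(aₙ₊₁))ₙ`, whose kernel and
cokernel are `lim Aₙ` and `lim¹ Aₙ` respectively. -/
def shiftHom {A : ℕ → Type*} [∀ n, AddCommGroup (A n)] (u : ∀ n, A (n + 1) →+ A n) :
    (∀ n, A n) →+ (∀ n, A n) :=
  AddMonoidHom.mk' (fun a n => a n - u n (a (n + 1))) (by
    intro a b
    funext n
    simp only [Pi.add_apply, map_add]
    abel)

theorem exists_extend {A : ℕ → Type*} [∀ n, AddCommGroup (A n)] (N : ℕ)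
    (f : ∀ i, A (N + i)) : ∃ b : ∀ n, A n, ∀ i, b (N + i) = f i := by
  classical
  refine ⟨fun m => if h : ∃ i, N + i = m then h.choose_spec ▸ f h.choose else 0, ?_⟩
  intro i
  have h : ∃ i', N + i' = N + i := ⟨i, rfl⟩
  simp only [dif_pos h]
  have key : ∀ (j : ℕ) (hj : N + j = N + i), (hj ▸ f j : A (N + i)) = f i := by
    intro j hj
    obtain rfl : j = i := by omega
    rfl
  exact key _ _

theorem telescope {A : ℕ → Type*} [∀ n, AddCommGroup (A n)]
    (u : ∀ n, A (n + 1) →+ A n) (N : ℕ) (a : ∀ n, A n) (j : ℕ) :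
    a N = (∑ i ∈ Finset.range j, transitionComp u N i (shiftHom u a (N + i)))
      + transitionComp u N j (a (N + j)) := by
  induction j with
  | zero => simp [transitionComp]
  | succ j ih =>
    rw [Finset.sum_range_succ]
    have h : shiftHom u a (N + j) = a (N + j) - u (N + j) (a (N + j + 1)) := rfl
    have h2 : transitionComp u N (j + 1) (a (N + (j + 1)))
      = transitionComp u N j (u (N + j) (a (N + j + 1))) := rfl
    rw [h, h2, map_sub]
    refine ih.trans ?_
    abel

/-- If an inverse system `(A n, u n)` of countable abelian groups fails the
Mittag-Leffler condition, then `lim¹ Aₙ` (the cokernel of the shift map on `∏ₙ Aₙ`)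
is uncountable. -/
theorem stmt_3 (A : ℕ → Type*) [∀ n, AddCommGroup (A n)] [∀ n, Countable (A n)]
    (u : ∀ n, A (n + 1) →+ A n)
    (hML : ∃ n, ¬ ∃ i₀, ∀ i, i₀ ≤ i →
      (transitionComp u n i).range = (transitionComp u n i₀).range) :
    ¬ Countable ((∀ n, A n) ⧸ (shiftHom u).range) := by
  classical
  intro hC
  obtain ⟨N, hN⟩ := hML
  let P : ℕ → Prop := fun j => (transitionComp u N (j + 1)).range ≠ (transitionComp u N j).range
  have hP : (Set.ofPred P).Infinite := by
    intro hfin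
    apply hN
    obtain ⟨M, hM⟩ := hfin.bddAbove
    refine ⟨M + 1, fun i hi => ?_⟩
    induction i, hi using Nat.le_induction with
    | base => rfl
    | succ i hi ih =>
      rw [← ih]
      by_contra hne
      have : i ≤ M := hM hne
      omega
  have hle : ∀ j, (transitionComp u N (j + 1)).range ≤ (transitionComp u N j).range := by
    rintro j _ ⟨x, rfl⟩
    exact ⟨u (N + j) x, rfl⟩
  obtain ⟨e, he⟩ := exists_surjective_nat (((∀ n, A n) ⧸ (shiftHom u).range) × A N)
  let T : ℕ → A N := fun j =>
    (∑ i ∈ Finset.range (j + 1),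
      transitionComp u N i ((e (Nat.count P j)).1.out (N + i))) + (e (Nat.count P j)).2
  have hz : ∀ (j : ℕ) (S : A N), ∃ z : A (N + j), P j →
      S + transitionComp u N j z - T j ∉ (transitionComp u N (j + 1)).range := by
    intro j S
    by_cases hPj : P j
    · by_cases h0 : S - T j ∈ (transitionComp u N (j + 1)).range
      · have hlt := lt_of_le_of_ne (hle j) hPj
        obtain ⟨y, ⟨z, rfl⟩, hy⟩ := SetLike.exists_of_lt hlt
        refine ⟨z, fun _ hmem => hy ?_⟩
        have := sub_mem hmem h0
        convert this using 1
        abel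
      · exact ⟨0, fun _ => by simpa using h0⟩
    · exact ⟨0, fun h => absurd h hPj⟩
  choose z hz using hz
  let S : ℕ → A N := fun j => Nat.rec 0 (fun j s => s + transitionComp u N j (z j s)) j
  have hS : ∀ j, S (j + 1) = S j + transitionComp u N j (z j (S j)) := fun j => rfl
  have hS0 : S 0 = 0 := rfl
  clear_value S
  obtain ⟨b, hb⟩ := exists_extend N (fun i => z i (S i))
  have hSb : ∀ j, S j = ∑ i ∈ Finset.range j, transitionComp u N i (b (N + i)) := by
    intro j
    induction j with
    | zero => simpa using hS0
    | succ j ih => rw [Finset.sum_range_succ, ← ih, hS, hb]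
  let q : (∀ n, A n) ⧸ (shiftHom u).range := QuotientAddGroup.mk b
  have hq : (QuotientAddGroup.mk q.out : (∀ n, A n) ⧸ (shiftHom u).range)
      = QuotientAddGroup.mk b := Quotient.out_eq q
  obtain ⟨a, ha⟩ := QuotientAddGroup.eq.1 hq
  obtain ⟨p, hp⟩ := he (q, a N)
  have hcount : Nat.count P (Nat.nth P p) = p := Nat.count_nth_of_infinite hP p
  have hPj : P (Nat.nth P p) := Nat.nth_mem_of_infinite hP p
  generalize Nat.nth P p = j at hcount hPj
  apply hz j (S j) hPj
  rw [← hS, hSb]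
  have hT : T j = (∑ i ∈ Finset.range (j + 1),
      transitionComp u N i (q.out (N + i))) + a N := by
    simp only [T, hcount, hp]
  have ht := telescope u N a (j + 1)
  rw [ha] at ht
  simp only [Pi.add_apply, Pi.neg_apply, map_add, map_neg, Finset.sum_add_distrib,
    Finset.sum_neg_distrib] at ht
  refine ⟨-a (N + (j + 1)), ?_⟩
  rw [hT, map_neg, ht]
  abel
end

section
/- Let K ⊆ L be CM fields, with maximal totally real subfields K₊ ⊆ K and L₊ ⊆ L (so K₊ ⊆ L₊). Write C⁻(K) for the kernel of the norm-induced homomorphism Cl(𝓞_K) → Cl(𝓞_{K₊}), and similarly C⁻(L). Then the norm-induced homomorphism Cl(𝓞_L) → Cl(𝓞_K) maps the subgroup of elements of odd order of C⁻(L) onto the subgroup of elements of odd order of C⁻(K): for every c ∈ Cl(𝓞_K) of odd order whose norm in Cl(𝓞_{K₊}) is trivial, there exists c' ∈ Cl(𝓞_L) of odd order whose norm in Cl(𝓞_{L₊}) is trivial and whose norm in Cl(𝓞_K) equals c. -/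
set_option synthInstance.maxHeartbeats 400000

open NumberField IntermediateField
open scoped nonZeroDivisors

/-- A subfield of `ℂ` is totally real if every field embedding of it into `ℂ`
has image contained in `ℝ`. -/
def TotallyReal (F : IntermediateField ℚ ℂ) : Prop :=
  ∀ φ : F →+* ℂ, ∀ x : F, (φ x).im = 0

/-- A subfield of `ℂ` is totally imaginary if no field embedding of it into `ℂ`
has image contained in `ℝ`. -/
def TotallyImaginary (K : IntermediateField ℚ ℂ) : Prop :=
  ∀ φ : K →+* ℂ, ∃ x : K, (φ x).im ≠ 0

instance (F : IntermediateField ℚ ℂ) [FiniteDimensional ℚ F] : NumberField F :=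
  NumberField.of_module_finite ℚ F

/-- The relative ideal norm `Nm_{L/F}` for subfields `F ⊆ L` of `ℂ`: the ideal of `𝓞 F`
generated by the field norms `Nm_{L/F}(x)` of the elements `x` of the given ideal of
`𝓞 L`. -/
noncomputable def idealNorm (F L : IntermediateField ℚ ℂ) (h : F ≤ L)
    (I : Ideal (𝓞 L)) : Ideal (𝓞 F) :=
  letI : Algebra F L := (IntermediateField.inclusion h).toRingHom.toAlgebra
  Ideal.span {y : 𝓞 F | ∃ x ∈ I, (y : F) = Algebra.norm F (x : L)}

set_option linter.unusedSectionVars false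

namespace OddNorm

open NumberField.Units NumberField.Units.dirichletUnitTheorem Module NumberField.InfinitePlace in
theorem exists_unit_coords (K : Type*) [Field K] [NumberField K] :
    ∃ (r : ℕ) (T : (InfinitePlace K → ℝ) →ₗ[ℝ] (Fin r → ℝ)) (A : ℝ)
      (e : (𝓞 K)ˣ ≃ torsion K × (Fin r → ℤ)),
      (∀ y, (∀ i, |T y i| ≤ 1) → ∀ w w', |y w - y w'| ≤ A) ∧
      (∀ (u : (𝓞 K)ˣ) i, T (fun w => Real.log (w (u : K))) i = (e u).2 i) := by
  classical
  let Y := InfinitePlace K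
  let S : (Y → ℝ) →ₗ[ℝ] ℝ := ∑ w : Y, (mult w : ℝ) • LinearMap.proj w
  have hS : ∀ y, S y = ∑ w : Y, (mult w : ℝ) * y w := by intro y; simp [S]
  let d : ℝ := finrank ℚ K
  have hd : 0 < d := by simp only [d]; exact_mod_cast finrank_pos
  let D : (Y → ℝ) →ₗ[ℝ] logSpace K :=
    LinearMap.pi fun w => (mult w.1 : ℝ) • (LinearMap.proj w.1 - d⁻¹ • S)
  have hD : ∀ y w, D y w = (mult w.1 : ℝ) * (y w.1 - d⁻¹ * S y) := by
    intro y w; simp [D]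
  let b := (basisUnitLattice K).ofZLatticeBasis ℝ (unitLattice K)
  let T : (Y → ℝ) →ₗ[ℝ] (Fin (rank K) → ℝ) := b.equivFun.toLinearMap ∘ₗ D
  have hTb : ∀ y, D y = ∑ i, T y i • b i := by
    intro y
    simp only [T, LinearMap.comp_apply, LinearEquiv.coe_coe]
    exact (b.sum_equivFun (D y)).symm
  have hmult : ∀ w : Y, (1 : ℝ) ≤ mult w := fun w => by exact_mod_cast one_le_mult
  have hsm : ∑ w : Y, (mult w : ℝ) = d := by
    simp only [d]; exact_mod_cast InfinitePlace.sum_mult_eq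
  let A0 : ℝ := ∑ w : {w : Y // w ≠ w₀}, ∑ i, |b i w|
  -- units
  have hcoord : ∀ u : (𝓞 K)ˣ, ∃ n : torsion K × (Fin (rank K) → ℤ),
      u = n.1 * ∏ i, (fundSystem K i) ^ (n.2 i) := fun u =>
    (exist_unique_eq_mul_prod K u).exists
  let f : torsion K × (Fin (rank K) → ℤ) → (𝓞 K)ˣ := fun n => n.1 * ∏ i, (fundSystem K i) ^ (n.2 i)
  have hf : Function.Bijective f := by
    constructor
    · intro a a' h
      exact (exist_unique_eq_mul_prod K (f a)).unique rfl h
    · intro u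
      obtain ⟨n, hn⟩ := hcoord u
      exact ⟨n, hn.symm⟩
  let e := (Equiv.ofBijective f hf).symm
  have hbi : ∀ i, b i = logEmbedding K (Additive.ofMul (fundSystem K i)) := by
    intro i
    rw [logEmbedding_fundSystem]
    simp [b]
  have hDu : ∀ u : (𝓞 K)ˣ, D (fun w => Real.log (w (u : K))) = logEmbedding K (Additive.ofMul u) := by
    intro u
    funext w
    rw [hD, logEmbedding_component]
    have : S (fun w => Real.log (w (u : K))) = 0 := by
      rw [hS, Units.sum_mult_mul_log]
    rw [this]; simp
  refine ⟨rank K, T, 2 * (2 * A0 + d * A0), e, ?_, ?_⟩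
  · intro y hy
    have h1 : ∀ w : {w : Y // w ≠ w₀}, |D y w| ≤ A0 := by
      intro w
      have : D y w = ∑ i, T y i * b i w := by
        rw [hTb y]; simp [Finset.sum_apply]
      rw [this]
      calc _ ≤ ∑ i, |T y i * b i w| := Finset.abs_sum_le_sum_abs _ _
        _ ≤ ∑ i, |b i w| := by
            refine Finset.sum_le_sum fun i _ => ?_
            rw [abs_mul]
            exact mul_le_of_le_one_left (abs_nonneg _) (hy i)
        _ ≤ A0 := Finset.single_le_sum (f := fun w : {w : Y // w ≠ w₀} => ∑ i, |b i w|)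
            (fun w _ => Finset.sum_nonneg fun i _ => abs_nonneg _) (Finset.mem_univ w)
    have hA0 : 0 ≤ A0 := Finset.sum_nonneg fun w _ => Finset.sum_nonneg fun i _ => abs_nonneg _
    have h2 : ∀ w : Y, w ≠ w₀ → |(mult w : ℝ) * (y w - d⁻¹ * S y)| ≤ A0 := by
      intro w hw
      have := h1 ⟨w, hw⟩
      rwa [hD] at this
    have h3 : ∀ w : Y, |y w - d⁻¹ * S y| ≤ |(mult w : ℝ) * (y w - d⁻¹ * S y)| := by
      intro w
      rw [abs_mul]
      apply le_mul_of_one_le_left (abs_nonneg _)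
      rw [abs_of_nonneg (by linarith [hmult w])]
      exact hmult w
    have h4 : ∑ w : Y, (mult w : ℝ) * (y w - d⁻¹ * S y) = 0 := by
      simp_rw [mul_sub]
      rw [Finset.sum_sub_distrib, ← hS, ← Finset.sum_mul, hsm]
      field_simp; ring
    have hcard : ((Finset.univ.erase (w₀ : Y)).card : ℝ) ≤ d := by
      rw [← hsm]
      calc ((Finset.univ.erase (w₀ : Y)).card : ℝ) ≤ (Finset.univ : Finset Y).card := by
            exact_mod_cast Finset.card_le_card (Finset.erase_subset _ _)
        _ = ∑ w : Y, (1:ℝ) := by simp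
        _ ≤ _ := Finset.sum_le_sum fun w _ => hmult w
    have h5 : ∀ w : Y, |y w - d⁻¹ * S y| ≤ A0 + d * A0 := by
      intro w
      by_cases hw : w = w₀
      · subst hw
        refine (h3 _).trans ?_
        rw [← Finset.add_sum_erase _ _ (Finset.mem_univ (w₀ : Y))] at h4
        rw [eq_neg_of_add_eq_zero_left h4, abs_neg]
        calc _ ≤ ∑ w ∈ Finset.univ.erase (w₀ : Y), |(mult w : ℝ) * (y w - d⁻¹ * S y)| :=
              Finset.abs_sum_le_sum_abs _ _
          _ ≤ ∑ w ∈ Finset.univ.erase (w₀ : Y), A0 := Finset.sum_le_sum fun w hw =>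
              h2 w (Finset.ne_of_mem_erase hw)
          _ = (Finset.univ.erase (w₀ : Y)).card * A0 := by simp
          _ ≤ _ := by nlinarith
      · refine ((h3 _).trans (h2 w hw)).trans ?_
        nlinarith
    intro w w'
    have a := h5 w
    have b := h5 w'
    rw [abs_le] at a b ⊢
    constructor <;> nlinarith
  · intro u i
    have hu : u = f (e u) := ((Equiv.ofBijective f hf).apply_symm_apply u).symm
    have : logEmbedding K (Additive.ofMul u) = ∑ i, ((e u).2 i : ℝ) • b i := by
      conv_lhs => rw [hu]
      simp only [f]
      rw [ofMul_mul, map_add, logEmbedding_eq_zero_iff.mpr (e u).1.2, zero_add, ofMul_prod, map_sum]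
      refine Finset.sum_congr rfl fun i _ => ?_
      rw [hbi, ofMul_zpow, map_zsmul, Int.cast_smul_eq_zsmul]
    simp only [T, LinearMap.comp_apply, LinearEquiv.coe_coe]
    rw [hDu, this, b.equivFun_apply, b.repr_sum_self]

end OddNorm

namespace OddNorm

noncomputable def tent (t : ℝ) : ℝ := max 0 (1 - |t|)

theorem tent_nonneg (t : ℝ) : 0 ≤ tent t := le_max_left _ _
theorem tent_le_one (t : ℝ) : tent t ≤ 1 := by
  unfold tent; have := abs_nonneg t; apply max_le <;> linarith
theorem tent_ne_zero {t : ℝ} (h : tent t ≠ 0) : |t| ≤ 1 := by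
  unfold tent at h
  by_contra hc
  exact h (max_eq_left (by linarith))
theorem tent_lip (a b : ℝ) : |tent a - tent b| ≤ |a - b| := by
  unfold tent
  have h := abs_max_sub_max_le_abs (1 - |a|) (1 - |b|) 0
  rw [max_comm, max_comm 0 (1 - |b|)]
  refine h.trans ?_
  have : 1 - |a| - (1 - |b|) = |b| - |a| := by ring
  rw [this, abs_sub_comm a b]
  exact abs_abs_sub_abs_le _ _

theorem sum_tent (t : ℝ) : ∑ n ∈ ({-⌊t⌋, -⌊t⌋ - 1} : Finset ℤ), tent (t + n) = 1 := by
  rw [Finset.sum_pair (by omega)]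
  have h0 := Int.floor_le t
  have h1 := Int.lt_floor_add_one t
  unfold tent
  push_cast
  rw [abs_of_nonneg (by linarith), abs_of_nonpos (by linarith), max_eq_right (by linarith),
    max_eq_right (by linarith)]
  ring

theorem tent_eq_zero_of_notMem (t : ℝ) (n : ℤ) (hn : n ∉ ({-⌊t⌋, -⌊t⌋ - 1} : Finset ℤ)) :
    tent (t + n) = 0 := by
  have h0 := Int.floor_le t
  have h1 := Int.lt_floor_add_one t
  simp only [Finset.mem_insert, Finset.mem_singleton, not_or] at hn
  unfold tent
  apply max_eq_left
  rcases lt_or_ge n (-⌊t⌋) with h | h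
  · have h2 : n ≤ -⌊t⌋ - 2 := by omega
    have h3 : (n : ℝ) ≤ -⌊t⌋ - 2 := by exact_mod_cast h2
    rw [abs_of_nonpos (by linarith)]; linarith
  · have h2 : -⌊t⌋ + 1 ≤ n := by omega
    have h3 : (-⌊t⌋ + 1 : ℝ) ≤ n := by exact_mod_cast h2
    rw [abs_of_nonneg (by linarith)]; linarith

theorem hasSum_tent {r : ℕ} (t : Fin r → ℝ) :
    HasSum (fun n : Fin r → ℤ => ∏ i, tent (t i + n i)) 1 := by
  classical
  have h1 : ∑ n ∈ Fintype.piFinset (fun i => ({-⌊t i⌋, -⌊t i⌋ - 1} : Finset ℤ)),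
      ∏ i, tent (t i + n i) = 1 := by
    rw [← Finset.prod_univ_sum (fun i => ({-⌊t i⌋, -⌊t i⌋ - 1} : Finset ℤ))
      (fun i n => tent (t i + (n : ℤ)))]
    exact Finset.prod_eq_one fun i _ => sum_tent (t i)
  rw [← h1]
  apply hasSum_sum_of_ne_finset_zero
  intro n hn
  rw [Fintype.mem_piFinset] at hn
  push Not at hn
  obtain ⟨i, hi⟩ := hn
  exact Finset.prod_eq_zero (Finset.mem_univ i) (tent_eq_zero_of_notMem _ _ hi)

theorem abs_prod_sub_prod_le {ι : Type*} (S : Finset ι) (f g : ι → ℝ)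
    (hf : ∀ i, |f i| ≤ 1) (hg : ∀ i, |g i| ≤ 1) :
    |∏ i ∈ S, f i - ∏ i ∈ S, g i| ≤ ∑ i ∈ S, |f i - g i| := by
  classical
  induction S using Finset.induction_on with
  | empty => simp
  | insert a S ha ih =>
    rw [Finset.prod_insert ha, Finset.prod_insert ha, Finset.sum_insert ha]
    have h1 : |∏ i ∈ S, g i| ≤ 1 := by
      rw [Finset.abs_prod]
      exact Finset.prod_le_one (fun i _ => abs_nonneg _) fun i _ => hg i
    have e : f a * ∏ i ∈ S, f i - g a * ∏ i ∈ S, g i =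
      f a * (∏ i ∈ S, f i - ∏ i ∈ S, g i) + (f a - g a) * ∏ i ∈ S, g i := by ring
    rw [e]
    refine (abs_add_le _ _).trans ?_
    rw [abs_mul, abs_mul, add_comm]
    refine add_le_add ?_ ?_
    · exact mul_le_of_le_one_right (abs_nonneg _) h1
    · exact (mul_le_of_le_one_left (abs_nonneg _) (hf a)).trans ih

section Phi
variable {Y : Type*} [Fintype Y] {r : ℕ} (μ : Y → ℝ) (T : (Y → ℝ) →ₗ[ℝ] (Fin r → ℝ))

noncomputable def Phi (s : ℝ) (y : Y → ℝ) : ℝ :=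
  Real.exp (-s * ∑ w, μ w * y w) * ∏ i, tent (T y i)

theorem Phi_nonneg (s : ℝ) (y : Y → ℝ) : 0 ≤ Phi μ T s y :=
  mul_nonneg (Real.exp_pos _).le (Finset.prod_nonneg fun _ _ => tent_nonneg _)

theorem Phi_le (s : ℝ) (y : Y → ℝ) : Phi μ T s y ≤ Real.exp (-s * ∑ w, μ w * y w) :=
  mul_le_of_le_one_right (Real.exp_pos _).le
    (Finset.prod_le_one (fun _ _ => tent_nonneg _) fun _ _ => tent_le_one _)

theorem Phi_ne_zero {s : ℝ} {y : Y → ℝ} (h : Phi μ T s y ≠ 0) (i : Fin r) : |T y i| ≤ 1 := by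
  apply tent_ne_zero
  intro h0
  exact h (by unfold Phi; rw [Finset.prod_eq_zero (Finset.mem_univ i) h0, mul_zero])

theorem exp_sub_exp_le {a b c : ℝ} (ha : a ≤ c) (hb : b ≤ c) :
    |Real.exp a - Real.exp b| ≤ Real.exp c * |a - b| := by
  wlog h : b ≤ a generalizing a b
  · rw [abs_sub_comm, abs_sub_comm a b]; exact this hb ha (le_of_not_ge h)
  rw [abs_of_nonneg (by simpa using h), abs_of_nonneg (by linarith)]
  have h1 : Real.exp b = Real.exp a * Real.exp (b - a) := by rw [← Real.exp_add]; ring_nf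
  have h2 := Real.add_one_le_exp (b - a)
  have h3 : Real.exp a ≤ Real.exp c := Real.exp_le_exp.mpr ha
  rw [h1]
  have := Real.exp_pos a
  nlinarith

theorem Phi_diff (hμ : ∀ w, 0 ≤ μ w) : ∃ C : ℝ, 0 ≤ C ∧ ∀ s : ℝ, 1 ≤ s → s ≤ 2 → ∀ (y y' : Y → ℝ)
    (m η : ℝ), 0 ≤ m → (∀ w, m ≤ y w) → (∀ w, m ≤ y' w) → (∀ w, |y w - y' w| ≤ η) →
    |Phi μ T s y - Phi μ T s y'| ≤ C * η * Real.exp (-(∑ w, μ w) * m) := by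
  classical
  let B : ℝ := ∑ i, ∑ w, |T (Pi.single w 1) i|
  let d : ℝ := ∑ w, μ w
  have hd : 0 ≤ d := Finset.sum_nonneg fun w _ => hμ w
  have hB : 0 ≤ B := Finset.sum_nonneg fun i _ => Finset.sum_nonneg fun w _ => abs_nonneg _
  have hT : ∀ (z : Y → ℝ) (η : ℝ), (∀ w, |z w| ≤ η) → ∑ i, |T z i| ≤ B * η := by
    intro z η hz
    have hz' : z = ∑ w, z w • (Pi.single w (1 : ℝ) : Y → ℝ) := by
      conv_lhs => rw [← Finset.univ_sum_single z]
      refine Finset.sum_congr rfl fun w _ => ?_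
      rw [← Pi.single_smul]; simp
    simp only [B, Finset.sum_mul]
    refine Finset.sum_le_sum fun i _ => ?_
    conv_lhs => rw [hz', map_sum, Finset.sum_apply]
    refine (Finset.abs_sum_le_sum_abs _ _).trans (Finset.sum_le_sum fun w _ => ?_)
    rw [map_smul, Pi.smul_apply, smul_eq_mul, abs_mul, mul_comm]
    exact mul_le_mul_of_nonneg_left (hz w) (abs_nonneg _)
  refine ⟨2 * d + B, by positivity, ?_⟩
  intro s hs1 hs2 y y' m η hm hy hy' hη
  have key : ∀ z : Y → ℝ, (∀ w, m ≤ z w) → -s * ∑ w, μ w * z w ≤ -d * m := by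
    intro z hz
    have : d * m ≤ ∑ w, μ w * z w := by
      simp only [d, Finset.sum_mul]
      exact Finset.sum_le_sum fun w _ => mul_le_mul_of_nonneg_left (hz w) (hμ w)
    have h0 : 0 ≤ d * m := mul_nonneg hd hm
    nlinarith
  have hE := exp_sub_exp_le (key y hy) (key y' hy')
  have hE2 : |(-s * ∑ w, μ w * y w) - (-s * ∑ w, μ w * y' w)| ≤ 2 * d * η := by
    rw [← mul_sub, ← Finset.sum_sub_distrib, abs_mul, abs_neg, abs_of_nonneg (by linarith : 0 ≤ s)]
    have h1 : |∑ w, (μ w * y w - μ w * y' w)| ≤ d * η := by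
      simp only [d, Finset.sum_mul]
      refine (Finset.abs_sum_le_sum_abs _ _).trans (Finset.sum_le_sum fun w _ => ?_)
      rw [← mul_sub, abs_mul, abs_of_nonneg (hμ w)]
      exact mul_le_mul_of_nonneg_left (hη w) (hμ w)
    have := abs_nonneg (∑ w, (μ w * y w - μ w * y' w))
    nlinarith
  have hP : |∏ i, tent (T y i) - ∏ i, tent (T y' i)| ≤ B * η := by
    refine (abs_prod_sub_prod_le _ _ _ ?_ ?_).trans ?_
    · intro i; rw [abs_of_nonneg (tent_nonneg _)]; exact tent_le_one _
    · intro i; rw [abs_of_nonneg (tent_nonneg _)]; exact tent_le_one _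
    · refine le_trans (Finset.sum_le_sum fun i _ => tent_lip _ _) ?_
      have := hT (y - y') η (by simpa using hη)
      simpa using this
  have hPle : |∏ i, tent (T y' i)| ≤ 1 := by
    rw [Finset.abs_prod]
    exact Finset.prod_le_one (fun i _ => abs_nonneg _) fun i _ => by
      rw [abs_of_nonneg (tent_nonneg _)]; exact tent_le_one _
  unfold Phi
  have e : ∀ a b c d : ℝ, a * b - c * d = a * (b - d) + (a - c) * d := by intros; ring
  rw [e]
  refine (abs_add_le _ _).trans ?_
  rw [abs_mul, abs_mul, abs_of_pos (Real.exp_pos _)]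
  have hx : Real.exp (-s * ∑ w, μ w * y w) ≤ Real.exp (-d * m) := Real.exp_le_exp.mpr (key y hy)
  have hpos := Real.exp_pos (-d * m)
  have g1 : Real.exp (-s * ∑ w, μ w * y w) * |∏ i, tent (T y i) - ∏ i, tent (T y' i)|
      ≤ Real.exp (-d * m) * (B * η) := mul_le_mul hx hP (abs_nonneg _) hpos.le
  have g2 : |Real.exp (-s * ∑ w, μ w * y w) - Real.exp (-s * ∑ w, μ w * y' w)| *
      |∏ i, tent (T y' i)| ≤ Real.exp (-d * m) * (2 * d * η) := by
    refine (mul_le_of_le_one_right (abs_nonneg _) hPle).trans (hE.trans ?_)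
    exact mul_le_mul_of_nonneg_left hE2 hpos.le
  calc _ ≤ _ := add_le_add g1 g2
    _ = _ := by ring
end Phi

end OddNorm

namespace OddNorm

structure UnitData (K : Type*) [Field K] [NumberField K] where
  r : ℕ
  T : (InfinitePlace K → ℝ) →ₗ[ℝ] (Fin r → ℝ)
  A : ℝ
  e : (𝓞 K)ˣ ≃ NumberField.Units.torsion K × (Fin r → ℤ)
  hA : ∀ y, (∀ i, |T y i| ≤ 1) → ∀ w w', |y w - y w'| ≤ A
  hT : ∀ (u : (𝓞 K)ˣ) i, T (fun w => Real.log (w (u : K))) i = (e u).2 i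

theorem nonempty_unitData (K : Type*) [Field K] [NumberField K] : Nonempty (UnitData K) := by
  obtain ⟨r, T, A, e, h1, h2⟩ := exists_unit_coords K
  exact ⟨⟨r, T, A, e, h1, h2⟩⟩

section
variable {K : Type*} [Field K] [NumberField K] (D : UnitData K)

noncomputable def lg (α : 𝓞 K) (w : InfinitePlace K) : ℝ := Real.log (w (α : K))

noncomputable def mu (w : InfinitePlace K) : ℝ := w.mult

theorem mu_nonneg (w : InfinitePlace K) : 0 ≤ mu w := by unfold mu; positivity

theorem sum_mu : ∑ w : InfinitePlace K, mu w = Module.finrank ℚ K := by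
  unfold mu; exact_mod_cast InfinitePlace.sum_mult_eq

theorem place_pos {α : 𝓞 K} (hα : α ≠ 0) (w : InfinitePlace K) : 0 < w (α : K) :=
  InfinitePlace.pos_iff.mpr (by simpa using hα)

theorem sum_mu_lg {α : 𝓞 K} (hα : α ≠ 0) :
    ∑ w, mu w * lg α w = Real.log (Ideal.absNorm (Ideal.span {α})) := by
  have h1 := InfinitePlace.prod_eq_abs_norm (α : K)
  have h2 : ((Ideal.absNorm (Ideal.span {α}) : ℕ) : ℝ) = |((Algebra.norm ℚ (α : K) : ℚ) : ℝ)| := by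
    rw [Ideal.absNorm_span_singleton, ← Algebra.coe_norm_int, Nat.cast_natAbs]
    push_cast; rfl
  rw [h2, ← Rat.cast_abs, ← h1, Real.log_prod]
  · refine Finset.sum_congr rfl fun w _ => ?_
    rw [Real.log_pow]; rfl
  · intro w _; exact pow_ne_zero _ (place_pos hα w).ne'

theorem one_le_absNorm {α : 𝓞 K} (hα : α ≠ 0) :
    (1 : ℝ) ≤ Ideal.absNorm (Ideal.span {α}) := by
  have : Ideal.absNorm (Ideal.span {α}) ≠ 0 := by
    rw [Ne, Ideal.absNorm_eq_zero_iff, Ideal.span_singleton_eq_bot]; exact hα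
  exact_mod_cast Nat.one_le_iff_ne_zero.mpr this

open Classical in
noncomputable def wt (s : ℝ) (α : 𝓞 K) : ℝ := if α = 0 then 0 else Phi mu D.T s (lg α)

theorem wt_zero (s : ℝ) : wt D s 0 = 0 := by simp [wt]
theorem wt_of_ne (s : ℝ) {α : 𝓞 K} (h : α ≠ 0) : wt D s α = Phi mu D.T s (lg α) := by simp [wt, h]

theorem wt_nonneg (s : ℝ) (α : 𝓞 K) : 0 ≤ wt D s α := by
  unfold wt; split_ifs
  · exact le_rfl
  · exact Phi_nonneg _ _ _ _

theorem wt_le_one {s : ℝ} (hs : 0 ≤ s) (α : 𝓞 K) : wt D s α ≤ 1 := by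
  unfold wt; split_ifs with h
  · exact zero_le_one
  · refine (Phi_le _ _ _ _).trans ?_
    rw [sum_mu_lg h, Real.exp_le_one_iff]
    have := Real.log_nonneg (one_le_absNorm h)
    nlinarith

open scoped Classical in
noncomputable def mx (α : 𝓞 K) : ℝ := ‖mixedEmbedding K (α : K)‖

open scoped Classical in
theorem le_mx (α : 𝓞 K) (w : InfinitePlace K) : w (α : K) ≤ mx α := by
  unfold mx
  rw [mixedEmbedding.norm_eq_sup'_normAtPlace, ← mixedEmbedding.normAtPlace_apply]
  exact Finset.le_sup' (fun w => mixedEmbedding.normAtPlace w (mixedEmbedding K (α : K)))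
    (Finset.mem_univ w)

open scoped Classical in
theorem exists_mx (α : 𝓞 K) : ∃ w : InfinitePlace K, w (α : K) = mx α := by
  unfold mx
  rw [mixedEmbedding.norm_eq_sup'_normAtPlace]
  obtain ⟨w, _, hw⟩ := Finset.exists_mem_eq_sup' Finset.univ_nonempty
    (fun w => mixedEmbedding.normAtPlace w (mixedEmbedding K (α : K)))
  exact ⟨w, by rw [hw, mixedEmbedding.normAtPlace_apply]⟩

theorem mx_nonneg (α : 𝓞 K) : 0 ≤ mx α := by
  obtain ⟨w⟩ := (inferInstance : Nonempty (InfinitePlace K))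
  exact (apply_nonneg w (α : K)).trans (le_mx α w)

theorem one_le_mx {α : 𝓞 K} (hα : α ≠ 0) : 1 ≤ mx α := by
  by_contra hc
  push Not at hc
  have h : ∑ w, mu w * lg α w < 0 := by
    apply Finset.sum_neg
    · intro w _
      have h1 : lg α w < 0 := Real.log_neg (place_pos hα w) ((le_mx α w).trans_lt hc)
      have h2 : 0 < mu w := by unfold mu; exact_mod_cast InfinitePlace.mult_pos
      nlinarith
    · exact Finset.univ_nonempty
  rw [sum_mu_lg hα] at h
  exact absurd (Real.log_nonneg (one_le_absNorm hα)) (not_le.mpr h)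

open scoped Classical in
theorem summable_mx_aux {p : ℝ} (hp : p < -(Module.finrank ℚ K : ℝ)) :
    Summable fun z : mixedEmbedding.integerLattice K => ‖(z : mixedEmbedding.mixedSpace K)‖ ^ p := by
  have hfr : Module.finrank ℤ (mixedEmbedding.integerLattice K) = Module.finrank ℚ K := by
    rw [ZLattice.rank ℝ, mixedEmbedding.finrank]
  exact ZLattice.summable_norm_rpow (mixedEmbedding.integerLattice K) p (by rw [hfr]; exact hp)

open scoped Classical in
noncomputable def toLat (α : 𝓞 K) : mixedEmbedding.integerLattice K :=
  ⟨mixedEmbedding K (α : K), ⟨α, rfl⟩⟩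

theorem toLat_injective : Function.Injective (toLat (K := K)) := by
  intro a b hab
  have h : mixedEmbedding K (a : K) = mixedEmbedding K (b : K) := congrArg Subtype.val hab
  exact RingOfIntegers.ext ((mixedEmbedding_injective K) h)

theorem summable_mx {p : ℝ} (hp : p < -(Module.finrank ℚ K : ℝ)) :
    Summable fun α : 𝓞 K => mx α ^ p := by
  have h := (summable_mx_aux hp).comp_injective (toLat_injective (K := K))
  exact h

/-- lower bound on the support -/
theorem wt_support {s : ℝ} {α : 𝓞 K} (h : wt D s α ≠ 0) (w : InfinitePlace K) :
    Real.exp (-D.A) * mx α ≤ w (α : K) := by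
  have hα : α ≠ 0 := by rintro rfl; exact h (wt_zero D s)
  rw [wt_of_ne D s hα] at h
  obtain ⟨w', hw'⟩ := exists_mx α
  have h1 := D.hA (lg α) (Phi_ne_zero _ _ h) w w'
  rw [abs_le] at h1
  have h2 : lg α w' - D.A ≤ lg α w := by linarith [h1.1]
  have h3 := Real.exp_le_exp.mpr h2
  unfold lg at h3
  rw [Real.exp_log (place_pos hα w), sub_eq_add_neg, Real.exp_add,
    Real.exp_log (place_pos hα w'), hw'] at h3
  linarith

theorem A_nonneg : 0 ≤ D.A := by
  have w : InfinitePlace K := Classical.arbitrary _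
  have := D.hA 0 (by simp) w w
  simpa using this

theorem summable_wt {s : ℝ} (hs : 1 < s) : Summable (wt D s) := by
  have hd : (0:ℝ) < Module.finrank ℚ K := by exact_mod_cast Module.finrank_pos
  have hsum := summable_mx (K := K) (p := -(Module.finrank ℚ K : ℝ) * s) (by nlinarith)
  refine Summable.of_nonneg_of_le (wt_nonneg D s) ?_
    (hsum.mul_left (Real.exp (-D.A) ^ (-(Module.finrank ℚ K : ℝ) * s)))
  intro α
  by_cases h : wt D s α = 0
  · have := mx_nonneg α; rw [h]; positivity
  have hα : α ≠ 0 := by rintro rfl; exact h (wt_zero D s)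
  have hm := one_le_mx hα
  rw [← Real.mul_rpow (Real.exp_pos _).le (by linarith)]
  rw [wt_of_ne D s hα]
  refine (Phi_le _ _ _ _).trans ?_
  have hpos : 0 < Real.exp (-D.A) * mx α := by positivity
  rw [Real.rpow_def_of_pos hpos, Real.exp_le_exp]
  have : (Module.finrank ℚ K : ℝ) * Real.log (Real.exp (-D.A) * mx α) ≤ ∑ w, mu w * lg α w := by
    rw [← sum_mu, Finset.sum_mul]
    refine Finset.sum_le_sum fun w _ => mul_le_mul_of_nonneg_left ?_ (mu_nonneg w)
    exact Real.log_le_log hpos (wt_support D h w)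
  nlinarith

open scoped Classical in
theorem mx_add_le (α β : 𝓞 K) : mx (α + β) ≤ mx α + mx β := by
  unfold mx; push_cast; rw [map_add]; exact norm_add_le _ _

open scoped Classical in
theorem mx_neg (β : 𝓞 K) : mx (-β) = mx β := by
  unfold mx; push_cast; rw [map_neg]; exact norm_neg _

theorem place_add_le (α β : 𝓞 K) (w : InfinitePlace K) :
    |w ((α + β : 𝓞 K) : K) - w (α : K)| ≤ mx β := by
  have h1 : w ((α + β : 𝓞 K) : K) ≤ w (α : K) + w (β : K) := by
    push_cast; exact w.1.add_le _ _
  have h2 : w (α : K) ≤ w ((α + β : 𝓞 K) : K) + w (β : K) := by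
    have := w.1.sub_le_add ((α + β : 𝓞 K) : K) (β : K)
    have e : ((α + β : 𝓞 K) : K) - (β : K) = (α : K) := by push_cast; ring
    rw [e] at this
    exact this
  have h3 := le_mx β w
  rw [abs_le]; constructor <;> linarith

theorem abs_log_sub_log_le {a b c : ℝ} (hc : 0 < c) (ha : c ≤ a) (hb : c ≤ b) :
    |Real.log a - Real.log b| ≤ |a - b| / c := by
  wlog h : b ≤ a generalizing a b
  · rw [abs_sub_comm, abs_sub_comm a b]; exact this hb ha (le_of_not_ge h)
  have hb0 : 0 < b := by linarith
  have ha0 : 0 < a := by linarith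
  rw [abs_of_nonneg (by linarith [Real.log_le_log hb0 h]), abs_of_nonneg (by linarith),
    ← Real.log_div ha0.ne' hb0.ne']
  refine (Real.log_le_sub_one_of_pos (by positivity)).trans ?_
  have : a / b - 1 = (a - b) / b := by field_simp
  rw [this]
  exact div_le_div_of_nonneg_left (by linarith) hc hb

set_option maxHeartbeats 1000000 in
theorem wt_diff (β : 𝓞 K) : ∃ g : 𝓞 K → ℝ, Summable g ∧ ∀ s : ℝ, 1 ≤ s → s ≤ 2 → ∀ α,
    |wt D s (α + β) - wt D s α| ≤ g α := by
  classical
  obtain ⟨C, hC, hdiff⟩ := Phi_diff (Y := InfinitePlace K) mu D.T mu_nonneg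
  rw [sum_mu] at hdiff
  set d : ℝ := (Module.finrank ℚ K : ℝ) with hd
  have hd0 : 0 < d := by rw [hd]; exact_mod_cast Module.finrank_pos
  set b := mx β with hb
  have hb0 : 0 ≤ b := mx_nonneg _
  set q := Real.exp (-D.A) with hq
  have hq0 : 0 < q := Real.exp_pos _
  have hq1 : q ≤ 1 := by rw [hq, Real.exp_le_one_iff]; linarith [A_nonneg D]
  -- threshold
  set R : ℝ := 4 * (b + 1) / q with hR
  have hR0 : 0 < R := by positivity
  have hRq : q * R = 4 * (b + 1) := by rw [hR]; field_simp
  set C1 : ℝ := C * (b / (q / 2)) * (q / 2) ^ (-d) with hC1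
  have hC10 : 0 ≤ C1 := by positivity
  set C2 : ℝ := R ^ (d + 1) with hC2
  have hC20 : 0 ≤ C2 := by positivity
  have hle1 : ∀ s : ℝ, 1 ≤ s → ∀ α, |wt D s (α + β) - wt D s α| ≤ 1 := by
    intro s hs α
    have h1 := wt_nonneg D s (α + β)
    have h2 := wt_nonneg D s α
    have h3 := wt_le_one D (by linarith : 0 ≤ s) (α + β)
    have h4 := wt_le_one D (by linarith : 0 ≤ s) α
    rw [abs_le]; constructor <;> linarith
  refine ⟨fun α => (C1 + C2) * mx α ^ (-d - 1) + if α = 0 then 1 else 0, ?_, ?_⟩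
  · apply Summable.add
    · exact (summable_mx (by rw [← hd]; linarith)).mul_left _
    · exact (hasSum_ite_eq (0 : 𝓞 K) (1 : ℝ)).summable
  intro s hs1 hs2 α
  have hmx0 : 0 ≤ mx α := mx_nonneg _
  by_cases hα : α = 0
  · simp only [hα, if_true]
    have : 0 ≤ (C1 + C2) * mx (0 : 𝓞 K) ^ (-d - 1) := by
      have : 0 ≤ mx (0 : 𝓞 K) := mx_nonneg _
      positivity
    have := hle1 s hs1 0
    linarith
  simp only [hα, if_false, add_zero]
  have hM := one_le_mx hα
  have hMp : 0 ≤ mx α ^ (-d - 1) := by positivity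
  by_cases hMR : mx α ≤ R
  · refine (hle1 s hs1 α).trans ?_
    have : 1 ≤ C2 * mx α ^ (-d - 1) := by
      have e : -d - 1 = -(d + 1) := by ring
      rw [hC2, e, Real.rpow_neg hmx0, ← div_eq_mul_inv, one_le_div (by positivity)]
      exact Real.rpow_le_rpow hmx0 hMR (by linarith)
    nlinarith
  push Not at hMR
  by_cases hz : wt D s (α + β) = 0 ∧ wt D s α = 0
  · rw [hz.1, hz.2, sub_zero, abs_zero]; exact mul_nonneg (add_nonneg hC10 hC20) hMp
  -- lower bounds
  have hqM : 4 * (b + 1) < q * mx α := by rw [← hRq]; exact mul_lt_mul_of_pos_left hMR hq0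
  have hlow : ∀ w : InfinitePlace K, q / 2 * mx α ≤ w (α : K) ∧
      q / 2 * mx α ≤ w ((α + β : 𝓞 K) : K) := by
    intro w
    have h1 := place_add_le α β w
    rw [abs_le] at h1
    by_cases h : wt D s α = 0
    · have h2 : wt D s (α + β) ≠ 0 := fun h' => hz ⟨h', h⟩
      have h3 := wt_support D h2 w
      have h4 : mx α ≤ mx (α + β) + b := by
        have := mx_add_le (α + β) (-β)
        rwa [add_neg_cancel_right, mx_neg] at this
      have h5 : q * mx α - q * b ≤ w ((α + β : 𝓞 K) : K) := by
        refine le_trans ?_ h3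
        rw [← mul_sub]
        exact mul_le_mul_of_nonneg_left (by linarith) hq0.le
      constructor <;> nlinarith [h1.1, h1.2]
    · have h3 := wt_support D h w
      constructor <;> nlinarith [h1.1, h1.2]
  have hαβ : α + β ≠ 0 := by
    intro h0
    obtain ⟨w⟩ := (inferInstance : Nonempty (InfinitePlace K))
    have := (hlow w).2
    rw [h0] at this
    simp at this
    nlinarith
  rw [wt_of_ne D s hα, wt_of_ne D s hαβ]
  have hcpos : 0 < q / 2 * mx α := by positivity
  have := hdiff s hs1 hs2 (lg (α + β)) (lg α) (Real.log (q / 2 * mx α)) (b / (q / 2 * mx α))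
    (Real.log_nonneg (by linarith))
    (fun w => Real.log_le_log hcpos (hlow w).2) (fun w => Real.log_le_log hcpos (hlow w).1)
    (fun w => (abs_log_sub_log_le hcpos (hlow w).2 (hlow w).1).trans
      (div_le_div_of_nonneg_right (place_add_le α β w) hcpos.le))
  refine this.trans ?_
  have e1 : Real.exp (-d * Real.log (q / 2 * mx α)) = (q / 2) ^ (-d) * mx α ^ (-d) := by
    rw [← Real.mul_rpow (by positivity) hmx0, Real.rpow_def_of_pos hcpos, mul_comm]
  have e2 : mx α ^ (-d - 1) = mx α ^ (-d) / mx α := by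
    rw [Real.rpow_sub (by linarith), Real.rpow_one]
  rw [e1]
  have : C * (b / (q / 2 * mx α)) * ((q / 2) ^ (-d) * mx α ^ (-d)) = C1 * mx α ^ (-d - 1) := by
    rw [e2, hC1]; field_simp
  rw [this]
  nlinarith

theorem hasSum_torsion_tent (t : Fin D.r → ℝ) :
    HasSum (fun p : NumberField.Units.torsion K × (Fin D.r → ℤ) =>
      ∏ i, tent (t i + p.2 i)) (Units.torsionOrder K : ℝ) := by
  have h5 := hasSum_tent t
  generalize hg : (fun n : Fin D.r → ℤ => ∏ i, tent (t i + n i)) = g at h5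
  have hg0 : 0 ≤ g := by
    rw [← hg]; intro n; exact Finset.prod_nonneg fun _ _ => tent_nonneg _
  have e1 : (fun p : NumberField.Units.torsion K × (Fin D.r → ℤ) =>
      ∏ i, tent (t i + p.2 i)) = fun p => (1 : ℝ) * g p.2 := by
    funext p; rw [one_mul, ← hg]
  rw [e1]
  have h4 : HasSum (fun _ : NumberField.Units.torsion K => (1 : ℝ)) (Units.torsionOrder K : ℝ) := by
    have : Fintype (NumberField.Units.torsion K) := Fintype.ofFinite _
    have h := hasSum_fintype (fun _ : NumberField.Units.torsion K => (1 : ℝ))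
    rw [Finset.sum_const, Finset.card_univ, nsmul_eq_mul, mul_one,
      ← Nat.card_eq_fintype_card] at h
    exact h
  have h3 := h4.mul h5 (h4.summable.mul_of_nonneg h5.summable (fun _ => zero_le_one) hg0)
  rwa [mul_one] at h3

theorem hasSum_units_wt (s : ℝ) {α : 𝓞 K} (hα : α ≠ 0) :
    HasSum (fun u : (𝓞 K)ˣ => wt D s (u * α))
      ((Units.torsionOrder K : ℝ) * (Ideal.absNorm (Ideal.span {α}) : ℝ) ^ (-s)) := by
  set c : ℝ := (Ideal.absNorm (Ideal.span {α}) : ℝ) ^ (-s) with hc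
  have hf : ∀ u : (𝓞 K)ˣ, wt D s (u * α) = c * ∏ i, tent (D.T (lg α) i + (D.e u).2 i) := by
    intro u
    have hu : (u : 𝓞 K) * α ≠ 0 := mul_ne_zero u.ne_zero hα
    rw [wt_of_ne D s hu]
    unfold Phi
    rw [sum_mu_lg hu]
    have e1 : Ideal.span {(u : 𝓞 K) * α} = Ideal.span {α} :=
      Ideal.span_singleton_mul_left_unit u.isUnit α
    have e2 : lg ((u : 𝓞 K) * α) = lg α + fun w => Real.log (w ((u : 𝓞 K) : K)) := by
      funext w
      unfold lg
      push_cast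
      rw [map_mul, Real.log_mul (place_pos u.ne_zero w).ne' (place_pos hα w).ne', add_comm]
      rfl
    rw [e1, e2, map_add]
    congr 1
    · have := one_le_absNorm hα
      rw [hc, Real.rpow_def_of_pos (by linarith), mul_comm]
    · refine Finset.prod_congr rfl fun i _ => ?_
      rw [Pi.add_apply, D.hT]
  have h2 := hasSum_torsion_tent D (D.T (lg α))
  have h6 := ((D.e.hasSum_iff).mpr h2).mul_left c
  rw [mul_comm]
  have e : (fun u : (𝓞 K)ˣ => wt D s (u * α)) =
      fun u => c * ((fun p : NumberField.Units.torsion K × (Fin D.r → ℤ) =>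
        ∏ i, tent (D.T (lg α) i + p.2 i)) ∘ D.e) u := funext hf
  rw [e]
  exact h6
end

end OddNorm

namespace OddNorm
section
variable {K : Type*} [Field K] [NumberField K]

noncomputable def nrm (I : (Ideal (𝓞 K))⁰) : ℝ := (Ideal.absNorm (I : Ideal (𝓞 K)) : ℝ)

theorem one_le_nrm (I : (Ideal (𝓞 K))⁰) : 1 ≤ nrm I := by
  unfold nrm
  have : Ideal.absNorm (I : Ideal (𝓞 K)) ≠ 0 := by
    rw [Ne, Ideal.absNorm_eq_zero_iff]; exact nonZeroDivisors.coe_ne_zero I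
  exact_mod_cast Nat.one_le_iff_ne_zero.mpr this

theorem nrm_mul (I J : (Ideal (𝓞 K))⁰) : nrm (I * J) = nrm I * nrm J := by
  unfold nrm; simp

theorem nrm_one : nrm (1 : (Ideal (𝓞 K))⁰) = 1 := by
  unfold nrm; simp

/-- the nonzero principal ideal -/
noncomputable def pr (α : 𝓞 K) (h : α ≠ 0) : (Ideal (𝓞 K))⁰ :=
  ⟨Ideal.span {α}, mem_nonZeroDivisors_of_ne_zero (by
    rw [Ne, Ideal.zero_eq_bot, Ideal.span_singleton_eq_bot]; exact h)⟩

variable (K) in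
abbrev PId := {I : (Ideal (𝓞 K))⁰ // (I : Ideal (𝓞 K)).IsPrincipal}

theorem PId.exists_gen (I : PId K) : ∃ (a : 𝓞 K) (h : a ≠ 0), pr a h = I.1 := by
  have h1 := I.2
  obtain ⟨a, ha⟩ := h1
  have ha' : (I.1 : Ideal (𝓞 K)) = Ideal.span {a} := ha
  have h0 : a ≠ 0 := by
    rintro rfl
    apply nonZeroDivisors.coe_ne_zero I.1
    rw [ha']; simp
  exact ⟨a, h0, Subtype.ext ha'.symm⟩

noncomputable def PId.gen (I : PId K) : 𝓞 K := (PId.exists_gen I).choose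
theorem PId.gen_ne (I : PId K) : I.gen ≠ 0 := (PId.exists_gen I).choose_spec.choose
theorem PId.pr_gen (I : PId K) : pr I.gen I.gen_ne = I.1 := (PId.exists_gen I).choose_spec.choose_spec

theorem pr_eq_iff {a b : 𝓞 K} (ha : a ≠ 0) (hb : b ≠ 0) :
    pr a ha = pr b hb ↔ ∃ u : (𝓞 K)ˣ, u * a = b := by
  rw [Subtype.ext_iff]
  change Ideal.span {a} = Ideal.span {b} ↔ _
  rw [Ideal.span_singleton_eq_span_singleton]
  constructor
  · rintro ⟨u, hu⟩; exact ⟨u, by rw [mul_comm]; exact hu⟩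
  · rintro ⟨u, hu⟩; exact ⟨u, by rw [mul_comm]; exact hu⟩

theorem pr_unit_mul {a : 𝓞 K} (ha : a ≠ 0) (u : (𝓞 K)ˣ) (h : (u : 𝓞 K) * a ≠ 0) :
    pr ((u : 𝓞 K) * a) h = pr a ha :=
  ((pr_eq_iff ha h).mpr ⟨u, rfl⟩).symm

noncomputable def unitsPId : PId K × (𝓞 K)ˣ → 𝓞 K := fun p => p.2 * p.1.gen

theorem unitsPId_injective : Function.Injective (unitsPId (K := K)) := by
  rintro ⟨I, u⟩ ⟨I', u'⟩ h
  simp only [unitsPId] at h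
  have h1 : I = I' := by
    apply Subtype.ext
    rw [← I.pr_gen, ← I'.pr_gen]
    rw [pr_eq_iff]
    exact ⟨u'⁻¹ * u, by push_cast; rw [mul_assoc, h, ← mul_assoc]; simp⟩
  subst h1
  have := mul_right_cancel₀ I.gen_ne h
  rw [Units.ext this]

theorem unitsPId_range {α : 𝓞 K} (h : α ≠ 0) : α ∈ Set.range (unitsPId (K := K)) := by
  let I : PId K := ⟨pr α h, ⟨α, rfl⟩⟩
  have := I.pr_gen
  rw [pr_eq_iff I.gen_ne h] at this
  obtain ⟨u, hu⟩ := this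
  exact ⟨(I, u), hu⟩

variable (D : UnitData K)

theorem summable_wt_pair {s : ℝ} (hs : 1 < s) :
    Summable fun p : PId K × (𝓞 K)ˣ => wt D s (p.2 * p.1.gen) :=
  (summable_wt D hs).comp_injective unitsPId_injective

theorem nrm_pr {α : 𝓞 K} (h : α ≠ 0) : nrm (pr α h) = Ideal.absNorm (Ideal.span {α}) := rfl

theorem hasSum_units_wt' (s : ℝ) (I : PId K) :
    HasSum (fun u : (𝓞 K)ˣ => wt D s (u * I.gen))
      ((Units.torsionOrder K : ℝ) * nrm I.1 ^ (-s)) := by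
  have := hasSum_units_wt D s I.gen_ne
  rwa [← nrm_pr I.gen_ne, I.pr_gen] at this

theorem summable_nrm_PId {s : ℝ} (hs : 1 < s) : Summable fun I : PId K => nrm I.1 ^ (-s) := by
  obtain ⟨D⟩ := nonempty_unitData K
  have h := (summable_wt_pair D hs).prod
  simp_rw [(hasSum_units_wt' D s _).tsum_eq] at h
  have ht : (Units.torsionOrder K : ℝ) ≠ 0 := by
    exact_mod_cast (Units.torsionOrder_pos K).ne'
  exact (summable_mul_left_iff ht).mp h

/-- unfolding -/
theorem unfold_sum {s : ℝ} (hs : 1 < s) (φ : (Ideal (𝓞 K))⁰ → ℂ) (hφ : ∀ I, ‖φ I‖ ≤ 1)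
    (g : 𝓞 K → ℂ) (hg : ∀ α (h : α ≠ 0), g α = φ (pr α h)) :
    ∑' α : 𝓞 K, g α * (wt D s α : ℂ) =
      (Units.torsionOrder K : ℂ) * ∑' I : PId K, φ I.1 * ((nrm I.1 ^ (-s) : ℝ) : ℂ) := by
  have hsup : Function.support (fun α : 𝓞 K => g α * (wt D s α : ℂ)) ⊆
      Set.range (unitsPId (K := K)) := by
    intro α hα
    apply unitsPId_range
    rintro rfl
    apply hα
    simp [wt_zero]
  rw [← unitsPId_injective.tsum_eq hsup]
  have hval : ∀ p : PId K × (𝓞 K)ˣ, g (unitsPId p) * (wt D s (unitsPId p) : ℂ) =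
      φ p.1.1 * ((wt D s (p.2 * p.1.gen) : ℝ) : ℂ) := by
    rintro ⟨I, u⟩
    have hne : (u : 𝓞 K) * I.gen ≠ 0 := mul_ne_zero u.ne_zero I.gen_ne
    simp only [unitsPId]
    rw [hg _ hne, pr_unit_mul I.gen_ne, I.pr_gen]
  simp_rw [hval]
  have hsum : Summable fun p : PId K × (𝓞 K)ˣ => φ p.1.1 * ((wt D s (p.2 * p.1.gen) : ℝ) : ℂ) := by
    refine Summable.of_norm_bounded (summable_wt_pair D hs) ?_
    intro p
    rw [norm_mul, Complex.norm_real, Real.norm_of_nonneg (wt_nonneg D _ _)]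
    exact mul_le_of_le_one_left (wt_nonneg D _ _) (hφ _)
  rw [hsum.tsum_prod, ← tsum_mul_left]
  refine tsum_congr fun I => ?_
  dsimp only
  rw [tsum_mul_left, ← Complex.ofReal_tsum, (hasSum_units_wt' D s I).tsum_eq]
  push_cast; ring
end
end OddNorm

namespace OddNorm
section
variable {K : Type*} [Field K] [NumberField K]

theorem exists_coprime_rep (m : 𝓞 K) (hm : m ≠ 0) (c : ClassGroup (𝓞 K)) :
    ∃ J : (Ideal (𝓞 K))⁰, ClassGroup.mk0 J = c ∧ (J : Ideal (𝓞 K)) ⊔ Ideal.span {m} = ⊤ := by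
  obtain ⟨A, hA⟩ := ClassGroup.mk0_surjective c⁻¹
  have hA0 : (A : Ideal (𝓞 K)) ≠ 0 := nonZeroDivisors.coe_ne_zero A
  have hm0 : Ideal.span {m} ≠ (0 : Ideal (𝓞 K)) := by
    rw [Ne, Ideal.zero_eq_bot, Ideal.span_singleton_eq_bot]; exact hm
  obtain ⟨a, ha⟩ := IsDedekindDomain.exists_sup_span_eq
    (I := (A : Ideal (𝓞 K)) * Ideal.span {m}) (J := A) Ideal.mul_le_left (mul_ne_zero hA0 hm0)
  by_cases ha0 : a = 0
  · obtain ⟨J, hJ⟩ := ClassGroup.mk0_surjective c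
    refine ⟨J, hJ, ?_⟩
    rw [ha0] at ha
    simp only [Set.singleton_zero, Ideal.span_zero, sup_bot_eq, bot_le] at ha
    have : Ideal.span {m} = 1 := by
      apply mul_left_cancel₀ hA0; rw [ha, mul_one]
    rw [this, Ideal.one_eq_top, sup_top_eq]
  · have hle : Ideal.span {a} ≤ (A : Ideal (𝓞 K)) := by
      conv_rhs => rw [← ha]
      exact le_sup_right
    obtain ⟨B, hB⟩ := Ideal.dvd_iff_le.mpr hle
    have hB0 : B ≠ 0 := by
      rintro rfl
      rw [mul_zero, Ideal.zero_eq_bot, Ideal.span_singleton_eq_bot] at hB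
      exact ha0 hB
    let B' : (Ideal (𝓞 K))⁰ := ⟨B, mem_nonZeroDivisors_of_ne_zero hB0⟩
    refine ⟨B', ?_, ?_⟩
    · have h1 : ClassGroup.mk0 (A * B') = 1 := by
        rw [ClassGroup.mk0_eq_one_iff]
        exact ⟨a, hB.symm⟩
      rw [map_mul, hA] at h1
      exact (inv_mul_eq_one.mp h1).symm
    · have : (A : Ideal (𝓞 K)) * (Ideal.span {m} ⊔ B) = A * 1 := by
        rw [Ideal.mul_sup, ← hB, ha, mul_one]
      have := mul_left_cancel₀ hA0 this
      rw [sup_comm, ← Ideal.one_eq_top]; exact this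

/-- summation over ideals, split by class -/
noncomputable def clsEquiv (J : ClassGroup (𝓞 K) → (Ideal (𝓞 K))⁰)
    (hJ : Function.Bijective fun c => ClassGroup.mk0 (J c)) :
    (Σ c, {I : (Ideal (𝓞 K))⁰ // ((I * J c : (Ideal (𝓞 K))⁰) : Ideal (𝓞 K)).IsPrincipal}) ≃
      (Ideal (𝓞 K))⁰ :=
  Equiv.ofBijective (fun x => x.2.1) (by
    constructor
    · rintro ⟨c, I, hI⟩ ⟨c', I', hI'⟩ h
      simp only at h
      subst h
      have h1 := (ClassGroup.mk0_eq_one_iff (I * J c).2).mpr hI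
      have h2 := (ClassGroup.mk0_eq_one_iff (I * J c').2).mpr hI'
      rw [Subtype.coe_eta, map_mul] at h1 h2
      have : c = c' := hJ.1 (mul_left_cancel (h1.trans h2.symm))
      subst this
      rfl
    · intro I
      obtain ⟨c, hc⟩ := hJ.2 (ClassGroup.mk0 I)⁻¹
      refine ⟨⟨c, I, ?_⟩, rfl⟩
      rw [← ClassGroup.mk0_eq_one_iff (I * J c).2, Subtype.coe_eta, map_mul]
      simp only at hc
      rw [hc, mul_inv_cancel])

theorem exists_reps (K : Type*) [Field K] [NumberField K] :
    ∃ J : ClassGroup (𝓞 K) → (Ideal (𝓞 K))⁰, ∀ c, ClassGroup.mk0 (J c) = c :=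
  ⟨fun c => (ClassGroup.mk0_surjective c).choose, fun c => (ClassGroup.mk0_surjective c).choose_spec⟩

theorem toPId_injective (J : (Ideal (𝓞 K))⁰) : Function.Injective
    (fun I : {I : (Ideal (𝓞 K))⁰ // ((I * J : (Ideal (𝓞 K))⁰) : Ideal (𝓞 K)).IsPrincipal} =>
      (⟨I.1 * J, I.2⟩ : PId K)) := by
  intro I I' h
  have h1 : I.1 * J = I'.1 * J := congrArg Subtype.val h
  exact Subtype.ext (mul_right_cancel h1)

theorem summable_nrm {s : ℝ} (hs : 1 < s) : Summable fun I : (Ideal (𝓞 K))⁰ => nrm I ^ (-s) := by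
  obtain ⟨J, hJ⟩ := exists_reps K
  have hJb : Function.Bijective fun c => ClassGroup.mk0 (J c) := by
    simp_rw [hJ]; exact Function.bijective_id
  rw [← (clsEquiv J hJb).summable_iff]
  refine (summable_sigma_of_nonneg (fun x => Real.rpow_nonneg (by linarith [one_le_nrm (clsEquiv J hJb x)]) _)).mpr ?_
  refine ⟨fun c => ?_, (hasSum_fintype _).summable⟩
  have h := (summable_nrm_PId (K := K) hs).comp_injective (toPId_injective (J c))
  have hpos : 0 < nrm (J c) := by linarith [one_le_nrm (J c)]
  have h2 := h.mul_left ((nrm (J c) ^ (-s))⁻¹)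
  refine h2.congr fun I => ?_
  simp only [Function.comp_apply, nrm_mul]
  have : 0 < nrm (J c) ^ (-s) := Real.rpow_pos_of_pos hpos _
  rw [Real.mul_rpow (by linarith [one_le_nrm I.1]) hpos.le]
  have e : clsEquiv J hJb ⟨c, I⟩ = I.1 := rfl
  rw [e]
  field_simp

/-- sum over ideals multiple of J that are principal -/
noncomputable def SJ (f : (Ideal (𝓞 K))⁰ → ℂ) (J : (Ideal (𝓞 K))⁰) : ℂ :=
  ∑' I : {I : (Ideal (𝓞 K))⁰ // ((I * J : (Ideal (𝓞 K))⁰) : Ideal (𝓞 K)).IsPrincipal}, f (I.1 * J)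

open Classical in
theorem SJ_eq (f : (Ideal (𝓞 K))⁰ → ℂ) (J : (Ideal (𝓞 K))⁰) :
    SJ f J = ∑' I : PId K, if (I.1 : Ideal (𝓞 K)) ≤ J then f I.1 else 0 := by
  unfold SJ
  rw [← (toPId_injective J).tsum_eq]
  · refine tsum_congr fun I => ?_
    rw [if_pos]
    exact (Ideal.mul_le_right : (I.1 : Ideal (𝓞 K)) * (J : Ideal (𝓞 K)) ≤ J)
  · intro I hI
    have hle : (I.1 : Ideal (𝓞 K)) ≤ J := by
      by_contra h
      exact hI (if_neg h)
    obtain ⟨B, hB⟩ := Ideal.dvd_iff_le.mpr hle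
    have hB0 : B ≠ 0 := by
      rintro rfl
      rw [mul_zero] at hB
      exact nonZeroDivisors.coe_ne_zero I.1 hB
    let B' : (Ideal (𝓞 K))⁰ := ⟨B, mem_nonZeroDivisors_of_ne_zero hB0⟩
    have e : B' * J = I.1 := Subtype.ext (by rw [hB, mul_comm]; rfl)
    refine ⟨⟨B', by rw [e]; exact I.2⟩, Subtype.ext e⟩

theorem tsum_cls (f : (Ideal (𝓞 K))⁰ →* ℂ) (hf : Summable f)
    (J : ClassGroup (𝓞 K) → (Ideal (𝓞 K))⁰)
    (hJ : Function.Bijective fun c => ClassGroup.mk0 (J c)) (hfJ : ∀ c, f (J c) ≠ 0) :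
    ∑' I, f I = ∑ c, (f (J c))⁻¹ * SJ f (J c) := by
  rw [← (clsEquiv J hJ).tsum_eq]
  have hs := (clsEquiv J hJ).summable_iff.mpr hf
  rw [Summable.tsum_sigma (by exact hs), tsum_fintype]
  refine Finset.sum_congr rfl fun c _ => ?_
  unfold SJ
  rw [← tsum_mul_left]
  refine tsum_congr fun I => ?_
  have e : clsEquiv J hJ ⟨c, I⟩ = I.1 := rfl
  rw [e, map_mul]
  have := hfJ c
  field_simp
end
end OddNorm

namespace OddNorm
section
variable {K : Type*} [Field K] [NumberField K]

open Classical in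
/-- periodic function restricted to an ideal -/
noncomputable def restr (h : 𝓞 K → ℂ) (J : Ideal (𝓞 K)) (α : 𝓞 K) : ℂ := if α ∈ J then h α else 0

theorem norm_restr_le {h : 𝓞 K → ℂ} (hb : ∀ α, ‖h α‖ ≤ 1) (J : Ideal (𝓞 K)) (α : 𝓞 K) :
    ‖restr h J α‖ ≤ 1 := by
  unfold restr; split_ifs
  · exact hb α
  · simp

theorem exists_reps_mul.{u} {K : Type u} [Field K] [NumberField K] (m : 𝓞 K) (J I0 : Ideal (𝓞 K)) (hJ : J ≠ 0)
    (hcop : I0 ⊔ Ideal.span {m} = ⊤) (hI0 : I0 ≠ 0) :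
    ∃ (ι : Type u) (_ : Fintype ι) (r : ι → 𝓞 K), Fintype.card ι = Ideal.absNorm I0 ∧
      (∀ i, r i ∈ J) ∧ (∀ i, m ∣ r i) ∧ ∀ α ∈ J, ∃! i, α - r i ∈ J * I0 := by
  classical
  have hle : J * I0 ≤ J := Ideal.mul_le_left
  have hJI : J * I0 ≠ 0 := mul_ne_zero hJ hI0
  have : Finite (𝓞 K ⧸ (J * I0)) := Ideal.finiteQuotientOfFreeOfNeBot _ hJI
  let ι := ↥(Submodule.map (Submodule.mkQ (J * I0)) J)
  have hfin : Finite ι := Subtype.finite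
  letI : Fintype ι := Fintype.ofFinite ι
  have hcard := Submodule.card_quotient_mul_card_quotient J (J * I0) hle
  obtain ⟨a, ha, b, hb, hab⟩ := Submodule.mem_sup.mp
    ((Ideal.eq_top_iff_one _).mp hcop)
  obtain ⟨b', rfl⟩ := Ideal.mem_span_singleton'.mp hb
  have hx : ∀ i : ι, ∃ x ∈ J, Submodule.mkQ (J * I0) x = i.1 := fun i => i.2
  choose x hxJ hxi using hx
  have hdiff : ∀ i, x i - b' * m * x i ∈ J * I0 := by
    intro i
    have : x i - b' * m * x i = x i * a := by
      have : a = 1 - b' * m := by rw [← hab]; ring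
      rw [this]; ring
    rw [this]
    exact Ideal.mul_mem_mul (hxJ i) ha
  refine ⟨ι, inferInstance, fun i => b' * m * x i, ?_, ?_, ?_, ?_⟩
  · have hJ0 : Nat.card (𝓞 K ⧸ J) ≠ 0 := by
      have := Ideal.finiteQuotientOfFreeOfNeBot J hJ
      exact Nat.card_pos.ne'
    have h1 : Ideal.absNorm (J * I0) = Ideal.absNorm J * Ideal.absNorm I0 := map_mul _ _ _
    rw [Ideal.absNorm_apply, Ideal.absNorm_apply, Submodule.cardQuot_apply,
      Submodule.cardQuot_apply] at h1
    rw [← Nat.card_eq_fintype_card]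
    apply Nat.eq_of_mul_eq_mul_right (Nat.pos_of_ne_zero hJ0)
    rw [mul_comm (Ideal.absNorm I0)]
    exact hcard.trans h1
  · intro i; exact J.mul_mem_left _ (hxJ i)
  · intro i; exact ⟨b' * x i, by ring⟩
  · intro α hα
    have key : ∀ i, α - b' * m * x i ∈ J * I0 ↔ Submodule.mkQ (J * I0) α = i.1 := by
      intro i
      rw [← hxi i, ← sub_eq_zero, ← map_sub, Submodule.mkQ_apply, Submodule.Quotient.mk_eq_zero]
      have e : α - b' * m * x i = (α - x i) + (x i - b' * m * x i) := by ring
      rw [e]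
      exact (J * I0).add_mem_iff_left (hdiff i)
    refine ⟨⟨Submodule.mkQ (J * I0) α, Submodule.mem_map_of_mem hα⟩, (key _).mpr rfl, ?_⟩
    intro i hi
    exact Subtype.ext ((key i).mp hi).symm

theorem translation (D : UnitData K) (m : 𝓞 K) (h : 𝓞 K → ℂ) (hb : ∀ α, ‖h α‖ ≤ 1)
    (hper : ∀ α β, m ∣ β → h (α + β) = h α) (J I0 : Ideal (𝓞 K)) (hJ : J ≠ 0)
    (hcop : I0 ⊔ Ideal.span {m} = ⊤) (hI0 : I0 ≠ 0) :
    ∃ C : ℝ, ∀ s : ℝ, 1 < s → s ≤ 2 →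
      ‖∑' α, restr h J α * (wt D s α : ℂ) -
        (Ideal.absNorm I0 : ℂ) * ∑' α, restr h (J * I0) α * (wt D s α : ℂ)‖ ≤ C := by
  classical
  obtain ⟨ι, _, r, hcard, hrJ, hrm, hr⟩ := exists_reps_mul m J I0 hJ hcop hI0
  have hle : J * I0 ≤ J := Ideal.mul_le_left
  choose g hg hgb using fun i => wt_diff D (r i)
  refine ⟨∑ i, ∑' α, g i α, fun s hs1 hs2 => ?_⟩
  have hsumw : ∀ (q : 𝓞 K → ℂ), (∀ α, ‖q α‖ ≤ 1) → ∀ β, Summable fun α => q α * (wt D s (α + β) : ℂ) := by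
    intro q hq β
    have h1 : Summable fun α => wt D s (α + β) :=
      (summable_wt D hs1).comp_injective (add_left_injective β)
    refine Summable.of_norm_bounded h1 fun α => ?_
    rw [norm_mul, Complex.norm_real, Real.norm_of_nonneg (wt_nonneg D _ _)]
    exact mul_le_of_le_one_left (wt_nonneg D _ _) (hq _)
  have hp : ∀ α, restr h J α = ∑ i, restr h (J * I0) (α - r i) := by
    intro α
    by_cases hα : α ∈ J
    · obtain ⟨i, hi, hu⟩ := hr α hα
      rw [Finset.sum_eq_single i]
      · unfold restr
        rw [if_pos hα, if_pos hi, sub_eq_add_neg, hper]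
        exact (dvd_neg).mpr (hrm i)
      · intro j _ hj
        unfold restr
        rw [if_neg]
        intro hj'
        exact hj (hu j hj')
      · simp
    · symm
      have : ∀ i, α - r i ∉ J * I0 := fun i hi => hα (by
        have := J.add_mem (hle hi) (hrJ i)
        simpa using this)
      unfold restr
      rw [if_neg hα]
      exact Finset.sum_eq_zero fun i _ => if_neg (this i)
  have e1 : ∑' α, restr h J α * (wt D s α : ℂ) =
      ∑ i, ∑' α, restr h (J * I0) α * (wt D s (α + r i) : ℂ) := by
    have : ∀ i, ∑' α, restr h (J * I0) α * (wt D s (α + r i) : ℂ) =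
        ∑' α, restr h (J * I0) (α - r i) * (wt D s α : ℂ) := by
      intro i
      rw [← (Equiv.subRight (r i)).tsum_eq]
      refine tsum_congr fun α => ?_
      simp
    simp_rw [this]
    rw [← Summable.tsum_finsetSum]
    · refine tsum_congr fun α => ?_
      rw [hp, Finset.sum_mul]
    · intro i _
      have := hsumw (fun α => restr h (J * I0) (α - r i)) (fun α => norm_restr_le hb _ _) 0
      simpa using this
  have e2 : (Ideal.absNorm I0 : ℂ) * ∑' α, restr h (J * I0) α * (wt D s α : ℂ) =
      ∑ i : ι, ∑' α, restr h (J * I0) α * (wt D s α : ℂ) := by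
    rw [Finset.sum_const, Finset.card_univ, hcard, nsmul_eq_mul]
  rw [e1, e2, ← Finset.sum_sub_distrib]
  refine (norm_sum_le _ _).trans (Finset.sum_le_sum fun i _ => ?_)
  have s1 := hsumw (restr h (J * I0)) (norm_restr_le hb _) (r i)
  have s2 := hsumw (restr h (J * I0)) (norm_restr_le hb _) 0
  simp only [add_zero] at s2
  rw [← s1.tsum_sub s2]
  refine tsum_of_norm_bounded (hg i).hasSum fun α => ?_
  rw [← mul_sub, norm_mul, ← Complex.ofReal_sub, Complex.norm_real]
  refine (mul_le_of_le_one_left (norm_nonneg _) (norm_restr_le hb _ _)).trans ?_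
  exact hgb i s hs1.le hs2 α

noncomputable def fs (Ψ : (Ideal (𝓞 K))⁰ →* ℂ) (s : ℝ) : (Ideal (𝓞 K))⁰ →* ℂ where
  toFun I := Ψ I * ((nrm I ^ (-s) : ℝ) : ℂ)
  map_one' := by rw [map_one, nrm_one, Real.one_rpow]; simp
  map_mul' I J := by
    rw [map_mul, nrm_mul, Real.mul_rpow (by linarith [one_le_nrm I]) (by linarith [one_le_nrm J])]
    push_cast; ring

theorem fs_apply (Ψ : (Ideal (𝓞 K))⁰ →* ℂ) (s : ℝ) (I) :
    fs Ψ s I = Ψ I * ((nrm I ^ (-s) : ℝ) : ℂ) := rfl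

theorem norm_fs_le (Ψ : (Ideal (𝓞 K))⁰ →* ℂ) (hΨ : ∀ I, ‖Ψ I‖ ≤ 1) (s : ℝ) (I) :
    ‖fs Ψ s I‖ ≤ nrm I ^ (-s) := by
  have h0 : 0 ≤ nrm I ^ (-s) := Real.rpow_nonneg (by linarith [one_le_nrm I]) _
  rw [fs_apply, norm_mul, Complex.norm_real, Real.norm_of_nonneg h0]
  exact mul_le_of_le_one_left h0 (hΨ I)

theorem summable_fs (Ψ : (Ideal (𝓞 K))⁰ →* ℂ) (hΨ : ∀ I, ‖Ψ I‖ ≤ 1) {s : ℝ} (hs : 1 < s) :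
    Summable (fs Ψ s) :=
  Summable.of_norm_bounded (summable_nrm hs) (norm_fs_le Ψ hΨ s)

theorem bounded_L (Ψ : (Ideal (𝓞 K))⁰ →* ℂ) (hΨ : ∀ I, ‖Ψ I‖ ≤ 1) (m : 𝓞 K) (hm : m ≠ 0)
    (hper : ∀ α β (hα : α ≠ 0) (hβ : β ≠ 0), m ∣ α - β → Ψ (pr α hα) = Ψ (pr β hβ))
    (hcop : ∀ J : (Ideal (𝓞 K))⁰, (J : Ideal (𝓞 K)) ⊔ Ideal.span {m} = ⊤ → Ψ J ≠ 0)
    (I0 : (Ideal (𝓞 K))⁰) (hI0 : (I0 : Ideal (𝓞 K)) ⊔ Ideal.span {m} = ⊤) (hne : Ψ I0 ≠ 1) :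
    ∃ C δ : ℝ, 0 < δ ∧ ∀ s : ℝ, 1 < s → s < 1 + δ → ‖∑' I, fs Ψ s I‖ ≤ C := by
  classical
  obtain ⟨D⟩ := nonempty_unitData K
  -- periodic extension
  let h : 𝓞 K → ℂ := fun α => if hα : α = 0 then Ψ (pr m hm) else Ψ (pr α hα)
  have hh : ∀ α (hα : α ≠ 0), h α = Ψ (pr α hα) := fun α hα => dif_neg hα
  have hh0 : h 0 = Ψ (pr m hm) := dif_pos rfl
  have hb : ∀ α, ‖h α‖ ≤ 1 := by
    intro α
    by_cases hα : α = 0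
    · rw [hα, hh0]; exact hΨ _
    · rw [hh α hα]; exact hΨ _
  have hp : ∀ α β, m ∣ β → h (α + β) = h α := by
    intro α β hβ
    by_cases h1 : α = 0 <;> by_cases h2 : α + β = 0
    · rw [h1] at h2 ⊢; rw [h2]
    · have e1 : h α = Ψ (pr m hm) := by rw [h1, hh0]
      rw [hh _ h2, e1]
      apply hper
      rw [h1, zero_add]; exact dvd_sub hβ dvd_rfl
    · rw [h2, hh0, hh _ h1]
      apply hper
      have : m ∣ α := by
        have e : α = -β := eq_neg_of_add_eq_zero_left h2
        rw [e]; exact (dvd_neg).mpr hβ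
      exact dvd_sub dvd_rfl this
    · rw [hh _ h1, hh _ h2]
      apply hper
      simpa using hβ
  choose J hJc hJm using exists_coprime_rep m hm
  have hJb : Function.Bijective fun c => ClassGroup.mk0 (J c) := by
    simp_rw [hJc]; exact Function.bijective_id
  have hJb' : Function.Bijective fun c => ClassGroup.mk0 (J c * I0) := by
    simp_rw [map_mul, hJc]; exact Group.mulRight_bijective _
  choose C hC using fun c => translation D m h hb hp (J c : Ideal (𝓞 K)) I0
    (nonZeroDivisors.coe_ne_zero (J c)) hI0 (nonZeroDivisors.coe_ne_zero I0)
  set ω : ℂ := (Units.torsionOrder K : ℂ) with hω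
  have hω0 : ω ≠ 0 := by
    rw [hω]; exact_mod_cast (Units.torsionOrder_pos K).ne'
  have hunf : ∀ (s : ℝ), 1 < s → ∀ A : (Ideal (𝓞 K))⁰,
      ∑' α, restr h A α * (wt D s α : ℂ) = ω * SJ (fs Ψ s) A := by
    intro s hs A
    rw [SJ_eq, unfold_sum D hs (fun I => if (I : Ideal (𝓞 K)) ≤ A then Ψ I else 0)]
    · congr 1
      refine tsum_congr fun I => ?_
      split_ifs
      · rfl
      · simp
    · intro I
      split_ifs
      · exact hΨ I
      · simp
    · intro α hα
      unfold restr
      rw [hh α hα]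
      have : α ∈ (A : Ideal (𝓞 K)) ↔ ((pr α hα : (Ideal (𝓞 K))⁰) : Ideal (𝓞 K)) ≤ A := by
        change _ ↔ Ideal.span {α} ≤ _
        rw [Ideal.span_singleton_le_iff_mem]
      simp only [this]
  have hΨI0 := hcop I0 hI0
  have hΨJ : ∀ c, Ψ (J c) ≠ 0 := fun c => hcop _ (hJm c)
  have hfs0 : ∀ s (I : (Ideal (𝓞 K))⁰), Ψ I ≠ 0 → fs Ψ s I ≠ 0 := by
    intro s I hI
    rw [fs_apply]
    refine mul_ne_zero hI ?_
    have : 0 < nrm I ^ (-s) := Real.rpow_pos_of_pos (by linarith [one_le_nrm I]) _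
    exact_mod_cast this.ne'
  let n0 : ℂ := (Ideal.absNorm (I0 : Ideal (𝓞 K)) : ℂ)
  -- main identity
  have hmain : ∀ s, 1 < s → (1 - n0 * fs Ψ s I0) * ∑' I, fs Ψ s I =
      ∑ c, (fs Ψ s (J c))⁻¹ * (SJ (fs Ψ s) (J c) - n0 * SJ (fs Ψ s) (J c * I0)) := by
    intro s hs
    have t1 := tsum_cls (fs Ψ s) (summable_fs Ψ hΨ hs) J hJb (fun c => hfs0 s _ (hΨJ c))
    have t2 := tsum_cls (fs Ψ s) (summable_fs Ψ hΨ hs) (fun c => J c * I0) hJb'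
      (fun c => hfs0 s _ (by rw [map_mul]; exact mul_ne_zero (hΨJ c) hΨI0))
    have t3 : fs Ψ s I0 * ∑' I, fs Ψ s I = ∑ c, (fs Ψ s (J c))⁻¹ * SJ (fs Ψ s) (J c * I0) := by
      rw [t2, Finset.mul_sum]
      refine Finset.sum_congr rfl fun c _ => ?_
      rw [map_mul]
      have := hfs0 s _ hΨI0
      have := hfs0 s _ (hΨJ c)
      field_simp
    rw [sub_mul, one_mul, mul_assoc, t3]
    conv_lhs => rw [t1]
    rw [Finset.mul_sum, ← Finset.sum_sub_distrib]
    refine Finset.sum_congr rfl fun c _ => ?_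
    ring
  -- bound RHS
  have hbd : ∀ s, 1 < s → s ≤ 2 → ‖(1 - n0 * fs Ψ s I0) * ∑' I, fs Ψ s I‖ ≤
      ∑ c, (‖Ψ (J c)‖⁻¹ * nrm (J c) ^ (2:ℝ)) * (‖ω‖⁻¹ * C c) := by
    intro s hs hs2
    rw [hmain s hs]
    refine (norm_sum_le _ _).trans (Finset.sum_le_sum fun c _ => ?_)
    rw [norm_mul]
    have hn1 := one_le_nrm (J c)
    have b1 : ‖(fs Ψ s (J c))⁻¹‖ ≤ ‖Ψ (J c)‖⁻¹ * nrm (J c) ^ (2:ℝ) := by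
      rw [norm_inv, fs_apply, norm_mul, Complex.norm_real,
        Real.norm_of_nonneg (Real.rpow_nonneg (by linarith) _), mul_inv, Real.rpow_neg (by linarith),
        inv_inv]
      refine mul_le_mul_of_nonneg_left ?_ (by positivity)
      exact Real.rpow_le_rpow_of_exponent_le hn1 hs2
    have b2 : ‖SJ (fs Ψ s) (J c) - n0 * SJ (fs Ψ s) (J c * I0)‖ ≤ ‖ω‖⁻¹ * C c := by
      have := hC c s hs hs2
      have e := hunf s hs (J c * I0)
      rw [Submonoid.coe_mul] at e
      rw [hunf s hs (J c), e] at this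
      have e : ω * SJ (fs Ψ s) (J c) - (Ideal.absNorm (I0 : Ideal (𝓞 K)) : ℂ) * (ω * SJ (fs Ψ s) (J c * I0))
        = ω * (SJ (fs Ψ s) (J c) - n0 * SJ (fs Ψ s) (J c * I0)) := by
          simp only [n0]; ring
      rw [e, norm_mul] at this
      have hpos : 0 < ‖ω‖ := norm_pos_iff.mpr hω0
      rw [inv_mul_eq_div, le_div_iff₀ hpos, mul_comm]
      exact this
    exact mul_le_mul b1 b2 (norm_nonneg _) (by positivity)
  -- factor limit
  have hlim : Filter.Tendsto (fun s : ℝ => ‖1 - n0 * fs Ψ s I0‖) (nhds 1) (nhds ‖1 - Ψ I0‖) := by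
    have hn1 := one_le_nrm I0
    have hc : Continuous fun s : ℝ => ‖1 - n0 * fs Ψ s I0‖ := by
      simp only [fs_apply]
      have : Continuous fun s : ℝ => nrm I0 ^ (-s) :=
        Real.continuous_const_rpow (by linarith) |>.comp continuous_neg
      fun_prop
    have := hc.tendsto 1
    convert this using 3
    simp only [fs_apply, n0]
    rw [Real.rpow_neg_one]
    have : ((Ideal.absNorm (I0 : Ideal (𝓞 K)) : ℂ)) = ((nrm I0 : ℝ) : ℂ) := by unfold nrm; simp
    rw [this]
    have h0 : ((nrm I0 : ℝ) : ℂ) ≠ 0 := by exact_mod_cast (by linarith : nrm I0 ≠ 0)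
    push_cast
    field_simp
  have hpos : 0 < ‖1 - Ψ I0‖ := norm_pos_iff.mpr (sub_ne_zero.mpr hne.symm)
  have hev := hlim.eventually (lt_mem_nhds (half_lt_self hpos))
  obtain ⟨δ, hδ, hball⟩ := Metric.eventually_nhds_iff.mp hev
  refine ⟨(∑ c, (‖Ψ (J c)‖⁻¹ * nrm (J c) ^ (2:ℝ)) * (‖ω‖⁻¹ * C c)) / (‖1 - Ψ I0‖ / 2), min δ 1,
    lt_min hδ one_pos, fun s hs1 hs2 => ?_⟩
  have h1 : s < 1 + δ := hs2.trans_le (by gcongr; exact min_le_left _ _)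
  have h2 : s < 1 + 1 := hs2.trans_le (by gcongr; exact min_le_right _ _)
  have h3 := hball (y := s) (by rw [Real.dist_eq, abs_of_pos (by linarith)]; linarith)
  have h4 := hbd s hs1 (by linarith)
  rw [norm_mul] at h4
  rw [le_div_iff₀ (by positivity), mul_comm]
  refine le_trans ?_ h4
  exact mul_le_mul_of_nonneg_right h3.le (norm_nonneg _)
end
end OddNorm

namespace OddNorm
section
variable {K : Type*} [Field K] [NumberField K]

theorem norm_nonneg_rat [IsTotallyComplex K] (x : K) : 0 ≤ Algebra.norm ℚ x := by
  classical
  have h := Algebra.norm_eq_prod_embeddings ℚ ℂ x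
  rw [← (RingHom.equivRatAlgHom (R := K) (S := ℂ)).prod_comp] at h
  rw [← Finset.prod_fiberwise Finset.univ InfinitePlace.mk] at h
  have key : ∀ w : InfinitePlace K, (∏ φ ∈ Finset.univ.filter (fun φ : K →+* ℂ => InfinitePlace.mk φ = w),
      (RingHom.equivRatAlgHom (R := K) (S := ℂ) φ) x) = (((w x) ^ 2 : ℝ) : ℂ) := by
    intro w
    have e : (Finset.univ.filter (fun φ : K →+* ℂ => InfinitePlace.mk φ = w)) =
        {w.embedding, ComplexEmbedding.conjugate w.embedding} := by
      ext φ
      rw [Finset.mem_filter, Finset.mem_insert, Finset.mem_singleton]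
      conv_lhs => rw [← w.mk_embedding, InfinitePlace.mk_eq_iff]
      simp only [Finset.mem_univ, true_and]
      refine or_congr Iff.rfl ?_
      rw [ComplexEmbedding.conjugate, star_involutive.eq_iff]
    have hne : w.embedding ≠ ComplexEmbedding.conjugate w.embedding := by
      intro h
      exact IsTotallyComplex.complexEmbedding_not_isReal w.embedding
        (ComplexEmbedding.isReal_iff.mpr h.symm)
    rw [e, Finset.prod_pair hne]
    change w.embedding x * (starRingEnd ℂ) (w.embedding x) = _
    rw [Complex.mul_conj, Complex.normSq_eq_norm_sq, InfinitePlace.norm_embedding_eq]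
  rw [Finset.prod_congr rfl (fun w _ => key w)] at h
  have h2 : ((Algebra.norm ℚ x : ℝ) : ℂ) = ((∏ w : InfinitePlace K, (w x)^2 : ℝ) : ℂ) := by
    rw [Complex.ofReal_prod, ← h]; simp
  have h3 := Complex.ofReal_injective h2
  have : (0 : ℝ) ≤ (Algebra.norm ℚ x : ℝ) := by rw [h3]; positivity
  exact_mod_cast this

theorem norm_nonneg_int [IsTotallyComplex K] (x : 𝓞 K) : 0 ≤ Algebra.norm ℤ x := by
  have := norm_nonneg_rat (x : K)
  rw [← Algebra.coe_norm_int] at this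
  exact_mod_cast this

theorem norm_cast_eq (m : ℕ) (α β : 𝓞 K) (h : (m : 𝓞 K) ∣ α - β) :
    ((Algebra.norm ℤ α : ℤ) : ZMod m) = ((Algebra.norm ℤ β : ℤ) : ZMod m) := by
  classical
  let b := RingOfIntegers.basis K
  obtain ⟨γ, hγ⟩ := h
  have hα : α = β + m * γ := by rw [← hγ]; ring
  rw [Algebra.norm_eq_matrix_det b, Algebra.norm_eq_matrix_det b]
  change (Int.castRingHom (ZMod m)) _ = (Int.castRingHom (ZMod m)) _
  rw [RingHom.map_det, RingHom.map_det]
  congr 1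
  rw [hα, map_add, map_mul, map_natCast, map_add, map_mul, map_natCast]
  rw [add_eq_left]
  have : ((m : ℕ) : Matrix (Module.Free.ChooseBasisIndex ℤ (𝓞 K)) (Module.Free.ChooseBasisIndex ℤ (𝓞 K)) (ZMod m)) = 0 := by
    ext i j
    rw [← nsmul_one, Matrix.smul_apply, nsmul_eq_mul, CharP.cast_eq_zero]; simp
  rw [this, zero_mul]

/-- class group character times Dirichlet character of the norm -/
noncomputable def psiChi (ψ : ClassGroup (𝓞 K) →* ℂˣ) {m : ℕ} (χ : DirichletCharacter ℂ m) :
    (Ideal (𝓞 K))⁰ →* ℂ where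
  toFun I := (ψ (ClassGroup.mk0 I) : ℂ) * χ ((Ideal.absNorm (I : Ideal (𝓞 K)) : ℕ) : ZMod m)
  map_one' := by simp
  map_mul' I J := by
    simp only [map_mul, Submonoid.coe_mul, Units.val_mul, Nat.cast_mul]; ring

theorem psiChi_apply (ψ : ClassGroup (𝓞 K) →* ℂˣ) {m : ℕ} (χ : DirichletCharacter ℂ m) (I) :
    psiChi ψ χ I = (ψ (ClassGroup.mk0 I) : ℂ) * χ ((Ideal.absNorm (I : Ideal (𝓞 K)) : ℕ) : ZMod m) := rfl

theorem norm_psi (ψ : ClassGroup (𝓞 K) →* ℂˣ) (c) : ‖(ψ c : ℂ)‖ = 1 := by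
  have h : (ψ c : ℂ) ^ (Fintype.card (ClassGroup (𝓞 K))) = 1 := by
    rw [← Units.val_pow_eq_pow_val, ← map_pow, pow_card_eq_one]; simp
  exact Complex.norm_eq_one_of_pow_eq_one h Fintype.card_ne_zero

theorem norm_psiChi_le (ψ : ClassGroup (𝓞 K) →* ℂˣ) {m : ℕ} [NeZero m] (χ : DirichletCharacter ℂ m) (I) :
    ‖psiChi ψ χ I‖ ≤ 1 := by
  rw [psiChi_apply, norm_mul, norm_psi, one_mul]
  exact DirichletCharacter.norm_le_one χ _

theorem coprime_absNorm {m : ℕ} (I : Ideal (𝓞 K)) (h : I ⊔ Ideal.span {(m : 𝓞 K)} = ⊤) :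
    (Ideal.absNorm I).Coprime m := by
  by_contra hc
  obtain ⟨p, hp, h1, h2⟩ := Nat.Prime.not_coprime_iff_dvd.mp hc
  -- m is a unit mod I
  by_cases hI : I = ⊥
  · subst hI
    rw [bot_sup_eq, Ideal.span_singleton_eq_top] at h
    obtain ⟨q, rfl⟩ := h2
    rw [Nat.cast_mul] at h
    have hu : IsUnit ((p : ℕ) : 𝓞 K) := isUnit_of_mul_isUnit_left h
    have := hu.map (Algebra.norm ℤ)
    rw [← map_natCast (algebraMap ℤ (𝓞 K)), Algebra.norm_algebraMap, isUnit_pow_iff Module.finrank_pos.ne'] at this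
    have := Int.isUnit_iff.mp this
    have := hp.two_le
    omega
  have : Finite (𝓞 K ⧸ I) := Ideal.finiteQuotientOfFreeOfNeBot _ hI
  have : Fact p.Prime := ⟨hp⟩
  rw [Ideal.absNorm_apply, Submodule.cardQuot_apply] at h1
  obtain ⟨x, hx⟩ := exists_prime_addOrderOf_dvd_card' (G := 𝓞 K ⧸ I) p h1
  have hu : IsUnit (Ideal.Quotient.mk I (m : 𝓞 K)) := by
    obtain ⟨a, ha, b, hb, hab⟩ := Submodule.mem_sup.mp ((Ideal.eq_top_iff_one _).mp h)
    obtain ⟨b', rfl⟩ := Ideal.mem_span_singleton'.mp hb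
    have := congrArg (Ideal.Quotient.mk I) hab
    rw [map_add, Ideal.Quotient.eq_zero_iff_mem.mpr ha, zero_add, map_mul, map_one] at this
    exact IsUnit.of_mul_eq_one_right _ this
  have h0 : (Ideal.Quotient.mk I (m : 𝓞 K)) * x = 0 := by
    obtain ⟨q, rfl⟩ := h2
    rw [map_natCast, ← nsmul_eq_mul, mul_comm, mul_smul, ← hx, addOrderOf_nsmul_eq_zero, smul_zero]
  have := (hu.mul_right_eq_zero).mp h0
  rw [this, addOrderOf_zero] at hx
  exact hp.one_lt.ne hx

theorem bounded_psiChi [IsTotallyComplex K] (ψ : ClassGroup (𝓞 K) →* ℂˣ) {m : ℕ} [NeZero m]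
    (χ : DirichletCharacter ℂ m)
    (I0 : (Ideal (𝓞 K))⁰) (hI0 : (I0 : Ideal (𝓞 K)) ⊔ Ideal.span {(m : 𝓞 K)} = ⊤)
    (hne : psiChi ψ χ I0 ≠ 1) :
    ∃ C δ : ℝ, 0 < δ ∧ ∀ s : ℝ, 1 < s → s < 1 + δ → ‖∑' I, fs (psiChi ψ χ) s I‖ ≤ C := by
  refine bounded_L (psiChi ψ χ) (norm_psiChi_le ψ χ) (m : 𝓞 K) (by exact_mod_cast NeZero.ne m)
    ?_ ?_ I0 hI0 hne
  · intro α β hα hβ hd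
    have key : ∀ α (hα : α ≠ 0), psiChi ψ χ (pr α hα) = χ ((Algebra.norm ℤ α : ℤ) : ZMod m) := by
      intro α hα
      rw [psiChi_apply]
      have h1 : ClassGroup.mk0 (pr α hα) = 1 := by
        rw [ClassGroup.mk0_eq_one_iff]
        exact ⟨⟨α, rfl⟩⟩
      have h2 : Ideal.absNorm ((pr α hα : (Ideal (𝓞 K))⁰) : Ideal (𝓞 K)) = (Algebra.norm ℤ α).natAbs :=
        Ideal.absNorm_span_singleton α
      have h3 : (((Algebra.norm ℤ α).natAbs : ℕ) : ℤ) = Algebra.norm ℤ α :=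
        Int.natAbs_of_nonneg (norm_nonneg_int α)
      rw [h1, h2, map_one, Units.val_one, one_mul]
      conv_rhs => rw [← h3]
      rw [Int.cast_natCast]
    rw [key, key, norm_cast_eq m α β hd]
  · intro J hJ
    rw [psiChi_apply]
    refine mul_ne_zero (Units.ne_zero _) ?_
    have := coprime_absNorm _ hJ
    have hu : IsUnit ((Ideal.absNorm (J : Ideal (𝓞 K)) : ℕ) : ZMod m) := (ZMod.isUnit_iff_coprime _ _).mpr this
    exact (hu.map χ).ne_zero
end
end OddNorm

namespace OddNorm
section
open IsDedekindDomain
variable {K : Type*} [Field K] [NumberField K]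

/-- prime as a nonzero ideal -/
noncomputable def pI (p : HeightOneSpectrum (𝓞 K)) : (Ideal (𝓞 K))⁰ :=
  ⟨p.asIdeal, mem_nonZeroDivisors_of_ne_zero p.ne_bot⟩

/-- ideals coprime to all primes in S -/
def cop (S : Finset (HeightOneSpectrum (𝓞 K))) : Set (Ideal (𝓞 K))⁰ := {I | ∀ p ∈ S, ¬ pI p ∣ I}

theorem pI_dvd_iff (p : HeightOneSpectrum (𝓞 K)) (I : (Ideal (𝓞 K))⁰) :
    pI p ∣ I ↔ p.asIdeal ∣ (I : Ideal (𝓞 K)) := by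
  constructor
  · rintro ⟨J, rfl⟩; exact ⟨J, rfl⟩
  · rintro ⟨J, hJ⟩
    refine ⟨⟨J, mem_nonZeroDivisors_of_ne_zero ?_⟩, Subtype.ext hJ⟩
    rintro rfl
    exact nonZeroDivisors.coe_ne_zero I (by rw [hJ, mul_zero])

theorem pI_mul_mem_cop {S : Finset (HeightOneSpectrum (𝓞 K))} {p : HeightOneSpectrum (𝓞 K)} (hp : p ∉ S)
    (J : (Ideal (𝓞 K))⁰) : pI p * J ∈ cop S ↔ J ∈ cop S := by
  refine forall₂_congr fun q hq => not_congr ?_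
  rw [pI_dvd_iff, pI_dvd_iff, Submonoid.coe_mul]
  have hqp : Prime q.asIdeal := q.prime
  rw [hqp.dvd_mul]
  refine or_iff_right ?_
  intro h
  have : p.asIdeal ≤ q.asIdeal := Ideal.dvd_iff_le.mp h
  have := p.isMaximal.eq_of_le q.isPrime.ne_top this
  exact hp ((HeightOneSpectrum.ext this) ▸ hq)

open Classical in
theorem tsum_cop (f : (Ideal (𝓞 K))⁰ →* ℂ) (hf : Summable f) (S : Finset (HeightOneSpectrum (𝓞 K))) :
    ∑' I, (cop S).indicator f I = (∏ p ∈ S, (1 - f (pI p))) * ∑' I, f I := by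
  induction S using Finset.induction with
  | empty =>
    have : cop (∅ : Finset (HeightOneSpectrum (𝓞 K))) = Set.univ := by
      ext I; simp [cop]
    simp [this]
  | insert p S hp ih =>
    rw [Finset.prod_insert hp, mul_assoc, ← ih, sub_mul, one_mul]
    have hinj : Function.Injective fun J : (Ideal (𝓞 K))⁰ => pI p * J := mul_right_injective _
    have e1 : f (pI p) * ∑' I, (cop S).indicator f I =
        ∑' I, (cop S ∩ {I | pI p ∣ I}).indicator f I := by
      rw [← tsum_mul_left]
      rw [← hinj.tsum_eq (f := (cop S ∩ {I | pI p ∣ I}).indicator f)]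
      · refine tsum_congr fun J => ?_
        by_cases hJ : J ∈ cop S
        · have : pI p * J ∈ cop S ∩ {I | pI p ∣ I} := ⟨(pI_mul_mem_cop hp J).mpr hJ, dvd_mul_right _ _⟩
          rw [Set.indicator_of_mem hJ, Set.indicator_of_mem this, map_mul]
        · have : pI p * J ∉ cop S ∩ {I | pI p ∣ I} := fun h => hJ ((pI_mul_mem_cop hp J).mp h.1)
          rw [Set.indicator_of_notMem hJ, Set.indicator_of_notMem this, mul_zero]
      · intro I hI
        obtain ⟨⟨_, ⟨J, rfl⟩⟩, _⟩ := Function.mem_support.mp hI |> fun h => (Set.indicator_apply_ne_zero.mp h)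
        exact ⟨J, rfl⟩
    rw [e1, ← (hf.indicator _).tsum_sub (hf.indicator _)]
    refine tsum_congr fun I => ?_
    have hc : I ∈ cop (insert p S) ↔ ¬ pI p ∣ I ∧ I ∈ cop S := by
      simp [cop]
    by_cases h1 : I ∈ cop S <;> by_cases h2 : pI p ∣ I <;>
      simp [Set.indicator, hc, h1, h2]

theorem exists_prime_dvd (I : (Ideal (𝓞 K))⁰) (hI : I ≠ 1) : ∃ p, pI p ∣ I := by
  have h : (I : Ideal (𝓞 K)) ≠ ⊤ := fun h => hI (Subtype.ext (by rw [h, Submonoid.coe_one, Ideal.one_eq_top]))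
  obtain ⟨P, hP, hle⟩ := Ideal.exists_le_maximal _ h
  have hb : P ≠ ⊥ := by
    rintro rfl
    exact nonZeroDivisors.coe_ne_zero I (le_bot_iff.mp hle)
  exact ⟨⟨P, hP.isPrime, hb⟩, (pI_dvd_iff _ _).mpr (Ideal.dvd_iff_le.mpr hle)⟩

theorem euler (f : (Ideal (𝓞 K))⁰ →* ℂ) (hf : Summable f) :
    Filter.Tendsto (fun S : Finset (HeightOneSpectrum (𝓞 K)) => (∏ p ∈ S, (1 - f (pI p))) * ∑' I, f I)
      Filter.atTop (nhds 1) := by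
  classical
  simp_rw [← tsum_cop f hf]
  have h1 : (1 : ℂ) = ∑' I : (Ideal (𝓞 K))⁰, ({1} : Set (Ideal (𝓞 K))⁰).indicator f I := by
    rw [tsum_eq_single 1]
    · simp
    · intro I hI; simp [hI]
  rw [h1]
  refine tendsto_tsum_of_dominated_convergence (bound := fun I => ‖f I‖) hf.norm ?_ ?_
  · intro I
    by_cases hI : I = 1
    · subst hI
      refine tendsto_const_nhds.congr fun S => ?_
      have : (1 : (Ideal (𝓞 K))⁰) ∈ cop S := by
        intro p _ h
        have := (pI_dvd_iff p 1).mp h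
        exact p.prime.not_isUnit (isUnit_of_dvd_one this)
      rw [Set.indicator_of_mem this, Set.indicator_of_mem (by simp)]
    · obtain ⟨p, hp⟩ := exists_prime_dvd I hI
      refine tendsto_const_nhds.congr' ?_
      filter_upwards [Filter.eventually_ge_atTop {p}] with S hS
      rw [Set.indicator_of_notMem (by simpa using hI), Set.indicator_of_notMem]
      intro h
      exact h p (hS (Finset.mem_singleton_self p)) hp
  · refine Filter.Eventually.of_forall fun S I => ?_
    exact norm_indicator_le_norm_self _ _
end
end OddNorm

namespace OddNorm
section
variable {K : Type*} [Field K] [NumberField K]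

theorem zeta_eq {s : ℝ} (hs : 1 < s) :
    dedekindZeta K (s : ℂ) = ((∑' I : (Ideal (𝓞 K))⁰, nrm I ^ (-s) : ℝ) : ℂ) := by
  classical
  have hsum := summable_nrm (K := K) hs
  let g : (Ideal (𝓞 K))⁰ → ℕ := fun I => Ideal.absNorm (I : Ideal (𝓞 K))
  let e := Equiv.sigmaFiberEquiv g
  have h1 : ∑' I : (Ideal (𝓞 K))⁰, nrm I ^ (-s) = ∑' n : ℕ, ∑' I : {I // g I = n}, nrm I.1 ^ (-s) := by
    rw [← e.tsum_eq]
    exact ((e.summable_iff).mpr hsum).tsum_sigma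
  rw [h1, Complex.ofReal_tsum]
  unfold dedekindZeta LSeries
  refine tsum_congr fun n => ?_
  have hn : ∀ I : {I // g I = n}, nrm I.1 ^ (-s) = (n : ℝ) ^ (-s) := by
    rintro ⟨I, rfl⟩; rfl
  simp_rw [hn]
  by_cases h0 : n = 0
  · subst h0
    rw [LSeries.term_zero]
    have : IsEmpty {I // g I = 0} := ⟨fun I => by
      have h1 := one_le_nrm I.1
      have h2 : nrm I.1 = ((g I.1 : ℕ) : ℝ) := rfl
      rw [h2, I.2] at h1
      norm_num at h1⟩
    simp
  · rw [LSeries.term_of_ne_zero h0]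
    have hc : Nat.card {I // g I = n} = Nat.card {I : Ideal (𝓞 K) // Ideal.absNorm I = n} := by
      refine Nat.card_congr ⟨fun I => ⟨I.1.1, I.2⟩, fun I => ⟨⟨I.1, ?_⟩, I.2⟩, fun _ => rfl, fun _ => rfl⟩
      refine mem_nonZeroDivisors_of_ne_zero ?_
      intro hz
      apply h0
      rw [← I.2, hz]; simp
    rw [tsum_const, hc, nsmul_eq_mul]
    push_cast
    rw [Complex.ofReal_cpow (by positivity)]
    push_cast
    rw [Complex.cpow_neg, div_eq_mul_inv]

theorem zeta_atTop : Filter.Tendsto (fun s : ℝ => ∑' I : (Ideal (𝓞 K))⁰, nrm I ^ (-s))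
    (nhdsWithin 1 (Set.Ioi 1)) Filter.atTop := by
  have h := NumberField.tendsto_sub_one_mul_dedekindZeta_nhdsGT K
  have h2 : Filter.Tendsto (fun s : ℝ => (s - 1) * ∑' I : (Ideal (𝓞 K))⁰, nrm I ^ (-s))
      (nhdsWithin 1 (Set.Ioi 1)) (nhds (dedekindZeta_residue K)) := by
    have h3 := (Complex.continuous_re.tendsto _).comp h
    rw [Complex.ofReal_re] at h3
    refine h3.congr' ?_
    filter_upwards [self_mem_nhdsWithin] with s hs
    simp only [Function.comp]
    rw [zeta_eq hs]
    norm_cast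
  have h3 : Filter.Tendsto (fun s : ℝ => (s - 1)⁻¹) (nhdsWithin 1 (Set.Ioi 1)) Filter.atTop := by
    apply Filter.Tendsto.inv_tendsto_nhdsGT_zero
    apply tendsto_nhdsWithin_of_tendsto_nhds_of_eventually_within
    · have : Filter.Tendsto (fun s : ℝ => s - 1) (nhds 1) (nhds (1 - 1)) := by
        apply Continuous.tendsto; fun_prop
      rw [sub_self] at this
      exact this.mono_left nhdsWithin_le_nhds
    · filter_upwards [self_mem_nhdsWithin] with s hs
      exact sub_pos.mpr (Set.mem_Ioi.mp hs)
  refine (h3.atTop_mul_pos (dedekindZeta_residue_pos K) h2).congr' ?_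
  filter_upwards [self_mem_nhdsWithin] with s hs
  have : s - 1 ≠ 0 := (sub_pos.mpr (Set.mem_Ioi.mp hs)).ne'
  field_simp
end
end OddNorm

namespace OddNorm
section
open Classical in
theorem prod_chi (m : ℕ) [NeZero m] (u : (ZMod m)ˣ) (z : ℂ) :
    ∏ χ : DirichletCharacter ℂ m, (1 - χ u * z) =
      (1 - z ^ orderOf u) ^ (m.totient / orderOf u) ∧ orderOf u ∣ m.totient := by
  let X := DirichletCharacter ℂ m
  let ev : X →* ℂˣ :=
    { toFun := fun χ => Units.map (χ : ZMod m →* ℂ) u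
      map_one' := by ext; exact MulChar.one_apply_coe u
      map_mul' := fun a b => by ext; exact MulChar.mul_apply a b u }
  have hev : ∀ χ : X, ((ev χ : ℂˣ) : ℂ) = χ u := fun χ => rfl
  set f := orderOf u with hf
  have hfpos : 0 < f := orderOf_pos u
  have : NeZero f := ⟨hfpos.ne'⟩
  have hcard : Fintype.card X = m.totient := by
    rw [← Nat.card_eq_fintype_card, Nat.card_congr (DirichletCharacter.mulEquiv_units ℂ m).some.toEquiv, Nat.card_eq_fintype_card, ZMod.card_units_eq_totient]
  -- range
  have hle : ev.range ≤ rootsOfUnity f ℂ := by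
    rintro _ ⟨χ, rfl⟩
    rw [mem_rootsOfUnity]
    ext
    rw [Units.val_pow_eq_pow_val, hev, ← map_pow, ← Units.val_pow_eq_pow_val, pow_orderOf_eq_one]
    simp
  have hdvd : f ∣ Nat.card ev.range := by
    apply orderOf_dvd_of_pow_eq_one
    by_contra hne
    have : ((u ^ Nat.card ev.range : (ZMod m)ˣ) : ZMod m) ≠ 1 := fun h => hne (Units.ext h)
    obtain ⟨χ, hχ⟩ := MulChar.exists_apply_ne_one_of_hasEnoughRootsOfUnity (ZMod m) ℂ this
    apply hχ
    rw [Units.val_pow_eq_pow_val, map_pow]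
    have h1 : (⟨ev χ, χ, rfl⟩ : ev.range) ^ Nat.card ev.range = 1 := pow_card_eq_one'
    have h2 := congrArg (fun x : ev.range => ((x : ℂˣ) : ℂ)) h1
    simpa [hev] using h2
  have hfin : Finite ev.range := inferInstance
  have hcr : Nat.card (rootsOfUnity f ℂ) = f := by
    exact Complex.card_rootsOfUnity f
  have hrange : ev.range = rootsOfUnity f ℂ := by
    apply Subgroup.eq_of_le_of_card_ge hle
    rw [hcr]
    exact Nat.le_of_dvd Nat.card_pos hdvd
  have hcardf : Nat.card ev.range = f := by rw [hrange, hcr]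
  have hker : Nat.card ev.ker * f = m.totient := by
    rw [← hcard, ← Nat.card_eq_fintype_card, ← hcardf, ← Subgroup.index_ker, Subgroup.card_mul_index]
  refine ⟨?_, Dvd.intro_left _ hker⟩
  have hquot : m.totient / f = Nat.card ev.ker := by
    rw [← hker, Nat.mul_div_cancel _ hfpos]
  rw [hquot]
  have e0 : ∏ χ : X, (1 - χ u * z) = ∏ χ : X, (fun w : ℂˣ => 1 - (w : ℂ) * z) (ev χ) := rfl
  change ∏ χ : X, (1 - χ u * z) = _
  rw [e0, Finset.prod_comp (fun w : ℂˣ => 1 - (w : ℂ) * z) ev]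
  have hfib : ∀ b ∈ Finset.univ.image ev, (1 - (b : ℂ) * z) ^ (Finset.univ.filter fun χ => ev χ = b).card =
      (1 - (b : ℂ) * z) ^ Nat.card ev.ker := by
    intro b hb
    obtain ⟨χ, _, rfl⟩ := Finset.mem_image.mp hb
    congr 1
    have := MonoidHom.card_fiber_eq_of_mem_range ev (x := ev χ) (y := 1) ⟨χ, rfl⟩ ⟨1, map_one _⟩
    rw [this, Nat.card_eq_fintype_card, Fintype.card_subtype]
    congr 1; ext; simp [MonoidHom.mem_ker]
  rw [Finset.prod_congr rfl hfib, Finset.prod_pow]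
  congr 1
  have hp := Complex.isPrimitiveRoot_exp f hfpos.ne'
  have h1 := hp.pow_sub_pow_eq_prod_sub_mul 1 z hfpos
  rw [one_pow] at h1
  rw [h1]
  have himg : (Finset.univ.image ev).image (fun w : ℂˣ => (w : ℂ)) = Polynomial.nthRootsFinset f (1 : ℂ) := by
    ext w
    rw [Polynomial.mem_nthRootsFinset hfpos]
    constructor
    · intro h
      obtain ⟨w', hw', rfl⟩ := Finset.mem_image.mp h
      obtain ⟨χ, _, rfl⟩ := Finset.mem_image.mp hw'
      have := hle ⟨χ, rfl⟩
      rw [mem_rootsOfUnity] at this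
      rw [← Units.val_pow_eq_pow_val, this]; rfl
    · intro h
      have hw0 : w ≠ 0 := by rintro rfl; rw [zero_pow hfpos.ne'] at h; exact zero_ne_one h
      have : Units.mk0 w hw0 ∈ ev.range := by
        rw [hrange, mem_rootsOfUnity]; ext; simpa using h
      obtain ⟨χ, hχ⟩ := this
      refine Finset.mem_image.mpr ⟨_, Finset.mem_image.mpr ⟨χ, Finset.mem_univ _, hχ⟩, rfl⟩
  rw [← himg]
  symm
  apply Finset.prod_image
  intro a _ b _ h
  exact Units.ext h
end
end OddNorm

namespace OddNorm
section
open IsDedekindDomain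

/-- if x ^ n = x for all x in a finite field then its cardinality is at most n -/
theorem card_le_of_pow_eq {k : Type*} [Field k] [Finite k] (n : ℕ) (hn : 1 < n) (h : ∀ x : k, x ^ n = x) :
    Nat.card k ≤ n := by
  classical
  have := Fintype.ofFinite k
  have hne := FiniteField.X_pow_card_sub_X_ne_zero k hn
  have hdeg := FiniteField.X_pow_card_sub_X_natDegree_eq k hn
  rw [Nat.card_eq_fintype_card, ← Finset.card_univ, ← hdeg]
  have hsub : (Finset.univ : Finset k) ⊆ (Polynomial.X ^ n - Polynomial.X : Polynomial k).roots.toFinset := by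
    intro x _
    rw [Multiset.mem_toFinset, Polynomial.mem_roots hne]
    simp [h x]
  exact (Finset.card_le_card hsub).trans ((Multiset.toFinset_card_le _).trans (Polynomial.card_roots' _))

variable {E F : Type*} [Field E] [Field F] [NumberField E] [NumberField F] [Algebra E F]

theorem absNorm_eq_pow (P : Ideal (𝓞 F)) [hP : P.IsPrime] (hP0 : P ≠ ⊥) :
    Ideal.absNorm P = Ideal.absNorm (P.under (𝓞 E)) ^ P.inertiaDeg (𝓞 E) ∧
    Ideal.relNorm (𝓞 E) P = (P.under (𝓞 E)) ^ P.inertiaDeg (𝓞 E) := by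
  have : P.IsMaximal := hP.isMaximal hP0
  have : (P.under (𝓞 E)).IsMaximal := Ideal.IsMaximal.under (𝓞 E) P
  have h := Ideal.relNorm_eq_pow_of_isMaximal P (P.under (𝓞 E))
  refine ⟨?_, h⟩
  rw [← Ideal.absNorm_relNorm (𝓞 E), h, map_pow]

theorem exists_frob [IsGalois E F] (P : Ideal (𝓞 F)) [hP : P.IsPrime] (hP0 : P ≠ ⊥) :
    ∃ σ : F ≃ₐ[E] F, (∀ x : 𝓞 F, σ • x - x ^ (Ideal.absNorm (P.under (𝓞 E))) ∈ P) ∧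
      ∀ (m : ℕ) (ζ : 𝓞 F), (m : 𝓞 F) ∉ P → ζ ^ m = 1 → σ • ζ = ζ ^ (Ideal.absNorm (P.under (𝓞 E))) := by
  have : Finite (𝓞 F ⧸ P) := Ideal.finiteQuotientOfFreeOfNeBot _ hP0
  obtain ⟨σ, hσ⟩ := IsArithFrobAt.exists_of_isInvariant (𝓞 E) (F ≃ₐ[E] F) P
  have hN : Ideal.absNorm (P.under (𝓞 E)) = Nat.card (𝓞 E ⧸ P.under (𝓞 E)) := by
    rw [Ideal.absNorm_apply, Submodule.cardQuot_apply]
  rw [hN]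
  exact ⟨σ, fun x => hσ x, fun m ζ hm hζ => hσ.apply_of_pow_eq_one hζ hm⟩

theorem frob_pow {σ : F ≃ₐ[E] F} {P : Ideal (𝓞 F)} {q : ℕ} (h : ∀ x : 𝓞 F, σ • x - x ^ q ∈ P) (k : ℕ) (x : 𝓞 F) :
    σ ^ k • x - x ^ (q ^ k) ∈ P := by
  induction k generalizing x with
  | zero => simp
  | succ k ih =>
    have h1 := ih (σ • x)
    have h2 : (σ • x) ^ (q ^ k) - (x ^ q) ^ (q ^ k) ∈ P :=
      Ideal.mem_of_dvd P (sub_dvd_pow_sub_pow _ _ _) (h x)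
    have h3 := P.add_mem h1 h2
    rw [sub_add_sub_cancel] at h3
    rwa [pow_succ, mul_smul, pow_succ', pow_mul]

theorem under_ne_bot (P : Ideal (𝓞 F)) (hP0 : P ≠ ⊥) : P.under (𝓞 E) ≠ ⊥ := by
  intro h
  exact hP0 (Ideal.eq_bot_of_comap_eq_bot h)

theorem frob_zeta_pow {σ : F ≃ₐ[E] F} {ζ : 𝓞 F} {q : ℕ} (h : σ • ζ = ζ ^ q) (k : ℕ) :
    σ ^ k • ζ = ζ ^ (q ^ k) := by
  induction k with
  | zero => simp
  | succ k ih => rw [pow_succ', mul_smul, ih, smul_pow', h, ← pow_mul, ← pow_succ']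

theorem natCast_notMem {m : ℕ} (P : Ideal (𝓞 F)) [hP : P.IsPrime] (hP0 : P ≠ ⊥) (hm : (m : 𝓞 F) ∉ P) :
    (Ideal.absNorm P).Coprime m := by
  apply coprime_absNorm
  have hmax := hP.isMaximal hP0
  apply hmax.1.2
  refine lt_of_le_of_ne le_sup_left fun h => hm ?_
  rw [h]
  exact (le_sup_right : Ideal.span {(m : 𝓞 F)} ≤ _) (Ideal.mem_span_singleton_self _)

theorem card_residue [IsGalois E F] (m : ℕ) [NeZero m] (ζ : 𝓞 F) (hζ : IsPrimitiveRoot ζ m)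
    (hgen : ∀ τ : F ≃ₐ[E] F, τ • ζ = ζ → τ = 1)
    (P : Ideal (𝓞 F)) [hP : P.IsPrime] (hP0 : P ≠ ⊥) (hm : (m : 𝓞 F) ∉ P) (u : (ZMod m)ˣ)
    (hu : (u : ZMod m) = (Ideal.absNorm (P.under (𝓞 E)) : ℕ)) :
    P.inertiaDeg (𝓞 E) = orderOf u := by
  obtain ⟨σ, hσ, hσζ⟩ := exists_frob (E := E) P hP0
  set q := Ideal.absNorm (P.under (𝓞 E)) with hq
  have hmax : P.IsMaximal := hP.isMaximal hP0
  have hpmax : (P.under (𝓞 E)).IsMaximal := Ideal.IsMaximal.under (𝓞 E) P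
  let _ := Ideal.Quotient.field P
  have : Finite (𝓞 F ⧸ P) := Ideal.finiteQuotientOfFreeOfNeBot _ hP0
  have hNP : Ideal.absNorm P = Nat.card (𝓞 F ⧸ P) := by
    rw [Ideal.absNorm_apply, Submodule.cardQuot_apply]
  have hq1 : 1 < q := by
    have h1 : q ≠ 1 := fun h => hpmax.ne_top (Ideal.absNorm_eq_one_iff.mp h)
    have h0 : q ≠ 0 := fun h => under_ne_bot (E := E) P hP0 (Ideal.absNorm_eq_zero_iff.mp h)
    omega
  obtain ⟨hpow, _⟩ := absNorm_eq_pow (E := E) P hP0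
  rw [← hq] at hpow
  set d := P.inertiaDeg (𝓞 E) with hd
  have hd0 : d ≠ 0 := by
    intro h
    rw [h, pow_zero] at hpow
    exact hmax.ne_top (Ideal.absNorm_eq_one_iff.mp hpow)
  have hfpos : 0 < orderOf u := orderOf_pos u
  apply le_antisymm
  · have h1 : σ ^ orderOf u = 1 := by
      apply hgen
      rw [frob_zeta_pow (hσζ m ζ hm hζ.pow_eq_one)]
      have : q ^ orderOf u ≡ 1 [MOD m] := by
        rw [← ZMod.natCast_eq_natCast_iff]
        push_cast
        rw [← hu, ← Units.val_pow_eq_pow_val, pow_orderOf_eq_one, Units.val_one]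
      have h2 : ζ ^ (q ^ orderOf u) = ζ ^ 1 := by
        obtain ⟨k, hk⟩ := (Nat.modEq_iff_dvd' (Nat.one_le_pow _ _ (by omega))).mp this.symm
        have hk' : q ^ orderOf u = 1 + m * k := by
          have := Nat.one_le_pow (orderOf u) q (by omega)
          omega
        rw [hk', pow_add, pow_mul, hζ.pow_eq_one, one_pow, mul_one]
      rw [h2, pow_one]
    have h2 : Nat.card (𝓞 F ⧸ P) ≤ q ^ orderOf u := by
      apply card_le_of_pow_eq _ (Nat.one_lt_pow hfpos.ne' hq1)
      intro x
      obtain ⟨x, rfl⟩ := Ideal.Quotient.mk_surjective x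
      have := frob_pow hσ (orderOf u) x
      rw [h1, one_smul] at this
      rw [← map_pow]
      exact (Ideal.Quotient.eq.mpr this).symm
    rw [← hNP, hpow] at h2
    exact (Nat.pow_le_pow_iff_right hq1).mp h2
  · apply Nat.le_of_dvd (Nat.pos_of_ne_zero hd0)
    apply orderOf_dvd_of_pow_eq_one
    have hprim := hζ.idealQuotient_mk (I := P) (fun h => hmax.ne_top (Ideal.absNorm_eq_one_iff.mp h))
      (natCast_notMem P hP0 hm)
    have hz0 : Ideal.Quotient.mk P ζ ≠ 0 := hprim.ne_zero (NeZero.ne m)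
    have := Fintype.ofFinite (𝓞 F ⧸ P)
    have h3 := FiniteField.pow_card_sub_one_eq_one _ hz0
    have h4 := hprim.dvd_of_pow_eq_one _ h3
    rw [← Nat.card_eq_fintype_card, ← hNP, hpow] at h4
    have h5 : 1 ≡ q ^ d [MOD m] := (Nat.modEq_iff_dvd' (Nat.one_le_pow _ _ (by omega))).mpr h4
    ext
    rw [Units.val_pow_eq_pow_val, hu]
    have := (ZMod.natCast_eq_natCast_iff _ _ _).mpr h5
    push_cast at this
    rw [← this, Units.val_one]

theorem finrank_le_totient [IsGalois E F] (m : ℕ) [NeZero m] (ζ : 𝓞 F) (hζ : IsPrimitiveRoot ζ m)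
    (hgen : ∀ τ : F ≃ₐ[E] F, τ • ζ = ζ → τ = 1) : Module.finrank E F ≤ m.totient := by
  rw [← IsGalois.card_aut_eq_finrank E F]
  have hζ' : IsPrimitiveRoot (ζ : F) m := hζ.map_of_injective RingOfIntegers.coe_injective
  have hinj : Function.Injective (hζ'.autToPow E) := by
    rw [injective_iff_map_eq_one]
    intro τ hτ
    apply hgen
    apply RingOfIntegers.ext
    have := hζ'.autToPow_spec E τ
    rw [hτ] at this
    change τ (ζ : F) = ζ
    rw [← this]
    rcases eq_or_ne m 1 with rfl | h1
    · have := hζ'.pow_eq_one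
      rw [pow_one] at this; rw [this, one_pow]
    · have : Fact (1 < m) := ⟨by have := NeZero.ne m; omega⟩
      rw [Units.val_one, ZMod.val_one, pow_one]
  have := Nat.card_le_card_of_injective _ hinj
  rwa [Nat.card_eq_fintype_card (α := (ZMod m)ˣ), ZMod.card_units_eq_totient] at this

theorem fiber_card [IsGalois E F] (m : ℕ) [NeZero m] (ζ : 𝓞 F) (hζ : IsPrimitiveRoot ζ m)
    (hgen : ∀ τ : F ≃ₐ[E] F, τ • ζ = ζ → τ = 1) (p : Ideal (𝓞 E)) (hp0 : p ≠ ⊥) (hpt : p ≠ ⊤) (f : ℕ)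
    (T : Finset (HeightOneSpectrum (𝓞 F))) (hT : ∀ P ∈ T, P.asIdeal.under (𝓞 E) = p ∧ 
      P.asIdeal.inertiaDeg (𝓞 E) = f) :
    T.card * f ≤ m.totient := by
  classical
  refine le_trans ?_ (finrank_le_totient m ζ hζ hgen)
  have hq1 : 1 < Ideal.absNorm p := by
    have h1 : Ideal.absNorm p ≠ 1 := fun h => hpt (Ideal.absNorm_eq_one_iff.mp h)
    have h0 : Ideal.absNorm p ≠ 0 := fun h => hp0 (Ideal.absNorm_eq_zero_iff.mp h)
    omega
  have hdvd : ∏ P ∈ T, P.asIdeal ∣ p.map (algebraMap (𝓞 E) (𝓞 F)) := by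
    rw [← Finset.prod_image (s := T) (g := fun P => P.asIdeal) (f := fun I => I)
      (by intro a _ b _ h; exact HeightOneSpectrum.ext h)]
    apply Finset.prod_primes_dvd
    · intro I hI
      obtain ⟨P, _, rfl⟩ := Finset.mem_image.mp hI
      exact P.prime
    · intro I hI
      obtain ⟨P, hP, rfl⟩ := Finset.mem_image.mp hI
      rw [Ideal.dvd_iff_le, Ideal.map_le_iff_le_comap]
      exact (hT P hP).1.ge
  have h2 := map_dvd Ideal.absNorm hdvd
  rw [map_prod] at h2
  have h3 : ∀ P ∈ T, Ideal.absNorm P.asIdeal = Ideal.absNorm p ^ f := by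
    intro P hP
    have := (absNorm_eq_pow (E := E) P.asIdeal P.ne_bot).1
    rwa [(hT P hP).1, (hT P hP).2] at this
  rw [Finset.prod_congr rfl h3, Finset.prod_const] at h2
  have h4 : Ideal.absNorm (p.map (algebraMap (𝓞 E) (𝓞 F))) = Ideal.absNorm p ^ Module.finrank E F := by
    rw [← Ideal.absNorm_relNorm (𝓞 E), Ideal.relNorm_algebraMap, map_pow]
    congr 1
    exact (Algebra.IsAlgebraic.finrank_of_isFractionRing (𝓞 E) E (𝓞 F) F).symm
  rw [h4, ← pow_mul] at h2
  rw [mul_comm]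
  exact (Nat.pow_dvd_pow_iff_le_right hq1).mp h2
end
end OddNorm

namespace OddNorm
section
open IsDedekindDomain
variable {E F : Type*} [Field E] [Field F] [NumberField E] [NumberField F] [Algebra E F]

/-- prime below -/
noncomputable def und (E : Type*) [Field E] [NumberField E] [Algebra E F] (P : HeightOneSpectrum (𝓞 F)) :
    HeightOneSpectrum (𝓞 E) :=
  ⟨P.asIdeal.under (𝓞 E), inferInstance, under_ne_bot P.asIdeal P.ne_bot⟩

theorem exists_over (p : HeightOneSpectrum (𝓞 E)) : ∃ P : HeightOneSpectrum (𝓞 F), und E P = p := by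
  have := p.isMaximal
  obtain ⟨P, hP, hPp⟩ := Ideal.exists_maximal_ideal_liesOver_of_isIntegral (S := 𝓞 F) p.asIdeal
  have h0 : P ≠ ⊥ := by
    rintro rfl
    apply p.ne_bot
    rw [hPp.over]
    exact Ideal.under_bot _ _
  exact ⟨⟨P, hP.isPrime, h0⟩, HeightOneSpectrum.ext hPp.over.symm⟩

theorem two_le_nrm_pI (p : HeightOneSpectrum (𝓞 E)) : 2 ≤ nrm (pI p) := by
  have h1 : Ideal.absNorm p.asIdeal ≠ 1 := fun h => p.isPrime.ne_top (Ideal.absNorm_eq_one_iff.mp h)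
  have h0 : Ideal.absNorm p.asIdeal ≠ 0 := fun h => p.ne_bot (Ideal.absNorm_eq_zero_iff.mp h)
  have : 2 ≤ Ideal.absNorm p.asIdeal := by omega
  change (2 : ℝ) ≤ (Ideal.absNorm p.asIdeal : ℝ)
  exact_mod_cast this

theorem mem_und (m : ℕ) (P : HeightOneSpectrum (𝓞 F)) : (m : 𝓞 E) ∈ (und E P).asIdeal ↔ (m : 𝓞 F) ∈ P.asIdeal := by
  change algebraMap (𝓞 E) (𝓞 F) m ∈ P.asIdeal ↔ _
  rw [map_natCast]

theorem rpow_range (p : HeightOneSpectrum (𝓞 E)) {s : ℝ} (hs : 1 < s) :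
    0 < nrm (pI p) ^ (-s) ∧ nrm (pI p) ^ (-s) ≤ 1 / 2 := by
  have h2 := two_le_nrm_pI p
  refine ⟨Real.rpow_pos_of_pos (by linarith) _, ?_⟩
  calc nrm (pI p) ^ (-s) ≤ nrm (pI p) ^ (-1 : ℝ) :=
        Real.rpow_le_rpow_of_exponent_le (by linarith) (by linarith)
    _ = (nrm (pI p))⁻¹ := Real.rpow_neg_one _
    _ ≤ 1 / 2 := by rw [one_div]; exact inv_anti₀ (by norm_num) h2

variable [IsGalois E F]

open Classical in
/-- norm of the Euler factor -/
noncomputable def rr (ψ : ClassGroup (𝓞 E) →* ℂˣ) (m : ℕ) [NeZero m] (s : ℝ) (p : HeightOneSpectrum (𝓞 E)) : ℝ :=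
  ‖∏ χ : DirichletCharacter ℂ m, (1 - fs (psiChi ψ χ) s (pI p))‖

theorem rr_of_mem (ψ : ClassGroup (𝓞 E) →* ℂˣ) (m : ℕ) [NeZero m] (s : ℝ) (p : HeightOneSpectrum (𝓞 E))
    (hm : (m : 𝓞 E) ∈ p.asIdeal) : rr ψ m s p = 1 := by
  have h : ∀ χ : DirichletCharacter ℂ m, fs (psiChi ψ χ) s (pI p) = 0 := by
    intro χ
    rw [fs_apply, psiChi_apply]
    have : ¬ IsUnit (((Ideal.absNorm ((pI p : (Ideal (𝓞 E))⁰) : Ideal (𝓞 E)) : ℕ)) : ZMod m) := by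
      rw [ZMod.isUnit_iff_coprime]
      intro hc
      have h1 : ((Ideal.absNorm p.asIdeal : ℕ) : 𝓞 E) ∈ p.asIdeal := Ideal.absNorm_mem _
      have h2 := (Nat.isCoprime_iff_coprime.mpr hc)
      obtain ⟨a, b, hab⟩ := h2
      apply p.isPrime.ne_top
      rw [Ideal.eq_top_iff_one]
      have h3 := congrArg (fun z : ℤ => (z : 𝓞 E)) hab
      push_cast at h3
      rw [← h3]
      exact Ideal.add_mem _ (Ideal.mul_mem_left _ _ h1) (Ideal.mul_mem_left _ _ hm)
    rw [χ.map_nonunit this]; simp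
  unfold rr
  simp [h]

theorem rr_of_notMem (m : ℕ) [NeZero m] (ζ : 𝓞 F) (hζ : IsPrimitiveRoot ζ m)
    (hgen : ∀ τ : F ≃ₐ[E] F, τ • ζ = ζ → τ = 1) (ψ : ClassGroup (𝓞 E) →* ℂˣ)
    (hψ : ∀ (P : HeightOneSpectrum (𝓞 F)) (I : (Ideal (𝓞 E))⁰),
      (I : Ideal (𝓞 E)) = Ideal.relNorm (𝓞 E) P.asIdeal → ψ (ClassGroup.mk0 I) = 1)
    {s : ℝ} (hs : 1 < s) (p : HeightOneSpectrum (𝓞 E)) (hm : (m : 𝓞 E) ∉ p.asIdeal) :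
    ∃ f : ℕ, 0 < f ∧ (∀ P : HeightOneSpectrum (𝓞 F), und E P = p → P.asIdeal.inertiaDeg (𝓞 E) = f) ∧
      rr ψ m s p = (1 - (nrm (pI p) ^ (-s)) ^ f) ^ (m.totient / f) := by
  have hcop : (Ideal.absNorm p.asIdeal).Coprime m := natCast_notMem _ p.ne_bot hm
  let u : (ZMod m)ˣ := ZMod.unitOfCoprime _ hcop
  have hu : (u : ZMod m) = ((Ideal.absNorm p.asIdeal : ℕ) : ZMod m) := ZMod.coe_unitOfCoprime _ _
  have hf : ∀ P : HeightOneSpectrum (𝓞 F), und E P = p → P.asIdeal.inertiaDeg (𝓞 E) = orderOf u := by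
    rintro P hP
    have := P.isPrime
    apply card_residue m ζ hζ hgen P.asIdeal P.ne_bot
    · rw [← mem_und (E := E), hP]; exact hm
    · rw [hu, ← hP]; rfl
  refine ⟨orderOf u, orderOf_pos u, hf, ?_⟩
  obtain ⟨P, hP⟩ := exists_over (F := F) p
  have hψp : (ψ (ClassGroup.mk0 (pI p)) : ℂ) ^ orderOf u = 1 := by
    rw [← Units.val_pow_eq_pow_val, ← map_pow, ← map_pow, hψ P, Units.val_one]
    have := P.isPrime
    rw [(absNorm_eq_pow (E := E) P.asIdeal P.ne_bot).2, hf P hP, SubmonoidClass.coe_pow, ← hP]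
    rfl
  unfold rr
  set t := nrm (pI p) ^ (-s) with ht
  have h1 : ∀ χ : DirichletCharacter ℂ m, 1 - fs (psiChi ψ χ) s (pI p) =
      1 - χ u * ((ψ (ClassGroup.mk0 (pI p)) : ℂ) * (t : ℂ)) := by
    intro χ
    rw [fs_apply, psiChi_apply, hu]
    change 1 - (ψ (ClassGroup.mk0 (pI p)) : ℂ) * χ ((Ideal.absNorm p.asIdeal : ℕ) : ZMod m) * (t : ℂ) = _
    ring
  rw [Finset.prod_congr rfl (fun χ _ => h1 χ), (prod_chi m u _).1, mul_pow, hψp, one_mul, norm_pow]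
  congr 1
  have ht2 := rpow_range p hs
  rw [← ht] at ht2
  have h3 : t ^ orderOf u ≤ 1 := pow_le_one₀ ht2.1.le (by linarith)
  have h4 : (1 : ℂ) - (t : ℂ) ^ orderOf u = ((1 - t ^ orderOf u : ℝ) : ℂ) := by push_cast; ring
  rw [h4, Complex.norm_real, Real.norm_of_nonneg (by linarith)]

theorem lower_bound (m : ℕ) [NeZero m] (ζ : 𝓞 F) (hζ : IsPrimitiveRoot ζ m)
    (hgen : ∀ τ : F ≃ₐ[E] F, τ • ζ = ζ → τ = 1) (ψ : ClassGroup (𝓞 E) →* ℂˣ)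
    (hψ : ∀ (P : HeightOneSpectrum (𝓞 F)) (I : (Ideal (𝓞 E))⁰),
      (I : Ideal (𝓞 E)) = Ideal.relNorm (𝓞 E) P.asIdeal → ψ (ClassGroup.mk0 I) = 1) :
    ∃ c0 : ℝ, 0 < c0 ∧ ∀ s : ℝ, 1 < s → c0 * (∑' I : (Ideal (𝓞 F))⁰, nrm I ^ (-s)) ≤
      ‖∏ χ : DirichletCharacter ℂ m, ∑' I, fs (psiChi ψ χ) s I‖ := by
  classical
  have hfin : {P : HeightOneSpectrum (𝓞 F) | (m : 𝓞 F) ∈ P.asIdeal}.Finite := by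
    have h := Ideal.finite_factors (R := 𝓞 F) (I := Ideal.span {(m : 𝓞 F)}) (by
      rw [Ne, Ideal.zero_eq_bot, Ideal.span_singleton_eq_bot]
      exact_mod_cast NeZero.ne m)
    refine h.subset fun P hP => ?_
    exact Ideal.dvd_span_singleton.mpr hP
  refine ⟨(1 / 2) ^ hfin.toFinset.card, by positivity, fun s hs => ?_⟩
  set A := ∏ χ : DirichletCharacter ℂ m, ∑' I, fs (psiChi ψ χ) s I with hA
  set Z := ∑' I : (Ideal (𝓞 F))⁰, nrm I ^ (-s) with hZ
  have hZ0 : 0 ≤ Z := tsum_nonneg fun I => Real.rpow_nonneg (by linarith [one_le_nrm I]) _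
  -- Euler product for A
  have t1 : Filter.Tendsto (fun S : Finset (HeightOneSpectrum (𝓞 E)) => (∏ p ∈ S, rr ψ m s p) * ‖A‖)
      Filter.atTop (nhds 1) := by
    have h1 := tendsto_finsetProd (Finset.univ : Finset (DirichletCharacter ℂ m)) (fun χ _ =>
      euler (fs (psiChi ψ χ) s) (summable_fs _ (norm_psiChi_le ψ χ) hs))
    have h2 := h1.norm
    simp only [Finset.prod_const_one, norm_one] at h2
    refine h2.congr fun S => ?_
    rw [Finset.prod_mul_distrib, norm_mul, Finset.prod_comm, norm_prod]
    rfl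
  have hr0 : ∀ p, 0 ≤ rr ψ m s p := fun p => norm_nonneg _
  have hr1 : ∀ p, rr ψ m s p ≤ 1 := by
    intro p
    by_cases hm : (m : 𝓞 E) ∈ p.asIdeal
    · exact (rr_of_mem ψ m s p hm).le
    · obtain ⟨f, hf, -, h⟩ := rr_of_notMem m ζ hζ hgen ψ hψ hs p hm
      rw [h]
      have ht2 := rpow_range p hs
      have h3 : (nrm (pI p) ^ (-s)) ^ f ≤ 1 := pow_le_one₀ ht2.1.le (by linarith)
      have h4 : 0 ≤ (nrm (pI p) ^ (-s)) ^ f := pow_nonneg ht2.1.le _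
      exact pow_le_one₀ (by linarith) (by linarith)
  have hS : ∀ S : Finset (HeightOneSpectrum (𝓞 E)), 1 ≤ (∏ p ∈ S, rr ψ m s p) * ‖A‖ := by
    intro S
    refine le_of_tendsto t1 ?_
    filter_upwards [Filter.eventually_ge_atTop S] with S' hS'
    refine mul_le_mul_of_nonneg_right ?_ (norm_nonneg _)
    rw [← Finset.prod_sdiff hS']
    refine mul_le_of_le_one_left (Finset.prod_nonneg fun p _ => hr0 p) ?_
    exact Finset.prod_le_one (fun p _ => hr0 p) (fun p _ => hr1 p)
  -- Euler product for Z
  let w : HeightOneSpectrum (𝓞 F) → ℝ := fun P => 1 - nrm (pI P) ^ (-s)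
  have hw : ∀ P, 1 / 2 ≤ w P ∧ w P ≤ 1 := fun P => by
    have := rpow_range P hs
    constructor <;> simp only [w] <;> linarith
  have t2 : Filter.Tendsto (fun T : Finset (HeightOneSpectrum (𝓞 F)) => (∏ P ∈ T, w P) * Z)
      Filter.atTop (nhds 1) := by
    have h1 := (euler (fs (1 : (Ideal (𝓞 F))⁰ →* ℂ) s) (summable_fs _ (by simp) hs))
    have h2 := (Complex.continuous_re.tendsto _).comp h1
    rw [Complex.one_re] at h2
    refine h2.congr fun T => ?_
    simp only [Function.comp, fs_apply, MonoidHom.one_apply, one_mul]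
    rw [← Complex.ofReal_tsum, ← hZ]
    have : ∏ P ∈ T, ((1 : ℂ) - ((nrm (pI P) ^ (-s) : ℝ) : ℂ)) = ((∏ P ∈ T, w P : ℝ) : ℂ) := by
      rw [Complex.ofReal_prod]
      refine Finset.prod_congr rfl fun P _ => ?_
      simp only [w]; push_cast; rfl
    rw [this, ← Complex.ofReal_mul, Complex.ofReal_re]
  -- comparison
  have hT : ∀ T : Finset (HeightOneSpectrum (𝓞 F)), (1 / 2 : ℝ) ^ hfin.toFinset.card ≤ (∏ P ∈ T, w P) * ‖A‖ := by
    intro T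
    let T1 := T.filter fun P => (m : 𝓞 F) ∈ P.asIdeal
    let T2 := T.filter fun P => (m : 𝓞 F) ∉ P.asIdeal
    have e : ∏ P ∈ T, w P = (∏ P ∈ T1, w P) * ∏ P ∈ T2, w P := (Finset.prod_filter_mul_prod_filter_not T _ _).symm
    have b1 : (1 / 2 : ℝ) ^ hfin.toFinset.card ≤ ∏ P ∈ T1, w P := by
      calc (1 / 2 : ℝ) ^ hfin.toFinset.card ≤ (1 / 2) ^ T1.card := by
            refine pow_le_pow_of_le_one (by norm_num) (by norm_num) (Finset.card_le_card ?_)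
            intro P hP
            rw [Set.Finite.mem_toFinset]
            exact (Finset.mem_filter.mp hP).2
        _ = ∏ P ∈ T1, (1 / 2) := by rw [Finset.prod_const]
        _ ≤ ∏ P ∈ T1, w P := Finset.prod_le_prod (fun _ _ => by norm_num) (fun P _ => (hw P).1)
    have b2 : ∏ p ∈ T2.image (und E), rr ψ m s p ≤ ∏ P ∈ T2, w P := by
      rw [← Finset.prod_fiberwise_of_maps_to (s := T2) (t := T2.image (und E)) (g := und E)
        (fun P hP => Finset.mem_image_of_mem _ hP)]
      refine Finset.prod_le_prod (fun p _ => hr0 p) fun p hp => ?_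
      obtain ⟨P0, hP0, rfl⟩ := Finset.mem_image.mp hp
      have hm0 : (m : 𝓞 E) ∉ (und E P0).asIdeal := by
        rw [mem_und]; exact (Finset.mem_filter.mp hP0).2
      obtain ⟨f, hf, hfP, hr⟩ := rr_of_notMem m ζ hζ hgen ψ hψ hs _ hm0
      rw [hr]
      set t := nrm (pI (und E P0)) ^ (-s) with ht
      have hwP : ∀ P ∈ T2.filter (fun P => und E P = und E P0), w P = 1 - t ^ f := by
        intro P hP
        have hPu := (Finset.mem_filter.mp hP).2
        have := P.isPrime
        have h1 := (absNorm_eq_pow (E := E) P.asIdeal P.ne_bot).1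
        rw [hfP P hPu] at h1
        have h2 : nrm (pI P) = nrm (pI (und E P0)) ^ f := by
          rw [← hPu]
          change ((Ideal.absNorm P.asIdeal : ℕ) : ℝ) = ((Ideal.absNorm (P.asIdeal.under (𝓞 E)) : ℕ) : ℝ) ^ f
          rw [h1]; push_cast; rfl
        simp only [w]
        rw [h2, ht, ← Real.rpow_natCast, ← Real.rpow_natCast, ← Real.rpow_mul, ← Real.rpow_mul, mul_comm]
        · linarith [one_le_nrm (pI (und E P0))]
        · linarith [one_le_nrm (pI (und E P0))]
      rw [Finset.prod_congr rfl hwP, Finset.prod_const]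
      have ht2 := rpow_range (und E P0) hs
      rw [← ht] at ht2
      have h3 : t ^ f ≤ 1 := pow_le_one₀ ht2.1.le (by linarith)
      have h4 : 0 ≤ t ^ f := pow_nonneg ht2.1.le _
      refine pow_le_pow_of_le_one (by linarith) (by linarith) ?_
      rw [Nat.le_div_iff_mul_le hf]
      refine fiber_card m ζ hζ hgen (und E P0).asIdeal (und E P0).ne_bot (und E P0).isPrime.ne_top f _ ?_
      intro P hP
      have hPu := (Finset.mem_filter.mp hP).2
      exact ⟨congrArg HeightOneSpectrum.asIdeal hPu, hfP P hPu⟩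
    have b3 := hS (T2.image (und E))
    have hT2 : 1 ≤ (∏ P ∈ T2, w P) * ‖A‖ := b3.trans (mul_le_mul_of_nonneg_right b2 (norm_nonneg _))
    rw [e, mul_assoc]
    calc (1 / 2 : ℝ) ^ hfin.toFinset.card ≤ (∏ P ∈ T1, w P) * 1 := by rw [mul_one]; exact b1
      _ ≤ _ := mul_le_mul_of_nonneg_left hT2 (le_trans (by positivity) b1)
  have h5 : (1 / 2 : ℝ) ^ hfin.toFinset.card * Z ≤ 1 * ‖A‖ := by
    refine ge_of_tendsto' (t2.mul_const ‖A‖) fun T => ?_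
    have := mul_le_mul_of_nonneg_right (hT T) hZ0
    linarith
  rwa [one_mul] at h5

theorem cyclo [IsTotallyComplex E] (m : ℕ) [NeZero m] (ζ : 𝓞 F) (hζ : IsPrimitiveRoot ζ m)
    (hgen : ∀ τ : F ≃ₐ[E] F, τ • ζ = ζ → τ = 1) (ψ : ClassGroup (𝓞 E) →* ℂˣ)
    (hψ : ∀ (P : HeightOneSpectrum (𝓞 F)) (I : (Ideal (𝓞 E))⁰),
      (I : Ideal (𝓞 E)) = Ideal.relNorm (𝓞 E) P.asIdeal → ψ (ClassGroup.mk0 I) = 1) :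
    ∃ χ : DirichletCharacter ℂ m, ∀ I : (Ideal (𝓞 E))⁰,
      (I : Ideal (𝓞 E)) ⊔ Ideal.span {(m : 𝓞 E)} = ⊤ → psiChi ψ χ I = 1 := by
  classical
  by_contra! hcon
  choose I0 hI0 hne using hcon
  choose C δ hδ hC using fun χ => bounded_psiChi ψ χ (I0 χ) (hI0 χ) (hne χ)
  obtain ⟨c0, hc0, hlow⟩ := lower_bound m ζ hζ hgen ψ hψ
  have hbig := (zeta_atTop (K := F)).eventually_gt_atTop ((∏ χ, C χ) / c0)
  have hsmall : ∀ᶠ s : ℝ in nhdsWithin 1 (Set.Ioi 1), ∀ χ, s < 1 + δ χ := by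
    rw [Filter.eventually_all]
    intro χ
    exact nhdsWithin_le_nhds (Iio_mem_nhds (by linarith [hδ χ]))
  obtain ⟨s, ⟨hs1, hs2⟩, hs3⟩ := ((hbig.and hsmall).and self_mem_nhdsWithin).exists
  have hs : 1 < s := hs3
  have h1 := hlow s hs
  rw [norm_prod] at h1
  have h2 : ∏ χ, ‖∑' I, fs (psiChi ψ χ) s I‖ ≤ ∏ χ, C χ :=
    Finset.prod_le_prod (fun _ _ => norm_nonneg _) (fun χ _ => hC χ s hs (hs2 χ))
  rw [div_lt_iff₀ hc0] at hs1
  linarith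
end
end OddNorm

namespace OddNorm
section
open IsDedekindDomain
variable {E F : Type*} [Field E] [Field F] [NumberField E] [NumberField F] [Algebra E F]

/-- relative norm on nonzero ideals -/
noncomputable def rn (E : Type*) {F : Type*} [Field E] [Field F] [NumberField E] [NumberField F] [Algebra E F] :
    (Ideal (𝓞 F))⁰ →* (Ideal (𝓞 E))⁰ where
  toFun I := ⟨Ideal.relNorm (𝓞 E) (I : Ideal (𝓞 F)), mem_nonZeroDivisors_of_ne_zero (by
    intro h
    exact nonZeroDivisors.coe_ne_zero I (Ideal.relNorm_eq_bot_iff.mp h))⟩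
  map_one' := Subtype.ext (map_one _)
  map_mul' I J := Subtype.ext (map_mul _ _ _)

theorem coe_rn (I : (Ideal (𝓞 F))⁰) : ((rn E I : (Ideal (𝓞 E))⁰) : Ideal (𝓞 E)) = Ideal.relNorm (𝓞 E) (I : Ideal (𝓞 F)) := rfl

theorem mk0_rn_congr {I J : (Ideal (𝓞 F))⁰} (h : ClassGroup.mk0 I = ClassGroup.mk0 J) :
    ClassGroup.mk0 (rn E I) = ClassGroup.mk0 (rn E J) := by
  obtain ⟨x, y, hx, hy, hxy⟩ := ClassGroup.mk0_eq_mk0_iff.mp h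
  refine ClassGroup.mk0_eq_mk0_iff.mpr ⟨Algebra.intNorm (𝓞 E) (𝓞 F) x, Algebra.intNorm (𝓞 E) (𝓞 F) y,
    Algebra.intNorm_ne_zero.mpr hx, Algebra.intNorm_ne_zero.mpr hy, ?_⟩
  have := congrArg (Ideal.relNorm (𝓞 E)) hxy
  rwa [map_mul, map_mul, Ideal.relNorm_singleton, Ideal.relNorm_singleton] at this

/-- norm on class groups -/
noncomputable def nCl (E : Type*) {F : Type*} [Field E] [Field F] [NumberField E] [NumberField F] [Algebra E F] :
    ClassGroup (𝓞 F) →* ClassGroup (𝓞 E) where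
  toFun c := ClassGroup.mk0 (rn E (ClassGroup.mk0_surjective c).choose)
  map_one' := by
    have h : ClassGroup.mk0 (ClassGroup.mk0_surjective (1 : ClassGroup (𝓞 F))).choose = ClassGroup.mk0 1 :=
      (Exists.choose_spec (ClassGroup.mk0_surjective (1 : ClassGroup (𝓞 F)))).trans (map_one _).symm
    exact (mk0_rn_congr (E := E) h).trans (by rw [map_one, map_one])
  map_mul' a b := by
    rw [← map_mul, ← map_mul]
    apply mk0_rn_congr
    rw [map_mul, Exists.choose_spec (ClassGroup.mk0_surjective a), Exists.choose_spec (ClassGroup.mk0_surjective b)]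
    exact Exists.choose_spec (ClassGroup.mk0_surjective (a * b))

theorem nCl_mk0 (I : (Ideal (𝓞 F))⁰) : nCl E (ClassGroup.mk0 I) = ClassGroup.mk0 (rn E I) :=
  mk0_rn_congr (Exists.choose_spec (ClassGroup.mk0_surjective (ClassGroup.mk0 I)))

theorem rn_rn {G : Type*} [Field G] [NumberField G] [Algebra F G] [Algebra E G] [IsScalarTower E F G]
    (I : (Ideal (𝓞 G))⁰) : rn E (rn F I) = rn E I :=
  Subtype.ext (Ideal.relNorm_relNorm (𝓞 E) (𝓞 F) _)

theorem nCl_nCl {G : Type*} [Field G] [NumberField G] [Algebra F G] [Algebra E G] [IsScalarTower E F G]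
    (c : ClassGroup (𝓞 G)) : nCl E (nCl F c) = nCl E c := by
  obtain ⟨I, rfl⟩ := ClassGroup.mk0_surjective c
  rw [nCl_mk0, nCl_mk0, nCl_mk0, rn_rn]

/-- degree one criterion -/
theorem deg_one (P : HeightOneSpectrum (𝓞 F)) 
    (h : ∀ x : 𝓞 F, x - x ^ (Ideal.absNorm (und E P).asIdeal) ∈ P.asIdeal) :
    rn E (pI P) = pI (und E P) ∧ Ideal.absNorm P.asIdeal = Ideal.absNorm (und E P).asIdeal := by
  have hP := P.isPrime
  have hP0 := P.ne_bot
  obtain ⟨h1, h2⟩ := absNorm_eq_pow (E := E) P.asIdeal P.ne_bot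
  set q := Ideal.absNorm (und E P).asIdeal with hq
  have hq2 : 1 < q := by
    have := two_le_nrm_pI (und E P)
    change (2 : ℝ) ≤ (q : ℝ) at this
    have : 2 ≤ q := by exact_mod_cast this
    omega
  have hmax : P.asIdeal.IsMaximal := hP.isMaximal hP0
  let _ := Ideal.Quotient.field P.asIdeal
  have : Finite (𝓞 F ⧸ P.asIdeal) := Ideal.finiteQuotientOfFreeOfNeBot _ hP0
  have hNP : Ideal.absNorm P.asIdeal = Nat.card (𝓞 F ⧸ P.asIdeal) := by
    rw [Ideal.absNorm_apply]; rfl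
  have hle : Nat.card (𝓞 F ⧸ P.asIdeal) ≤ q := by
    apply card_le_of_pow_eq q hq2
    intro x
    obtain ⟨y, rfl⟩ := Ideal.Quotient.mk_surjective x
    rw [← map_pow]
    exact (Ideal.Quotient.eq.mpr (h y)).symm
  change Ideal.absNorm P.asIdeal = q ^ _ at h1
  have hf1 : P.asIdeal.inertiaDeg (𝓞 E) = 1 := by
    have ha : P.asIdeal.inertiaDeg (𝓞 E) ≤ 1 := by
      rw [← hNP, h1] at hle
      exact (Nat.pow_le_pow_iff_right hq2).mp (by simpa using hle)
    have hb : P.asIdeal.inertiaDeg (𝓞 E) ≠ 0 := by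
      intro h0
      rw [h0, pow_zero] at h1
      exact hP.ne_top (Ideal.absNorm_eq_one_iff.mp h1)
    omega
  rw [hf1, pow_one] at h1 h2
  exact ⟨Subtype.ext h2, h1⟩

end
section
open IsDedekindDomain
variable {K N : Type*} [Field K] [Field N] [NumberField K] [NumberField N] [Algebra K N]

theorem frob_deg_one (σ : N ≃ₐ[K] N) (Q : HeightOneSpectrum (𝓞 N))
    (hσ : ∀ x : 𝓞 N, σ • x - x ^ (Ideal.absNorm (und K Q).asIdeal) ∈ Q.asIdeal)
    (M : IntermediateField K N) (hM : ∀ x ∈ M, σ x = x) :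
    rn K (pI (und M Q)) = pI (und K Q) ∧ Ideal.absNorm (und M Q).asIdeal = Ideal.absNorm (und K Q).asIdeal := by
  have hu : und K (und M Q) = und K Q := HeightOneSpectrum.ext (by
    change (Q.asIdeal.under (𝓞 M)).under (𝓞 K) = Q.asIdeal.under (𝓞 K)
    exact Ideal.under_under _)
  have := deg_one (E := K) (und M Q) (by
    intro x
    rw [hu]
    change algebraMap (𝓞 M) (𝓞 N) _ ∈ Q.asIdeal
    rw [map_sub, map_pow]
    have h := hσ (algebraMap (𝓞 M) (𝓞 N) x)
    have h2 : σ • (algebraMap (𝓞 M) (𝓞 N) x) = algebraMap (𝓞 M) (𝓞 N) x := by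
      apply RingOfIntegers.ext
      exact hM _ (x : M).2
    rwa [h2] at h)
  rwa [hu] at this

theorem key [IsGalois K N] [IsTotallyComplex K] (J : 𝓞 N ≃+* 𝓞 N)
    (hJ : ∀ (σ : N ≃ₐ[K] N) (x : 𝓞 N), σ • J x = J (σ • x))
    (Q Q' : HeightOneSpectrum (𝓞 N)) (hQ : ∀ x, J x ∈ Q'.asIdeal ↔ x ∈ Q.asIdeal)
    (hnorm : Ideal.absNorm (und K Q').asIdeal = Ideal.absNorm (und K Q).asIdeal)
    (n m : ℕ) (hn : 0 < n) (hm : Ideal.absNorm (und K Q).asIdeal ^ n = m + 1)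
    (ζ : 𝓞 N) (hζ : IsPrimitiveRoot ζ m)
    (hgen : ∀ τ : N ≃ₐ[K] N, τ ^ n • ζ = ζ → τ ^ n = 1)
    (ψ : ClassGroup (𝓞 K) →* ℂˣ) (hψ : ∀ c : ClassGroup (𝓞 N), ψ (nCl K c) = 1) :
    ψ (ClassGroup.mk0 (pI (und K Q'))) = ψ (ClassGroup.mk0 (pI (und K Q))) := by
  have hQp := Q.isPrime
  obtain ⟨σ, hσ, hσζ⟩ := exists_frob (E := K) Q.asIdeal Q.ne_bot
  change ∀ x : 𝓞 N, σ • x - x ^ (Ideal.absNorm (und K Q).asIdeal) ∈ Q.asIdeal at hσ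
  change ∀ (m : ℕ) (ζ : 𝓞 N), (m : 𝓞 N) ∉ Q.asIdeal → ζ ^ m = 1 → σ • ζ = ζ ^ (Ideal.absNorm (und K Q).asIdeal) at hσζ
  set q := Ideal.absNorm (und K Q).asIdeal with hq
  have hq2 : 1 < q := by
    have := two_le_nrm_pI (und K Q)
    change (2 : ℝ) ≤ (q : ℝ) at this
    have : 2 ≤ q := by exact_mod_cast this
    omega
  have hm0 : m ≠ 0 := by
    rintro rfl
    have := Nat.one_lt_pow hn.ne' hq2
    omega
  have : NeZero m := ⟨hm0⟩
  have hσ' : ∀ x : 𝓞 N, σ • x - x ^ (Ideal.absNorm (und K Q').asIdeal) ∈ Q'.asIdeal := by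
    intro x
    obtain ⟨y, rfl⟩ := J.surjective x
    rw [hnorm, hJ, ← map_pow, ← map_sub, hQ]
    exact hσ y
  let M : IntermediateField K N := IntermediateField.fixedField (Subgroup.zpowers σ)
  have hM : ∀ x ∈ M, σ x = x := fun x hx => hx ⟨σ, Subgroup.mem_zpowers σ⟩
  obtain ⟨a1, a2⟩ := frob_deg_one σ Q hσ M hM
  obtain ⟨b1, b2⟩ := frob_deg_one σ Q' hσ' M hM
  have hqmem : ((q : ℕ) : 𝓞 K) ∈ (und K Q).asIdeal := Ideal.absNorm_mem _
  have hmcop : ∀ R : HeightOneSpectrum (𝓞 M), Ideal.absNorm R.asIdeal = q →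
      R.asIdeal ⊔ Ideal.span {(m : 𝓞 M)} = ⊤ := by
    intro R hR
    rw [Ideal.eq_top_iff_one]
    have h1 : ((q : ℕ) : 𝓞 M) ∈ R.asIdeal := by rw [← hR]; exact Ideal.absNorm_mem _
    have h2 : (1 : 𝓞 M) = (q : 𝓞 M) ^ n - m := by
      rw [eq_sub_iff_add_eq, ← Nat.cast_pow, hm]; push_cast; ring
    rw [h2]
    exact sub_mem (Ideal.mem_sup_left (Ideal.pow_mem_of_mem _ h1 _ hn))
      (Ideal.mem_sup_right (Ideal.mem_span_singleton_self _))
  have hmQ : (m : 𝓞 N) ∉ Q.asIdeal := by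
    intro h
    apply hQp.ne_top
    rw [Ideal.eq_top_iff_one]
    have h1 : ((q : ℕ) : 𝓞 N) ∈ Q.asIdeal := (mem_und q Q).mp hqmem
    have h2 : (1 : 𝓞 N) = (q : 𝓞 N) ^ n - m := by
      rw [eq_sub_iff_add_eq, ← Nat.cast_pow, hm]; push_cast; ring
    rw [h2]
    exact sub_mem (Ideal.pow_mem_of_mem _ h1 _ hn) h
  have hz := hσζ m ζ hmQ hζ.pow_eq_one
  have hMtc : IsTotallyComplex M := isTotallyComplex_of_algebra K M
  have hgenM : ∀ τ : N ≃ₐ[M] N, τ • ζ = ζ → τ = 1 := by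
    intro τ hτ
    have hmem : (τ.restrictScalars K) ∈ Subgroup.zpowers σ := by
      have h1 : Subgroup.zpowers σ = M.fixingSubgroup := (IntermediateField.fixingSubgroup_fixedField _).symm
      rw [h1]
      intro x
      exact τ.commutes x
    obtain ⟨k, hk⟩ := (isOfFinOrder_of_finite σ).mem_powers_iff_mem_zpowers.mpr hmem
    have hk' : σ ^ k = τ.restrictScalars K := hk
    have h2 : σ ^ k • ζ = ζ := by rw [hk']; exact hτ
    have hq1 : q ^ n ≡ 1 [MOD m] := by
      rw [hm]; exact Nat.add_modEq_left
    have hσn : σ ^ n = 1 := by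
      apply hgen
      rw [frob_zeta_pow hz, hm, pow_succ, hζ.pow_eq_one, one_mul]
    have hr : σ ^ (k % n) = σ ^ k := by
      conv_rhs => rw [← Nat.mod_add_div k n, pow_add, pow_mul, hσn, one_pow, mul_one]
    rw [← hr, frob_zeta_pow hz] at h2
    have h3 : q ^ (k % n) = 1 := by
      have h4 : ζ ^ (q ^ (k % n) - 1) = 1 := by
        have h5 : ζ ^ (q ^ (k % n) - 1) * ζ = ζ := by
          rw [← pow_succ, Nat.sub_add_cancel (Nat.one_le_pow _ _ (by omega)), h2]
        have hζ0 : ζ ≠ 0 := hζ.ne_zero hm0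
        exact mul_right_cancel₀ hζ0 (by rw [h5, one_mul])
      have h6 := (hζ.pow_eq_one_iff_dvd _).mp h4
      have h7 : q ^ (k % n) < q ^ n := Nat.pow_lt_pow_right hq2 (Nat.mod_lt _ hn)
      have h8 := Nat.eq_zero_of_dvd_of_lt h6 (by
        have := Nat.one_le_pow (k % n) q (by omega)
        omega)
      have := Nat.one_le_pow (k % n) q (by omega)
      omega
    have h9 : k % n = 0 := by
      by_contra h0
      have := Nat.one_lt_pow h0 hq2
      omega
    rw [h9, pow_zero] at hr
    apply AlgEquiv.ext
    intro x
    have := DFunLike.congr_fun (hr.trans hk') x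
    exact this.symm
  obtain ⟨χ, hχ⟩ := cyclo (E := M) (F := N) m ζ hζ hgenM (ψ.comp (nCl K)) (by
    intro P I hI
    have : I = rn M (pI P) := Subtype.ext hI
    rw [this, ← nCl_mk0, MonoidHom.comp_apply, nCl_nCl]
    exact hψ _)
  have hA := hχ (pI (und M Q)) (hmcop _ a2)
  have hB := hχ (pI (und M Q')) (hmcop _ (b2.trans hnorm))
  rw [psiChi_apply, MonoidHom.comp_apply, nCl_mk0] at hA hB
  rw [a1] at hA
  rw [b1] at hB
  change _ * χ ((Ideal.absNorm (und M Q).asIdeal : ℕ) : ZMod m) = 1 at hA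
  change _ * χ ((Ideal.absNorm (und M Q').asIdeal : ℕ) : ZMod m) = 1 at hB
  rw [a2] at hA
  rw [b2, hnorm] at hB
  have hne : χ ((q : ℕ) : ZMod m) ≠ 0 := right_ne_zero_of_mul_eq_one hA
  exact Units.ext (mul_right_cancel₀ hne (hB.trans hA.symm))

end
end OddNorm

namespace OddNorm
section
open IsDedekindDomain
variable {K N : Type*} [Field K] [Field N] [NumberField K] [NumberField N] [Algebra K N]

theorem absNorm_map_equiv (e : 𝓞 K ≃+* 𝓞 K) (I : Ideal (𝓞 K)) : Ideal.absNorm (I.map e) = Ideal.absNorm I := by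
  rw [Ideal.absNorm_apply, Ideal.absNorm_apply]
  exact Nat.card_congr (Ideal.quotientEquiv I (I.map e) e rfl).symm.toEquiv

/-- action of an automorphism on nonzero ideals -/
noncomputable def cj (j : K ≃+* K) : (Ideal (𝓞 K))⁰ →* (Ideal (𝓞 K))⁰ where
  toFun I := ⟨(I : Ideal (𝓞 K)).map (RingOfIntegers.mapRingEquiv j), mem_nonZeroDivisors_of_ne_zero (by
    intro h
    have := absNorm_map_equiv (RingOfIntegers.mapRingEquiv j) (I : Ideal (𝓞 K))
    rw [h] at this
    rw [Ideal.zero_eq_bot, Ideal.absNorm_bot] at this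
    exact nonZeroDivisors.coe_ne_zero I (Ideal.absNorm_eq_zero_iff.mp this.symm))⟩
  map_one' := Subtype.ext (by simp [Ideal.one_eq_top, Ideal.map_top])
  map_mul' I J := Subtype.ext (Ideal.map_mul _ _ _)

theorem coe_cj (j : K ≃+* K) (I : (Ideal (𝓞 K))⁰) :
    ((cj j I : (Ideal (𝓞 K))⁰) : Ideal (𝓞 K)) = (I : Ideal (𝓞 K)).map (RingOfIntegers.mapRingEquiv j) := rfl

theorem mem_cj (j : K ≃+* K) (I : (Ideal (𝓞 K))⁰) (x : 𝓞 K) :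
    RingOfIntegers.mapRingEquiv j x ∈ ((cj j I : (Ideal (𝓞 K))⁰) : Ideal (𝓞 K)) ↔ x ∈ (I : Ideal (𝓞 K)) := by
  rw [coe_cj]
  constructor
  · intro h
    obtain ⟨y, hy, hxy⟩ := (Ideal.mem_map_of_equiv (RingOfIntegers.mapRingEquiv j) _).mp h
    rwa [← (RingOfIntegers.mapRingEquiv j).injective hxy]
  · exact fun h => Ideal.mem_map_of_mem _ h

/-- action on primes -/
noncomputable def cjP (j : K ≃+* K) (p : HeightOneSpectrum (𝓞 K)) : HeightOneSpectrum (𝓞 K) :=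
  ⟨(cj j (pI p) : (Ideal (𝓞 K))⁰), by
    rw [coe_cj]
    have : (pI p : Ideal (𝓞 K)).IsPrime := p.isPrime
    exact Ideal.map_isPrime_of_equiv _, nonZeroDivisors.coe_ne_zero _⟩

theorem pI_cjP (j : K ≃+* K) (p : HeightOneSpectrum (𝓞 K)) : pI (cjP j p) = cj j (pI p) := rfl

theorem key2 [IsGalois K N] [IsTotallyComplex K] (j : K ≃+* K) (J : N ≃+* N)
    (hjJ : ∀ x, J (algebraMap K N x) = algebraMap K N (j x))
    (hJ : ∀ (σ : N ≃ₐ[K] N) (x : N), σ (J x) = J (σ x))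
    (p : HeightOneSpectrum (𝓞 K))
    (n m : ℕ) (hn : 0 < n) (hm : Ideal.absNorm p.asIdeal ^ n = m + 1)
    (ζ : N) (hζ : IsPrimitiveRoot ζ m)
    (hgen : ∀ τ : N ≃ₐ[K] N, (τ ^ n) ζ = ζ → τ ^ n = 1)
    (ψ : ClassGroup (𝓞 K) →* ℂˣ) (hψ : ∀ c : ClassGroup (𝓞 N), ψ (nCl K c) = 1) :
    ψ (ClassGroup.mk0 (cj j (pI p))) = ψ (ClassGroup.mk0 (pI p)) := by
  obtain ⟨Q, hQ⟩ := exists_over (F := N) p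
  have hu : und K (cjP J Q) = cjP j p := by
    apply HeightOneSpectrum.ext
    ext x
    obtain ⟨y, rfl⟩ := (RingOfIntegers.mapRingEquiv j).surjective x
    change algebraMap (𝓞 K) (𝓞 N) _ ∈ ((cj J (pI Q) : (Ideal (𝓞 N))⁰) : Ideal (𝓞 N)) ↔
      _ ∈ ((cj j (pI p) : (Ideal (𝓞 K))⁰) : Ideal (𝓞 K))
    have h1 : algebraMap (𝓞 K) (𝓞 N) (RingOfIntegers.mapRingEquiv j y) =
        RingOfIntegers.mapRingEquiv J (algebraMap (𝓞 K) (𝓞 N) y) := by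
      apply RingOfIntegers.ext
      exact (hjJ _).symm
    rw [h1, mem_cj, mem_cj, ← hQ]
    rfl
  have hm0 : m ≠ 0 := by
    rintro rfl
    have h2 := two_le_nrm_pI p
    change (2 : ℝ) ≤ (Ideal.absNorm p.asIdeal : ℝ) at h2
    have h2 : 2 ≤ Ideal.absNorm p.asIdeal := by exact_mod_cast h2
    have := Nat.one_lt_pow hn.ne' h2
    omega
  have hnint : IsIntegral ℤ ζ := hζ.isIntegral (Nat.pos_of_ne_zero hm0)
  have := key (K := K) (RingOfIntegers.mapRingEquiv J) (fun σ x => RingOfIntegers.ext (hJ σ x)) Q (cjP J Q)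
    (fun x => mem_cj J (pI Q) x) (by
      rw [hu, hQ]
      exact absNorm_map_equiv _ _) n m hn (by rw [hQ, hm]) ⟨ζ, hnint⟩
    (by
      apply IsPrimitiveRoot.of_map_of_injective (f := algebraMap (𝓞 N) N)
      · exact hζ
      · exact RingOfIntegers.coe_injective)
    (fun τ h => hgen τ (congrArg (algebraMap (𝓞 N) N) h)) ψ hψ
  rw [hu, hQ] at this
  exact this

theorem cj_ind (j : K ≃+* K) (ψ : ClassGroup (𝓞 K) →* ℂˣ)
    (h : ∀ p : HeightOneSpectrum (𝓞 K), ψ (ClassGroup.mk0 (cj j (pI p))) = ψ (ClassGroup.mk0 (pI p)))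
    (I : (Ideal (𝓞 K))⁰) : ψ (ClassGroup.mk0 (cj j I)) = ψ (ClassGroup.mk0 I) := by
  obtain ⟨I, hI⟩ := I
  induction I using UniqueFactorizationMonoid.induction_on_prime with
  | h₁ => exact absurd rfl (nonZeroDivisors.ne_zero hI)
  | h₂ x hx =>
    have : (⟨x, hI⟩ : (Ideal (𝓞 K))⁰) = 1 := Subtype.ext ((Ideal.isUnit_iff.mp hx).trans Ideal.one_eq_top.symm)
    rw [this, map_one]
  | h₃ a p ha hp ih =>
    have ha' : a ∈ (Ideal (𝓞 K))⁰ := mem_nonZeroDivisors_of_ne_zero ha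
    let P : HeightOneSpectrum (𝓞 K) := ⟨p, Ideal.isPrime_of_prime hp, hp.ne_zero⟩
    have : (⟨p * a, hI⟩ : (Ideal (𝓞 K))⁰) = pI P * ⟨a, ha'⟩ := rfl
    rw [this, map_mul, map_mul, map_mul, map_mul, map_mul, h, ih]

end
end OddNorm

namespace OddNorm
section
open IsDedekindDomain ComplexConjugate

theorem exists_eqLocus {M : Type*} [Field M] (N : IntermediateField ℚ ℂ) (f g : N →+* M) :
    ∃ T : IntermediateField ℚ ℂ, ∀ x : ℂ, x ∈ T ↔ ∃ h : x ∈ N, f ⟨x, h⟩ = g ⟨x, h⟩ := by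
  let S : IntermediateField ℚ N := (RingHom.eqLocusField f g).toIntermediateField (fun q => by
    change f _ = g _
    simp)
  refine ⟨IntermediateField.lift S, fun x => ?_⟩
  constructor
  · intro hx
    have hxN : x ∈ N := IntermediateField.lift_le S hx
    refine ⟨hxN, ?_⟩
    have := (IntermediateField.mem_lift (E := S) ⟨x, hxN⟩).mp hx
    exact this
  · rintro ⟨h, hx⟩
    exact (IntermediateField.mem_lift (E := S) ⟨x, h⟩).mpr hx

theorem key3 (K L : IntermediateField ℚ ℂ) [NumberField K] [NumberField L] [Algebra K L]
    (hKL : ∀ x : K, ((algebraMap K L x : L) : ℂ) = x) [IsTotallyComplex K]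
    (jK : K ≃+* K) (hjK : ∀ x : K, ((jK x : K) : ℂ) = conj (x : ℂ))
    (jL : L ≃+* L) (hjL : ∀ (φ : L →+* ℂ) (x : L), φ (jL x) = conj (φ x))
    (ψ : ClassGroup (𝓞 K) →* ℂˣ) (hψ : ∀ c : ClassGroup (𝓞 L), ψ (nCl K c) = 1)
    (p : HeightOneSpectrum (𝓞 K)) :
    ψ (ClassGroup.mk0 (cj jK (pI p))) = ψ (ClassGroup.mk0 (pI p)) := by
  have hLfin : FiniteDimensional ℚ L := inferInstance
  have hsplit : ∀ x : L, ((minpoly ℚ x).map (algebraMap ℚ ℂ)).Splits := fun x => IsAlgClosed.splits _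
  let L' : IntermediateField ℚ ℂ := normalClosure ℚ L ℂ
  have hL'n : Normal ℚ L' := (Algebra.IsAlgebraic.isNormalClosure_normalClosure hsplit).normal
  have hL'f : FiniteDimensional ℚ L' := inferInstanceAs (FiniteDimensional ℚ (normalClosure ℚ L ℂ))
  let n := Nat.card (L' ≃ₐ[ℚ] L')
  have hn : 0 < n := Nat.card_pos
  have hq2 : 2 ≤ Ideal.absNorm p.asIdeal := by
    have h2 := two_le_nrm_pI p
    change (2 : ℝ) ≤ (Ideal.absNorm p.asIdeal : ℝ) at h2
    exact_mod_cast h2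
  have hqn : 1 < Ideal.absNorm p.asIdeal ^ n := Nat.one_lt_pow hn.ne' hq2
  obtain ⟨m, hm⟩ : ∃ m, Ideal.absNorm p.asIdeal ^ n = m + 1 := ⟨_, (Nat.sub_add_cancel hqn.le).symm⟩
  have hm0 : m ≠ 0 := by rintro rfl; omega
  have : NeZero m := ⟨hm0⟩
  obtain ⟨z, hz⟩ : ∃ z : ℂ, IsPrimitiveRoot z m := ⟨_, Complex.isPrimitiveRoot_exp m hm0⟩
  let Z : IntermediateField ℚ ℂ := ℚ⟮z⟯
  have hZc : IsCyclotomicExtension {m} ℚ Z :=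
    (IntermediateField.isCyclotomicExtension_singleton_iff_eq_adjoin m ℚ ℂ Z hz).mpr rfl
  have hZf : FiniteDimensional ℚ Z := IsCyclotomicExtension.finiteDimensional {m} ℚ Z
  have hZg : IsGalois ℚ Z := IsCyclotomicExtension.isGalois {m} ℚ Z
  have hZn : Normal ℚ Z := inferInstance
  let N : IntermediateField ℚ ℂ := L' ⊔ Z
  have hNf : FiniteDimensional ℚ N := IntermediateField.finiteDimensional_sup L' Z
  have hNn : Normal ℚ N := @IntermediateField.normal_sup ℚ ℂ _ _ _ L' Z hL'n hZn
  have hNnf : NumberField N := NumberField.of_module_finite ℚ N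
  have hL'N : L' ≤ N := le_sup_left
  have hZN : Z ≤ N := le_sup_right
  have hLL' : L ≤ L' := by
    have := AlgHom.fieldRange_le_normalClosure (L.val)
    rwa [IntermediateField.fieldRange_val] at this
  have hLN : L ≤ N := hLL'.trans hL'N
  have hKL' : K ≤ L := fun x hx => by
    have := (algebraMap K L ⟨x, hx⟩ : L).2
    rwa [hKL] at this
  let aLN : Algebra L N := (IntermediateField.inclusion hLN).toRingHom.toAlgebra
  let aKN : Algebra K N := (IntermediateField.inclusion (hKL'.trans hLN)).toRingHom.toAlgebra
  let aL'N : Algebra L' N := (IntermediateField.inclusion hL'N).toRingHom.toAlgebra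
  have t1 : IsScalarTower K L N := IsScalarTower.of_algebraMap_eq (fun x => Subtype.ext (hKL x).symm)
  have t2 : IsScalarTower ℚ K N := IsScalarTower.of_algebraMap_eq (fun x => by
    apply Subtype.ext
    rfl)
  have t3 : IsScalarTower ℚ L' N := IsScalarTower.of_algebraMap_eq (fun x => by
    apply Subtype.ext
    rfl)
  have hNG : IsGalois ℚ N := IsGalois.mk
  have hKNG : IsGalois K N := IsGalois.tower_top_of_isGalois ℚ K N
  let J : N ≃ₐ[ℚ] N := (Complex.conjAe.restrictScalars ℚ).restrictNormal N
  have hJc : ∀ x : N, ((J x : N) : ℂ) = conj (x : ℂ) := fun x =>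
    AlgEquiv.restrictNormal_commutes (Complex.conjAe.restrictScalars ℚ) N x
  have hzN : z ∈ N := hZN (mem_adjoin_simple_self ℚ z)
  have hconjz : ∀ w : N, w ^ m = 1 → J w = w⁻¹ := by
    intro w hw
    apply Subtype.ext
    have hw' : (w : ℂ) ^ m = 1 := congrArg (fun t : N => (t : ℂ)) hw
    have hn1 : ‖(w : ℂ)‖ = 1 := Complex.norm_eq_one_of_pow_eq_one hw' hm0
    rw [hJc, ← Complex.inv_eq_conj hn1]
    rfl
  have hzm : (⟨z, hzN⟩ : N) ^ m = 1 := Subtype.ext hz.pow_eq_one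
  refine key2 (N := N) jK J.toRingEquiv ?_ ?_ p n m hn hm ⟨z, hzN⟩ ?_ ?_ ψ ?_
  · intro x
    apply Subtype.ext
    change ((J (algebraMap K N x) : N) : ℂ) = _
    rw [hJc]
    exact (hjK x).symm
  · intro σ
    obtain ⟨T, hT⟩ := exists_eqLocus N ((σ : N →+* N).comp (J : N →+* N)) ((J : N →+* N).comp (σ : N →+* N))
    have hNT : N ≤ T := by
      refine sup_le (iSup_le fun f => ?_) (adjoin_simple_le_iff.mpr ?_)
      · rintro _ ⟨l, rfl⟩
        have hmem : ∀ l : L, f l ∈ N := fun l => hL'N (AlgHom.fieldRange_le_normalClosure f ⟨l, rfl⟩)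
        refine (hT _).mpr ⟨hmem l, ?_⟩
        let f' : L →+* N := (f : L →+* ℂ).codRestrict N hmem
        have h1 : J (f' l) = f' (jL l) := by
          apply Subtype.ext
          rw [hJc]
          exact (hjL (f : L →+* ℂ) l).symm
        change σ (J (f' l)) = J (σ (f' l))
        rw [h1]
        apply Subtype.ext
        rw [hJc]
        exact hjL ((N.val : N →+* ℂ).comp ((σ : N →+* N).comp f')) l
      · refine (hT _).mpr ⟨hzN, ?_⟩
        change σ (J ⟨z, hzN⟩) = J (σ ⟨z, hzN⟩)
        rw [hconjz _ hzm, hconjz _ (by rw [← map_pow, hzm, map_one]), map_inv₀]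
    intro x
    obtain ⟨_, h⟩ := (hT x).mp (hNT x.2)
    exact h
  · exact IsPrimitiveRoot.of_map_of_injective (f := N.val) hz Subtype.val_injective
  · intro τ hτ
    obtain ⟨T, hT⟩ := exists_eqLocus N ((τ ^ n : N ≃ₐ[K] N) : N →+* N) (RingHom.id N)
    have hNT : N ≤ T := by
      refine sup_le ?_ (adjoin_simple_le_iff.mpr ?_)
      · intro x hx
        refine (hT _).mpr ⟨hL'N hx, ?_⟩
        have h1 : (AlgEquiv.restrictNormalHom (F := ℚ) (K₁ := N) L') ((τ.restrictScalars ℚ) ^ n) = 1 := by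
          rw [map_pow]
          exact pow_card_eq_one'
        have h2 := AlgEquiv.restrictNormal_commutes ((τ.restrictScalars ℚ) ^ n) L' ⟨x, hx⟩
        have h3 : ((τ.restrictScalars ℚ) ^ n).restrictNormal L' = 1 := h1
        rw [h3] at h2
        have h4 : ∀ (k : ℕ) (y : N), ((τ.restrictScalars ℚ) ^ k) y = (τ ^ k) y := by
          intro k
          induction k with
          | zero => intro y; rfl
          | succ k ih => intro y; rw [pow_succ, pow_succ, AlgEquiv.mul_apply, AlgEquiv.mul_apply, ih]; rfl
        rw [h4] at h2
        exact h2.symm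
      · exact (hT _).mpr ⟨hzN, hτ⟩
    apply AlgEquiv.ext
    intro x
    obtain ⟨_, h⟩ := (hT x).mp (hNT x.2)
    exact h
  · intro c
    rw [← nCl_nCl (F := L)]
    exact hψ _

end
end OddNorm

namespace OddNorm
section
open IsDedekindDomain ComplexConjugate
variable {E F : Type*} [Field E] [Field F] [NumberField E] [NumberField F] [Algebra E F]

theorem coe_intNorm (x : 𝓞 F) : ((Algebra.intNorm (𝓞 E) (𝓞 F) x : 𝓞 E) : E) = Algebra.norm E (x : F) :=
  Algebra.algebraMap_intNorm (A := 𝓞 E) (K := E) (L := F) (B := 𝓞 F) x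

theorem rn_cj (jE : E ≃+* E) (jF : F ≃+* F) (h : ∀ x, jF (algebraMap E F x) = algebraMap E F (jE x))
    (I : (Ideal (𝓞 F))⁰) : rn E (cj jF I) = cj jE (rn E I) := by
  have hnint : ∀ x : 𝓞 F, Algebra.intNorm (𝓞 E) (𝓞 F) (RingOfIntegers.mapRingEquiv jF x) =
      RingOfIntegers.mapRingEquiv jE (Algebra.intNorm (𝓞 E) (𝓞 F) x) := by
    intro x
    apply RingOfIntegers.ext
    rw [RingOfIntegers.mapRingEquiv_apply, coe_intNorm, coe_intNorm, RingOfIntegers.mapRingEquiv_apply]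
    have := Algebra.norm_eq_of_equiv_equiv jE jF (RingHom.ext fun y => (h y).symm) (x : F)
    rw [this, RingEquiv.apply_symm_apply]
  apply Subtype.ext
  rw [coe_rn, coe_cj, coe_cj, coe_rn]
  have h2 : Ideal.map (RingOfIntegers.mapRingEquiv jE) (Ideal.relNorm (𝓞 E) (I : Ideal (𝓞 F))) = _ :=
    Ideal.map_relNorm (𝓞 E) (I : Ideal (𝓞 F)) (RingOfIntegers.mapRingEquiv jE : 𝓞 E →+* 𝓞 E)
  rw [h2]
  change Ideal.span _ = _
  apply congrArg
  ext y
  constructor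
  · rintro ⟨x, hx, rfl⟩
    obtain ⟨x', hx', rfl⟩ := (Ideal.mem_map_of_equiv (RingOfIntegers.mapRingEquiv jF) _).mp hx
    exact ⟨x', hx', (hnint x').symm⟩
  · rintro ⟨x, hx, rfl⟩
    exact ⟨RingOfIntegers.mapRingEquiv jF x, Ideal.mem_map_of_mem _ hx, hnint x⟩

theorem cj_refl (I : (Ideal (𝓞 F))⁰) : cj (RingEquiv.refl F) I = I := by
  apply Subtype.ext
  ext x
  exact mem_cj (RingEquiv.refl F) I x

theorem norm_quad (h2 : Module.finrank E F = 2) (j : F ≃ₐ[E] F) (hj : j ≠ 1) (x : F) :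
    algebraMap E F (Algebra.norm E x) = x * j x := by
  classical
  have : Algebra.IsQuadraticExtension E F := ⟨h2⟩
  rw [Algebra.norm_eq_prod_automorphisms]
  have hcard : Fintype.card (F ≃ₐ[E] F) = 2 := by
    rw [← Nat.card_eq_fintype_card, IsGalois.card_aut_eq_finrank, h2]
  have hu : (Finset.univ : Finset (F ≃ₐ[E] F)) = {1, j} := by
    symm
    apply Finset.eq_univ_of_card
    rw [hcard, Finset.card_pair hj.symm]
  rw [hu, Finset.prod_pair hj.symm]
  rfl

theorem mul_cj (h2 : Module.finrank E F = 2) (j : F ≃ₐ[E] F) (hj : j ≠ 1) (I : (Ideal (𝓞 F))⁰) :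
    ((I * cj j.toRingEquiv I : (Ideal (𝓞 F))⁰) : Ideal (𝓞 F)) =
      Ideal.map (algebraMap (𝓞 E) (𝓞 F)) (Ideal.relNorm (𝓞 E) (I : Ideal (𝓞 F))) := by
  have hle : Ideal.map (algebraMap (𝓞 E) (𝓞 F)) (Ideal.relNorm (𝓞 E) (I : Ideal (𝓞 F))) ≤
      ((I * cj j.toRingEquiv I : (Ideal (𝓞 F))⁰) : Ideal (𝓞 F)) := by
    rw [Ideal.map_relNorm, Ideal.span_le]
    rintro _ ⟨x, hx, rfl⟩
    have : algebraMap (𝓞 E) (𝓞 F) (Algebra.intNorm (𝓞 E) (𝓞 F) x) =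
        x * RingOfIntegers.mapRingEquiv j.toRingEquiv x := by
      apply RingOfIntegers.ext
      have h := norm_quad h2 j hj (x : F)
      rw [← coe_intNorm] at h
      exact h
    change algebraMap (𝓞 E) (𝓞 F) (Algebra.intNorm (𝓞 E) (𝓞 F) x) ∈ _
    rw [this, Submonoid.coe_mul]
    exact Ideal.mul_mem_mul hx ((mem_cj _ _ _).mpr hx)
  obtain ⟨C, hC⟩ := Ideal.dvd_iff_le.mpr hle
  have hfr : Module.finrank (𝓞 E) (𝓞 F) = 2 := by
    rw [← h2]
    exact (IsFractionRing.finrank_eq (𝓞 E) E (𝓞 F) F).symm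
  have hn := congrArg Ideal.absNorm hC
  rw [Ideal.absNorm_algebraMap, hfr, Ideal.absNorm_relNorm, map_mul, Submonoid.coe_mul, map_mul, coe_cj,
    absNorm_map_equiv, ← pow_two] at hn
  have h0 : Ideal.absNorm (I : Ideal (𝓞 F)) ≠ 0 := fun h =>
    nonZeroDivisors.coe_ne_zero I (Ideal.absNorm_eq_zero_iff.mp h)
  have hC1 : Ideal.absNorm C = 1 := by
    have h1 : Ideal.absNorm (I : Ideal (𝓞 F)) ^ 2 * Ideal.absNorm C =
      Ideal.absNorm (I : Ideal (𝓞 F)) ^ 2 * 1 := by rw [mul_one]; exact hn.symm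
    exact Nat.eq_of_mul_eq_mul_left (Nat.pos_of_ne_zero (pow_ne_zero 2 h0)) h1
  rw [hC, Ideal.absNorm_eq_one_iff.mp hC1, Ideal.mul_top]

theorem mk0_cj (h2 : Module.finrank E F = 2) (j : F ≃ₐ[E] F) (hj : j ≠ 1) (I : (Ideal (𝓞 F))⁰)
    (hI : (Ideal.relNorm (𝓞 E) (I : Ideal (𝓞 F))).IsPrincipal) :
    ClassGroup.mk0 I * ClassGroup.mk0 (cj j.toRingEquiv I) = 1 := by
  rw [← map_mul]
  apply (ClassGroup.mk0_eq_one_iff (I * cj j.toRingEquiv I).2).mpr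
  rw [mul_cj h2 j hj I]
  exact Submodule.IsPrincipal.map_ringHom _ hI

end

section
open ComplexConjugate
theorem exists_conj (F K : IntermediateField ℚ ℂ) [NumberField F] [NumberField K] [Algebra F K]
    (hFK : ∀ x : F, ((algebraMap F K x : K) : ℂ) = x) (hK : TotallyImaginary K) (hF : TotallyReal F)
    (h2 : Module.finrank F K = 2) :
    IsTotallyComplex K ∧ ∃ j : K ≃ₐ[F] K, j ≠ 1 ∧ ∀ (φ : K →+* ℂ) (x : K), φ (j x) = conj (φ x) := by
  have h1 : IsTotallyComplex K := ⟨fun v => by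
    rw [InfinitePlace.isComplex_iff]
    intro h
    obtain ⟨x, hx⟩ := hK v.embedding
    apply hx
    have := RingHom.congr_fun (ComplexEmbedding.isReal_iff.mp h) x
    exact Complex.conj_eq_iff_im.mp this⟩
  have h3 : IsTotallyReal F := ⟨fun v => by
    rw [InfinitePlace.isReal_iff, ComplexEmbedding.isReal_iff]
    ext x
    exact Complex.conj_eq_iff_im.mpr (hF v.embedding x)⟩
  have h4 : Algebra.IsQuadraticExtension F K := ⟨h2⟩
  have h5 : IsCMField K := IsCMField.ofCMExtension F K
  refine ⟨h1, ?_⟩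
  have hc := IsCMField.complexEmbedding_complexConj K
  let j : K ≃ₐ[F] K := AlgEquiv.ofRingEquiv (f := (IsCMField.complexConj K).toRingEquiv) (fun x => by
    apply Subtype.ext
    have := hc (K.val : K →+* ℂ) (algebraMap F K x)
    change (((IsCMField.complexConj K) (algebraMap F K x) : K) : ℂ) = conj ((algebraMap F K x : K) : ℂ) at this
    change (((IsCMField.complexConj K) (algebraMap F K x) : K) : ℂ) = _
    rw [this, hFK]
    exact Complex.conj_eq_iff_im.mpr (hF (F.val : F →+* ℂ) x))
  refine ⟨j, ?_, fun φ x => hc φ x⟩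
  intro hj
  obtain ⟨x, hx⟩ := hK (K.val : K →+* ℂ)
  apply hx
  have := hc (K.val : K →+* ℂ) x
  change _ = conj _ at this
  have h6 : IsCMField.complexConj K x = x := AlgEquiv.congr_fun hj x
  rw [h6] at this
  exact Complex.conj_eq_iff_im.mp this.symm

theorem idealNorm_eq (F L : IntermediateField ℚ ℂ) [FiniteDimensional ℚ F] [FiniteDimensional ℚ L]
    (h : F ≤ L) (I : Ideal (𝓞 L)) :
    letI : Algebra F L := (IntermediateField.inclusion h).toRingHom.toAlgebra
    idealNorm F L h I = Ideal.relNorm (𝓞 F) I := by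
  let _ : Algebra F L := (IntermediateField.inclusion h).toRingHom.toAlgebra
  unfold idealNorm
  change _ = Ideal.span _
  apply congrArg
  ext y
  constructor
  · rintro ⟨x, hx, hy⟩
    exact ⟨x, hx, RingOfIntegers.ext ((coe_intNorm x).trans hy.symm)⟩
  · rintro ⟨x, hx, rfl⟩
    exact ⟨x, hx, coe_intNorm x⟩

end
end OddNorm

theorem stmt_8 (K L Kp Lp : IntermediateField ℚ ℂ)
    [FiniteDimensional ℚ K] [FiniteDimensional ℚ L]
    [FiniteDimensional ℚ Kp] [FiniteDimensional ℚ Lp]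
    (hKL : K ≤ L) (hKpK : Kp ≤ K) (hLpL : Lp ≤ L) (hKpLp : Kp ≤ Lp)
    (hKim : TotallyImaginary K) (hLim : TotallyImaginary L)
    (hKp : TotallyReal Kp) (hLp : TotallyReal Lp)
    (hKquad : letI : Algebra Kp K := (IntermediateField.inclusion hKpK).toRingHom.toAlgebra
      Module.finrank Kp K = 2)
    (hLquad : letI : Algebra Lp L := (IntermediateField.inclusion hLpL).toRingHom.toAlgebra
      Module.finrank Lp L = 2)
    (c : ClassGroup (𝓞 K)) (hodd : Odd (orderOf c))
    (hker : ∀ I : (Ideal (𝓞 K))⁰, ClassGroup.mk0 I = c →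
      (idealNorm Kp K hKpK I).IsPrincipal) :
    ∃ c' : ClassGroup (𝓞 L), Odd (orderOf c') ∧
      ∃ I' : (Ideal (𝓞 L))⁰, ClassGroup.mk0 I' = c' ∧
        (idealNorm Lp L hLpL I').IsPrincipal ∧
        ∃ J : (Ideal (𝓞 K))⁰, (J : Ideal (𝓞 K)) = idealNorm K L hKL I' ∧
          ClassGroup.mk0 J = c := by
  let aK : Algebra Kp K := (IntermediateField.inclusion hKpK).toRingHom.toAlgebra
  let aL : Algebra Lp L := (IntermediateField.inclusion hLpL).toRingHom.toAlgebra
  let aKL : Algebra K L := (IntermediateField.inclusion hKL).toRingHom.toAlgebra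
  have hcKL : ∀ x : K, ((algebraMap K L x : L) : ℂ) = x := fun x => rfl
  obtain ⟨hKtc, jK, hjK1, hjK⟩ := OddNorm.exists_conj Kp K (fun x => rfl) hKim hKp hKquad
  obtain ⟨hLtc, jL, hjL1, hjL⟩ := OddNorm.exists_conj Lp L (fun x => rfl) hLim hLp hLquad
  have hjK' : ∀ x : K, ((jK x : K) : ℂ) = (starRingEnd ℂ) (x : ℂ) := fun x => hjK (K.val : K →+* ℂ) x
  have hjL' : ∀ x : L, ((jL x : L) : ℂ) = (starRingEnd ℂ) (x : ℂ) := fun x => hjL (L.val : L →+* ℂ) x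
  -- the class of the conjugate is the inverse
  have hinv : ∀ I : (Ideal (𝓞 K))⁰, ClassGroup.mk0 I = c →
      c * ClassGroup.mk0 (OddNorm.cj jK.toRingEquiv I) = 1 := by
    intro I hI
    have h := hker I hI
    rw [OddNorm.idealNorm_eq] at h
    have := OddNorm.mk0_cj hKquad jK hjK1 I h
    rwa [hI] at this
  -- c is a norm
  have hmem : c ∈ (OddNorm.nCl K (F := L)).range := by
    rw [← CommGroup.forall_monoidHom_apply_eq_one_iff ℂ]
    intro ψ hψ
    obtain ⟨I, hI⟩ := ClassGroup.mk0_surjective c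
    have h1 : ∀ x : ClassGroup (𝓞 L), ψ (OddNorm.nCl K x) = 1 := fun x => hψ _ ⟨x, rfl⟩
    have h2 := OddNorm.cj_ind jK.toRingEquiv ψ
      (OddNorm.key3 K L hcKL jK.toRingEquiv hjK' jL.toRingEquiv hjL ψ h1) I
    have h3 := congrArg ψ (hinv I hI)
    rw [map_mul, h2, hI, map_one, ← pow_two] at h3
    have h4 : ψ c ^ orderOf c = 1 := by rw [← map_pow, pow_orderOf_eq_one, map_one]
    obtain ⟨k, hk⟩ := hodd
    rwa [hk, pow_succ, pow_mul, h3, one_pow, one_mul] at h4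
  obtain ⟨e, he⟩ := hmem
  obtain ⟨A, rfl⟩ := ClassGroup.mk0_surjective e
  rw [OddNorm.nCl_mk0] at he
  let B := OddNorm.cj jL.toRingEquiv A
  have hB1 : OddNorm.nCl K (ClassGroup.mk0 B) = c⁻¹ := by
    rw [OddNorm.nCl_mk0, OddNorm.rn_cj jK.toRingEquiv jL.toRingEquiv]
    · exact (inv_eq_of_mul_eq_one_right (hinv _ he)).symm
    · intro x
      apply Subtype.ext
      exact (hjL' _).trans (hjK' x).symm
  have hB2 : OddNorm.nCl Lp (ClassGroup.mk0 B) = OddNorm.nCl Lp (ClassGroup.mk0 A) := by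
    rw [OddNorm.nCl_mk0, OddNorm.nCl_mk0, OddNorm.rn_cj (RingEquiv.refl Lp) jL.toRingEquiv, OddNorm.cj_refl]
    intro x
    exact jL.commutes x
  let f : ClassGroup (𝓞 L) := ClassGroup.mk0 A * (ClassGroup.mk0 B)⁻¹
  have hf1 : OddNorm.nCl K f = c ^ 2 := by
    rw [map_mul, map_inv, hB1, OddNorm.nCl_mk0, he, inv_inv, pow_two]
  have hf2 : OddNorm.nCl Lp f = 1 := by
    rw [map_mul, map_inv, hB2, mul_inv_cancel]
  obtain ⟨a, b, hb, hab⟩ := Nat.exists_eq_two_pow_mul_odd (orderOf_pos f).ne'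
  obtain ⟨t, ht⟩ := exists_pow_eq_self_of_coprime (x := c) (n := 2 * 2 ^ a) (by
    rw [← pow_succ']
    exact Nat.Coprime.pow_left _ ((Nat.coprime_two_left).mpr hodd))
  refine ⟨(f ^ 2 ^ a) ^ t, ?_, ?_⟩
  · have h1 : ((f ^ 2 ^ a) ^ t) ^ b = 1 := by
      rw [← pow_mul, mul_comm t b, pow_mul, ← pow_mul f, ← hab, pow_orderOf_eq_one, one_pow]
    exact Odd.of_dvd_nat hb (orderOf_dvd_of_pow_eq_one h1)
  · obtain ⟨I', hI'⟩ := ClassGroup.mk0_surjective ((f ^ 2 ^ a) ^ t)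
    refine ⟨I', hI', ?_, OddNorm.rn K I', ?_, ?_⟩
    · rw [OddNorm.idealNorm_eq]
      apply (ClassGroup.mk0_eq_one_iff (OddNorm.rn Lp I').2).mp
      change ClassGroup.mk0 (OddNorm.rn Lp I') = 1
      rw [← OddNorm.nCl_mk0, hI', map_pow, map_pow, hf2, one_pow, one_pow]
    · rw [OddNorm.idealNorm_eq]
      rfl
    · rw [← OddNorm.nCl_mk0, hI', map_pow, map_pow, hf1, ← pow_mul c 2 (2 ^ a), ht]
end
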